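/- Let ρ be a quantum state on a finite-dimensional complex Hilbert space H, let {S_n}_{n≥1} satisfy Assumption 1, and suppose S_1 contains a state whose support contains supp(ρ). Assume D(ρ‖S_1) < D̃_∞(ρ‖S_1), where D(ρ‖S_1) = min_{σ ∈ S_1} D(ρ‖σ) and D̃_∞(ρ‖S_1) = min_{σ ∈ S_1} D̃_∞(ρ‖σ). Let r satisfy D(ρ‖S_1) < r < r_∞(ρ‖S_1), where r_∞(ρ‖S_1) = sup_{α ∈ [1,+∞)} { α D̃_∞(ρ‖S_1) − log(min_{σ ∈ S_1} Q̃_α(ρ‖σ)) }, and let (α₀,σ₀) ∈ (1,+∞) × S_1 maximize (α,σ) ↦ ((α−1)/α)(r − D̃_α(ρ‖σ)). Then: (i) the equality sc_r(ρ‖{S_n}) = ((α₀−1)/α₀)(r − D̃_{α₀}(ρ‖σ₀)) implies that sup_{t ∈ ℝ, τ ∈ S_1} Tr[τ σ₀^{−(1+it)/2} (σ₀^{(1−α₀)/(2α₀)} ρ σ₀^{(1−α₀)/(2α₀)})^{α₀} σ₀^{−(1−it)/2}] = Q̃_{α₀}(ρ‖σ₀); (ii) conversely, this trace condition implies the equality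 provided 1 < α₀ ≤ 2 and either r < D̃_∞(ρ‖S_1) or (d/dα) log Q̃_α(ρ‖σ₀) evaluated at α = α₀ is strictly less than D̃_∞(ρ‖σ₀); and (iii) if ρ and σ₀ commute, then both the trace condition and the equality hold without further assumptions. -/

import Mathlib

open scoped BigOperators ComplexOrder Classical
open MeasureTheory Filter Set

noncomputable section

namespace QHT

variable {ι : Type*} [Fintype ι] [DecidableEq ι]

/-- Generalized matrix power `A ^ w` (complex exponent `w`) of a Hermitian matrix,
via functional calculus on the support: the eigenvalue `0` is mapped to `0`. -/
def mpow (A : Matrix ι ι ℂ) (w : ℂ) : Matrix ι ι ℂ :=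
  if hA : A.IsHermitian then
    (hA.eigenvectorUnitary : Matrix ι ι ℂ) *
      Matrix.diagonal (fun i => if hA.eigenvalues i = 0 then 0 else (hA.eigenvalues i : ℂ) ^ w) *
      star (hA.eigenvectorUnitary : Matrix ι ι ℂ)
  else 0

/-- Matrix logarithm of a Hermitian matrix, taken on its support
(`Real.log 0 = 0`, so the kernel is mapped to `0`). -/
def mlog (A : Matrix ι ι ℂ) : Matrix ι ι ℂ :=
  if hA : A.IsHermitian then
    (hA.eigenvectorUnitary : Matrix ι ι ℂ) *
      Matrix.diagonal (fun i => (Real.log (hA.eigenvalues i) : ℂ)) *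
      star (hA.eigenvectorUnitary : Matrix ι ι ℂ)
  else 0

/-- The support of a matrix, i.e. its range as a linear map. -/
def msupp (A : Matrix ι ι ℂ) : Submodule ℂ (ι → ℂ) := LinearMap.range A.mulVecLin

/-- A quantum state: a positive semidefinite matrix of trace one. -/
def IsState (A : Matrix ι ι ℂ) : Prop := A.PosSemidef ∧ A.trace = 1

/-- Real part of the trace. -/
def rtr (A : Matrix ι ι ℂ) : ℝ := A.trace.re

/-- The Umegaki relative entropy `D(ρ‖σ)`, with value `+∞` when `supp ρ ⊄ supp σ`. -/
def relEnt (ρ σ : Matrix ι ι ℂ) : EReal :=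
  if msupp ρ ≤ msupp σ then ((rtr (ρ * (mlog ρ - mlog σ)) : ℝ) : EReal) else ⊤

/-- The polar of a set of matrices (intersected with the PSD cone). -/
def polar (S : Set (Matrix ι ι ℂ)) : Set (Matrix ι ι ℂ) :=
  {X | X.PosSemidef ∧ ∀ Y ∈ S, rtr (X * Y) ≤ 1}

/-- Entrywise Bochner integral of a matrix-valued function over `ℝ`. -/
def mInt (f : ℝ → Matrix ι ι ℂ) : Matrix ι ι ℂ :=
  Matrix.of fun i j => ∫ t : ℝ, f t i j

/-- Entrywise Bochner integral of a matrix-valued function over a set `s ⊆ ℝ`. -/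
def mIntOn (f : ℝ → Matrix ι ι ℂ) (s : Set ℝ) : Matrix ι ι ℂ :=
  Matrix.of fun i j => ∫ t in s, f t i j

/-- `sinc` function. -/
def sinc (s : ℝ) : ℝ := if s = 0 then 1 else Real.sin s / s

/-- The probability density `β_θ` from the paper (`β₀` is the `θ → 0` limit). -/
def betaDist (θ t : ℝ) : ℝ :=
  if θ = 0 then Real.pi / (2 * (Real.cosh (Real.pi * t) + 1))
  else Real.sin (θ * Real.pi) / (2 * θ * (Real.cosh (Real.pi * t) + Real.cos (θ * Real.pi)))

/-- `Q_{α,z}(ρ‖σ) = Tr[(ρ^{α/2z} σ^{(1-α)/z} ρ^{α/2z})^z]`. -/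
def Qaz (α z : ℝ) (ρ σ : Matrix ι ι ℂ) : ℝ :=
  rtr (mpow (mpow ρ ((α / (2 * z) : ℝ) : ℂ) * mpow σ (((1 - α) / z : ℝ) : ℂ) *
      mpow ρ ((α / (2 * z) : ℝ) : ℂ)) ((z : ℝ) : ℂ))

/-- The `α`-`z` Rényi relative entropy. -/
def Daz (α z : ℝ) (ρ σ : Matrix ι ι ℂ) : EReal :=
  if (α < 1 ∧ (ρ * σ).trace ≠ 0) ∨ msupp ρ ≤ msupp σ then
    (((α - 1)⁻¹ * Real.log (Qaz α z ρ σ) : ℝ) : EReal)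
  else ⊤

/-- `Q_α(ρ‖σ) = Tr[ρ^α σ^{1-α}]` (Petz). -/
def Qpetz (α : ℝ) (ρ σ : Matrix ι ι ℂ) : ℝ :=
  rtr (mpow ρ ((α : ℝ) : ℂ) * mpow σ (((1 - α) : ℝ) : ℂ))

/-- The Petz Rényi divergence. -/
def Dpetz (α : ℝ) (ρ σ : Matrix ι ι ℂ) : EReal :=
  if (α < 1 ∧ (ρ * σ).trace ≠ 0) ∨ msupp ρ ≤ msupp σ then
    (((α - 1)⁻¹ * Real.log (Qpetz α ρ σ) : ℝ) : EReal)
  else ⊤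

/-- `Q̃_α(ρ‖σ) = Tr[(σ^{(1-α)/2α} ρ σ^{(1-α)/2α})^α]` (sandwiched). -/
def Qsand (α : ℝ) (ρ σ : Matrix ι ι ℂ) : ℝ :=
  rtr (mpow (mpow σ (((1 - α) / (2 * α) : ℝ) : ℂ) * ρ * mpow σ (((1 - α) / (2 * α) : ℝ) : ℂ))
    ((α : ℝ) : ℂ))

/-- The sandwiched Rényi divergence. -/
def Dsand (α : ℝ) (ρ σ : Matrix ι ι ℂ) : EReal :=
  if (α < 1 ∧ (ρ * σ).trace ≠ 0) ∨ msupp ρ ≤ msupp σ then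
    (((α - 1)⁻¹ * Real.log (Qsand α ρ σ) : ℝ) : EReal)
  else ⊤

/-- `D̃_∞(ρ‖σ)`: the limit of `D̃_α(ρ‖σ)` as `α → +∞` (encoded as a `limsup`; the limit
exists by monotonicity in `α`). -/
def DsandInf (ρ σ : Matrix ι ι ℂ) : EReal :=
  Filter.limsup (fun α : ℝ => Dsand α ρ σ) Filter.atTop

/-- `χ_{α,z}(ρ,σ) = ρ^{α/2z} (ρ^{α/2z} σ^{(1-α)/z} ρ^{α/2z})^{z-1} ρ^{α/2z}`. -/
def chi (α z : ℝ) (ρ σ : Matrix ι ι ℂ) : Matrix ι ι ℂ :=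
  mpow ρ ((α / (2 * z) : ℝ) : ℂ) *
    mpow (mpow ρ ((α / (2 * z) : ℝ) : ℂ) * mpow σ (((1 - α) / z : ℝ) : ℂ) *
      mpow ρ ((α / (2 * z) : ℝ) : ℂ)) (((z - 1 : ℝ)) : ℂ) *
    mpow ρ ((α / (2 * z) : ℝ) : ℂ)

/-- The data-processing region `𝒟` for `α`-`z` Rényi relative entropies. -/
def Dregion : Set (ℝ × ℝ) :=
  {p | (0 < p.1 ∧ p.1 < 1 ∧ max p.1 (1 - p.1) ≤ p.2) ∨
       (1 < p.1 ∧ max (p.1 / 2) (p.1 - 1) ≤ p.2 ∧ p.2 ≤ p.1) ∨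
       (p.1 = 1 ∧ 0 < p.2)}

end QHT

namespace QHT

variable {ι : Type*} [Fintype ι] [DecidableEq ι]

/-! ### Tensor products and many copies -/

/-- Tensor product of a `d₁`- and a `d₂`-dimensional operator, as a `d₁d₂`-dimensional one. -/
def dtens {a b : ℕ} (A : Matrix (Fin a) (Fin a) ℂ) (B : Matrix (Fin b) (Fin b) ℂ) :
    Matrix (Fin (a * b)) (Fin (a * b)) ℂ :=
  Matrix.of fun x y =>
    A (finProdFinEquiv.symm x).1 (finProdFinEquiv.symm y).1 *
      B (finProdFinEquiv.symm x).2 (finProdFinEquiv.symm y).2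

/-- `ρ^{⊗n}` of a `d`-dimensional operator, as a `d^n`-dimensional operator. -/
def dpow {d : ℕ} (ρ : Matrix (Fin d) (Fin d) ℂ) (n : ℕ) :
    Matrix (Fin (d ^ n)) (Fin (d ^ n)) ℂ :=
  Matrix.of fun x y => ∏ i, ρ (finFunctionFinEquiv.symm x i) (finFunctionFinEquiv.symm y i)

/-- The action of a permutation of the `k` tensor factors on an operator on `(ℂ^d)^{⊗k}`. -/
def permMat (d k : ℕ) (π : Equiv.Perm (Fin k)) (A : Matrix (Fin (d ^ k)) (Fin (d ^ k)) ℂ) :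
    Matrix (Fin (d ^ k)) (Fin (d ^ k)) ℂ :=
  Matrix.of fun x y =>
    A (finFunctionFinEquiv ((finFunctionFinEquiv.symm x) ∘ π))
      (finFunctionFinEquiv ((finFunctionFinEquiv.symm y) ∘ π))

/-- `ρ^{⊗n}` of a `d`-dimensional operator, as an operator on `H^{⊗n}` with `H = ℂ^d`,
indexed by tuples. -/
def tpow {d : ℕ} (ρ : Matrix (Fin d) (Fin d) ℂ) (n : ℕ) :
    Matrix (Fin n → Fin d) (Fin n → Fin d) ℂ :=
  Matrix.of fun x y => ∏ i, ρ (x i) (y i)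

/-- Tensor product of an operator on `H^{⊗m}` and an operator on `H^{⊗n}`, as an
operator on `H^{⊗(m+n)}`. -/
def tensOp {d m n : ℕ} (A : Matrix (Fin m → Fin d) (Fin m → Fin d) ℂ)
    (B : Matrix (Fin n → Fin d) (Fin n → Fin d) ℂ) :
    Matrix (Fin (m + n) → Fin d) (Fin (m + n) → Fin d) ℂ :=
  Matrix.of fun x y =>
    A (fun i => x (Fin.castAdd n i)) (fun i => y (Fin.castAdd n i)) *
      B (fun j => x (Fin.natAdd m j)) (fun j => y (Fin.natAdd m j))

/-- Permutation action on operators on `H^{⊗k}`. -/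
def permOp {d k : ℕ} (π : Equiv.Perm (Fin k))
    (A : Matrix (Fin k → Fin d) (Fin k → Fin d) ℂ) :
    Matrix (Fin k → Fin d) (Fin k → Fin d) ℂ :=
  Matrix.of fun x y => A (x ∘ π) (y ∘ π)

/-! ### Hypothesis testing -/

/-- A test: an operator `T` with `0 ≤ T ≤ I`. -/
def IsTest (T : Matrix ι ι ℂ) : Prop := T.PosSemidef ∧ (1 - T).PosSemidef

/-- Type I error `α_n(ρ|T) = Tr[(I - T) ρ^{⊗n}]`. -/
def typeI {d : ℕ} (ρ : Matrix (Fin d) (Fin d) ℂ) (n : ℕ)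
    (T : Matrix (Fin n → Fin d) (Fin n → Fin d) ℂ) : ℝ :=
  rtr ((1 - T) * tpow ρ n)

/-- Type II error `β_n(S|T) = sup_{σ ∈ S} Tr[σ T]`. -/
def typeII {d n : ℕ} (S : Set (Matrix (Fin n → Fin d) (Fin n → Fin d) ℂ))
    (T : Matrix (Fin n → Fin d) (Fin n → Fin d) ℂ) : ℝ :=
  sSup ((fun σ => rtr (σ * T)) '' S)

/-- `- log x`, valued in `EReal`, with `- log x = +∞` for `x ≤ 0`. -/
def negLog (x : ℝ) : EReal := if x ≤ 0 then ⊤ else ((- Real.log x : ℝ) : EReal)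

/-- The exponential rate `-(1/n) log x`. -/
def rate (n : ℕ) (x : ℝ) : EReal := (((n : ℝ)⁻¹ : ℝ) : EReal) * negLog x

/-- The Stein exponent `s(ρ‖{S_n})`. -/
def steinExp {d : ℕ} (ρ : Matrix (Fin d) (Fin d) ℂ)
    (S : (n : ℕ) → Set (Matrix (Fin n → Fin d) (Fin n → Fin d) ℂ)) : EReal :=
  sSup ((fun r : ℝ => (r : EReal)) ''
    {r : ℝ | 0 ≤ r ∧ ∃ T : (n : ℕ) → Matrix (Fin n → Fin d) (Fin n → Fin d) ℂ,
      (∀ n, IsTest (T n)) ∧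
      (r : EReal) ≤ Filter.liminf (fun n => rate n (typeII (S n) (T n))) Filter.atTop ∧
      Filter.Tendsto (fun n => typeI ρ n (T n)) Filter.atTop (nhds 0)})

/-- The Chernoff exponent `c(ρ‖{S_n})`. -/
def chernoffExp {d : ℕ} (ρ : Matrix (Fin d) (Fin d) ℂ)
    (S : (n : ℕ) → Set (Matrix (Fin n → Fin d) (Fin n → Fin d) ℂ)) : EReal :=
  Filter.liminf (fun n =>
    rate n (sInf ((fun T => typeI ρ n T + typeII (S n) T) '' {T | IsTest T}))) Filter.atTop

/-- The Hoeffding (direct) exponent `d_r(ρ‖{S_n})`. -/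
def hoeffdingExp {d : ℕ} (r : ℝ) (ρ : Matrix (Fin d) (Fin d) ℂ)
    (S : (n : ℕ) → Set (Matrix (Fin n → Fin d) (Fin n → Fin d) ℂ)) : EReal :=
  ⨆ T : {T : (n : ℕ) → Matrix (Fin n → Fin d) (Fin n → Fin d) ℂ //
      (∀ n, IsTest (T n)) ∧
      (r : EReal) ≤ Filter.liminf (fun n => rate n (typeII (S n) (T n))) Filter.atTop},
    Filter.liminf (fun n => rate n (typeI ρ n (T.1 n))) Filter.atTop

/-- The strong converse exponent `sc_r(ρ‖{S_n})`. -/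
def scExp {d : ℕ} (r : ℝ) (ρ : Matrix (Fin d) (Fin d) ℂ)
    (S : (n : ℕ) → Set (Matrix (Fin n → Fin d) (Fin n → Fin d) ℂ)) : EReal :=
  ⨅ T : {T : (n : ℕ) → Matrix (Fin n → Fin d) (Fin n → Fin d) ℂ //
      (∀ n, IsTest (T n)) ∧
      (r : EReal) ≤ Filter.liminf (fun n => rate n (typeII (S n) (T n))) Filter.atTop},
    Filter.limsup (fun n => rate n (1 - typeI ρ n (T.1 n))) Filter.atTop

/-- Assumption 1 of the paper for a family `{S_n}_{n ≥ 1}` of sets of operators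
on `H^{⊗n}`, `H = ℂ^d`: each `S_n` is a convex compact set of positive semidefinite
operators, closed under tensor products, and with polar sets closed under tensor
products. -/
structure Assumption1 {d : ℕ}
    (S : (n : ℕ) → Set (Matrix (Fin n → Fin d) (Fin n → Fin d) ℂ)) : Prop where
  psd : ∀ n, 1 ≤ n → ∀ X ∈ S n, X.PosSemidef
  convex : ∀ n, 1 ≤ n → Convex ℝ (S n)
  compact : ∀ n, 1 ≤ n → IsCompact (S n)
  tens : ∀ m n, 1 ≤ m → 1 ≤ n → ∀ A ∈ S m, ∀ B ∈ S n, tensOp A B ∈ S (m + n)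
  polarTens : ∀ m n, 1 ≤ m → 1 ≤ n →
    ∀ A ∈ polar (S m), ∀ B ∈ polar (S n), tensOp A B ∈ polar (S (m + n))

/-- Assumption 1′ of the paper for a dimension-indexed family `{S_d}_{d ≥ 1}`. -/
structure Assumption1' (S : (d : ℕ) → Set (Matrix (Fin d) (Fin d) ℂ)) : Prop where
  psd : ∀ d, 1 ≤ d → ∀ X ∈ S d, X.PosSemidef
  convex : ∀ d, 1 ≤ d → Convex ℝ (S d)
  compact : ∀ d, 1 ≤ d → IsCompact (S d)
  tens : ∀ d₁ d₂, 1 ≤ d₁ → 1 ≤ d₂ → ∀ A ∈ S d₁, ∀ B ∈ S d₂, dtens A B ∈ S (d₁ * d₂)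
  polarTens : ∀ d₁ d₂, 1 ≤ d₁ → 1 ≤ d₂ →
    ∀ A ∈ polar (S d₁), ∀ B ∈ polar (S d₂), dtens A B ∈ polar (S (d₁ * d₂))

end QHT

namespace QHT

/-- The objective `((α-1)/α)(r - D̃_α(ρ‖σ))` of the strong converse exponent. -/
noncomputable def scObj {ι : Type*} [Fintype ι] [DecidableEq ι]
    (r : ℝ) (ρ σ : Matrix ι ι ℂ) (α : ℝ) : EReal :=
  (((α - 1) / α : ℝ) : EReal) * ((r : EReal) - Dsand α ρ σ)

set_option linter.unusedSectionVars false
set_option linter.unusedVariables false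
set_option linter.unusedSimpArgs false
set_option linter.style.whitespace false

/-- Functional calculus of a Hermitian matrix. -/
def fc {κ : Type*} [Fintype κ] [DecidableEq κ] (f : ℝ → ℂ) (A : Matrix κ κ ℂ) : Matrix κ κ ℂ :=
  if hA : A.IsHermitian then
    (hA.eigenvectorUnitary : Matrix κ κ ℂ) *
      Matrix.diagonal (fun i => f (hA.eigenvalues i)) *
      star (hA.eigenvectorUnitary : Matrix κ κ ℂ)
  else 0

/-- The scalar function underlying `mpow`. -/
def pw (w : ℂ) (x : ℝ) : ℂ := if x = 0 then 0 else (x : ℂ) ^ w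

section Basic

variable {κ κ' : Type*} [Fintype κ] [DecidableEq κ] [Fintype κ'] [DecidableEq κ']

theorem mpow_eq_fc (A : Matrix κ κ ℂ) (w : ℂ) : mpow A w = fc (pw w) A := rfl

/-- `V` diagonalises a matrix with real spectrum `a`. -/
structure Diag (A V : Matrix κ κ ℂ) (a : κ → ℝ) : Prop where
  l : Matrix.conjTranspose V * V = 1
  r : V * Matrix.conjTranspose V = 1
  eq : A = V * Matrix.diagonal (fun i => (a i : ℂ)) * Matrix.conjTranspose V

theorem exists_diag {A : Matrix κ κ ℂ} (hA : A.IsHermitian) :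
    Diag A (hA.eigenvectorUnitary : Matrix κ κ ℂ) hA.eigenvalues where
  l := Unitary.coe_star_mul_self hA.eigenvectorUnitary
  r := Unitary.coe_mul_star_self hA.eigenvectorUnitary
  eq := by
    have := hA.spectral_theorem
    rw [Unitary.conjStarAlgAut_apply] at this
    exact this

theorem Diag.isHermitian {A V : Matrix κ κ ℂ} {a : κ → ℝ} (h : Diag A V a) : A.IsHermitian := by
  rw [h.eq]
  apply Matrix.isHermitian_mul_mul_conjTranspose
  exact Matrix.isHermitian_diagonal_of_self_adjoint _ (by ext i; simp)

theorem diagonal_intertwine {a : κ → ℝ} {b : κ' → ℝ} {N : Matrix κ κ' ℂ} (f : ℝ → ℂ)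
    (h : Matrix.diagonal (fun i => (a i : ℂ)) * N = N * Matrix.diagonal (fun i => (b i : ℂ))) :
    Matrix.diagonal (fun i => f (a i)) * N = N * Matrix.diagonal (fun i => f (b i)) := by
  ext i j
  have hij := congrFun (congrFun h i) j
  rw [Matrix.diagonal_mul, Matrix.mul_diagonal] at hij ⊢
  by_cases hN : N i j = 0
  · simp [hN]
  · have h1 : ((a i : ℝ) : ℂ) = (b j : ℂ) := by
      apply mul_right_cancel₀ hN; rw [hij]; ring
    have h2 : a i = b j := by exact_mod_cast h1
    rw [h2]; ring

theorem diag_intertwine {A V : Matrix κ κ ℂ} {B W : Matrix κ' κ' ℂ} {a : κ → ℝ} {b : κ' → ℝ}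
    (hA : Diag A V a) (hB : Diag B W b) {M : Matrix κ κ' ℂ} (h : A * M = M * B) (f : ℝ → ℂ) :
    V * Matrix.diagonal (fun i => f (a i)) * V.conjTranspose * M =
      M * (W * Matrix.diagonal (fun i => f (b i)) * W.conjTranspose) := by
  have h1 : Matrix.diagonal (fun i => (a i : ℂ)) * (V.conjTranspose * M * W) =
      (V.conjTranspose * M * W) * Matrix.diagonal (fun i => (b i : ℂ)) := by
    have e1 : V.conjTranspose * (A * M) * W =
        Matrix.diagonal (fun i => (a i : ℂ)) * (V.conjTranspose * M * W) := by
      rw [hA.eq]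
      calc _ = (V.conjTranspose * V) * Matrix.diagonal (fun i => (a i : ℂ)) *
            (V.conjTranspose * M * W) := by simp only [Matrix.mul_assoc]
        _ = _ := by rw [hA.l, Matrix.one_mul]
    have e2 : V.conjTranspose * (M * B) * W =
        (V.conjTranspose * M * W) * Matrix.diagonal (fun i => (b i : ℂ)) := by
      rw [hB.eq]
      calc _ = (V.conjTranspose * M * W) * Matrix.diagonal (fun i => (b i : ℂ)) *
            (W.conjTranspose * W) := by simp only [Matrix.mul_assoc]
        _ = _ := by rw [hB.l, Matrix.mul_one]
    rw [← e1, ← e2, h]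
  have h2 := diagonal_intertwine f h1
  calc _ = V * (Matrix.diagonal (fun i => f (a i)) * (V.conjTranspose * M * W)) *
        W.conjTranspose := by
        simp only [Matrix.mul_assoc]; rw [hB.r, Matrix.mul_one]
    _ = (V * V.conjTranspose) * M * (W * Matrix.diagonal (fun i => f (b i)) * W.conjTranspose) := by
        rw [h2]; simp only [Matrix.mul_assoc]
    _ = _ := by rw [hA.r, Matrix.one_mul]

theorem Diag.fc_eq {A V : Matrix κ κ ℂ} {a : κ → ℝ} (h : Diag A V a) (f : ℝ → ℂ) :
    fc f A = V * Matrix.diagonal (fun i => f (a i)) * V.conjTranspose := by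
  have h1 := diag_intertwine (exists_diag h.isHermitian) h (M := 1) (by simp) f
  rw [Matrix.mul_one, Matrix.one_mul] at h1
  rw [← h1, fc, dif_pos h.isHermitian]; rfl

theorem fc_intertwine {A : Matrix κ κ ℂ} {B : Matrix κ' κ' ℂ} (hA : A.IsHermitian)
    (hB : B.IsHermitian) {M : Matrix κ κ' ℂ} (h : A * M = M * B) (f : ℝ → ℂ) :
    fc f A * M = M * fc f B := by
  rw [(exists_diag hA).fc_eq, (exists_diag hB).fc_eq]
  exact diag_intertwine (exists_diag hA) (exists_diag hB) h f

theorem diag_diagonal (a : κ → ℝ) : Diag (Matrix.diagonal (fun i => (a i : ℂ))) 1 a :=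
  ⟨by simp, by simp, by simp⟩

theorem fc_diagonal (f : ℝ → ℂ) (a : κ → ℝ) :
    fc f (Matrix.diagonal (fun i => (a i : ℂ))) = Matrix.diagonal (fun i => f (a i)) := by
  rw [(diag_diagonal a).fc_eq]; simp

theorem Diag.conj {A V : Matrix κ κ ℂ} {a : κ → ℝ} (h : Diag A V a) {U : Matrix κ κ ℂ}
    (hl : U.conjTranspose * U = 1) (hr : U * U.conjTranspose = 1) :
    Diag (U * A * U.conjTranspose) (U * V) a where
  l := by
    rw [Matrix.conjTranspose_mul, Matrix.mul_assoc, ← Matrix.mul_assoc _ U, hl, Matrix.one_mul, h.l]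
  r := by
    rw [Matrix.conjTranspose_mul, Matrix.mul_assoc, ← Matrix.mul_assoc V, h.r, Matrix.one_mul, hr]
  eq := by rw [h.eq, Matrix.conjTranspose_mul]; simp only [Matrix.mul_assoc]

theorem fc_conj (f : ℝ → ℂ) {A U : Matrix κ κ ℂ} (hA : A.IsHermitian)
    (hl : U.conjTranspose * U = 1) (hr : U * U.conjTranspose = 1) :
    fc f (U * A * U.conjTranspose) = U * fc f A * U.conjTranspose := by
  rw [((exists_diag hA).conj hl hr).fc_eq, (exists_diag hA).fc_eq, Matrix.conjTranspose_mul]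
  simp only [Matrix.mul_assoc]

theorem Diag.fc_mul {A V : Matrix κ κ ℂ} {a : κ → ℝ} (h : Diag A V a) (f g : ℝ → ℂ) :
    fc f A * fc g A = fc (fun x => f x * g x) A := by
  rw [h.fc_eq, h.fc_eq, h.fc_eq]
  calc _ = V * Matrix.diagonal (fun i => f (a i)) * (V.conjTranspose * V) *
        Matrix.diagonal (fun i => g (a i)) * V.conjTranspose := by simp only [Matrix.mul_assoc]
    _ = _ := by
      rw [h.l, Matrix.mul_one, Matrix.mul_assoc V, Matrix.diagonal_mul_diagonal]

theorem fc_mul {A : Matrix κ κ ℂ} (hA : A.IsHermitian) (f g : ℝ → ℂ) :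
    fc f A * fc g A = fc (fun x => f x * g x) A := (exists_diag hA).fc_mul f g

theorem Diag.fc_congr {A V : Matrix κ κ ℂ} {a : κ → ℝ} (h : Diag A V a) {f g : ℝ → ℂ}
    (hfg : ∀ i, f (a i) = g (a i)) : fc f A = fc g A := by
  rw [h.fc_eq, h.fc_eq]; simp only [hfg]

theorem fc_id {A : Matrix κ κ ℂ} (hA : A.IsHermitian) : fc (fun x => (x : ℂ)) A = A := by
  rw [(exists_diag hA).fc_eq]; exact (exists_diag hA).eq.symm

theorem fc_one {A : Matrix κ κ ℂ} (hA : A.IsHermitian) : fc (fun _ => 1) A = 1 := by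
  rw [(exists_diag hA).fc_eq, Matrix.diagonal_one, Matrix.mul_one, (exists_diag hA).r]

theorem Diag.trace_fc {A V : Matrix κ κ ℂ} {a : κ → ℝ} (h : Diag A V a) (f : ℝ → ℂ) :
    (fc f A).trace = ∑ i, f (a i) := by
  rw [h.fc_eq, Matrix.trace_mul_comm, ← Matrix.mul_assoc, h.l, Matrix.one_mul,
    Matrix.trace_diagonal]

theorem fc_conjTranspose (f : ℝ → ℂ) {A : Matrix κ κ ℂ} (hA : A.IsHermitian) :
    (fc f A).conjTranspose = fc (fun x => star (f x)) A := by
  rw [(exists_diag hA).fc_eq, (exists_diag hA).fc_eq, Matrix.conjTranspose_mul,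
    Matrix.conjTranspose_mul, Matrix.conjTranspose_conjTranspose, Matrix.diagonal_conjTranspose,
    Matrix.mul_assoc]
  rfl

theorem fc_isHermitian (f : ℝ → ℝ) {A : Matrix κ κ ℂ} (hA : A.IsHermitian) :
    (fc (fun x => (f x : ℂ)) A).IsHermitian := by
  rw [Matrix.IsHermitian, fc_conjTranspose _ hA]; simp

theorem Diag.diag_fc {A V : Matrix κ κ ℂ} {a : κ → ℝ} (h : Diag A V a) (f : ℝ → ℝ) :
    Diag (fc (fun x => (f x : ℂ)) A) V (fun i => f (a i)) :=
  ⟨h.l, h.r, by rw [h.fc_eq]⟩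

theorem Diag.posSemidef {A V : Matrix κ κ ℂ} {a : κ → ℝ} (h : Diag A V a) (ha : ∀ i, 0 ≤ a i) :
    A.PosSemidef := by
  rw [h.eq]
  apply Matrix.PosSemidef.mul_mul_conjTranspose_same
  rw [Matrix.posSemidef_diagonal_iff]
  intro i
  exact_mod_cast ha i

theorem Diag.nonneg {A V : Matrix κ κ ℂ} {a : κ → ℝ} (h : Diag A V a) (hA : A.PosSemidef) (i) :
    0 ≤ a i := by
  have h1 : Matrix.diagonal (fun i => (a i : ℂ)) = V.conjTranspose * A * V := by
    rw [h.eq]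
    calc _ = (V.conjTranspose * V) * Matrix.diagonal (fun i => (a i : ℂ)) *
          (V.conjTranspose * V) := by rw [h.l]; simp
      _ = _ := by simp only [Matrix.mul_assoc]
  have h2 := hA.conjTranspose_mul_mul_same V
  rw [← h1, Matrix.posSemidef_diagonal_iff] at h2
  exact_mod_cast h2 i

theorem exists_diag_psd {A : Matrix κ κ ℂ} (hA : A.PosSemidef) :
    ∃ V a, Diag A V a ∧ ∀ i, 0 ≤ a i :=
  ⟨_, _, exists_diag hA.1, (exists_diag hA.1).nonneg hA⟩

theorem fc_posSemidef {f : ℝ → ℝ} {A : Matrix κ κ ℂ} (hA : A.PosSemidef)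
    (hf : ∀ x, 0 ≤ x → 0 ≤ f x) : (fc (fun x => (f x : ℂ)) A).PosSemidef := by
  obtain ⟨V, a, h, ha⟩ := exists_diag_psd hA
  exact (h.diag_fc f).posSemidef fun i => hf _ (ha i)

theorem fc_fc {A : Matrix κ κ ℂ} (hA : A.IsHermitian) (f : ℝ → ℝ) (g : ℝ → ℂ) :
    fc g (fc (fun x => (f x : ℂ)) A) = fc (fun x => g (f x)) A := by
  rw [((exists_diag hA).diag_fc f).fc_eq, (exists_diag hA).fc_eq]

end Basic

section RealPower

variable {κ κ' : Type*} [Fintype κ] [DecidableEq κ] [Fintype κ'] [DecidableEq κ']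

/-- Real power of a positive semidefinite matrix. -/
def rp (s : ℝ) (A : Matrix κ κ ℂ) : Matrix κ κ ℂ := fc (fun x => ((x ^ s : ℝ) : ℂ)) A

theorem pw_real {s : ℝ} (hs : s ≠ 0) {x : ℝ} (hx : 0 ≤ x) :
    pw (s : ℂ) x = ((x ^ s : ℝ) : ℂ) := by
  rw [pw]
  split_ifs with h
  · rw [h, Real.zero_rpow hs]; simp
  · rw [Complex.ofReal_cpow hx]

theorem mpow_eq_rp {A : Matrix κ κ ℂ} (hA : A.PosSemidef) {s : ℝ} (hs : s ≠ 0) :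
    mpow A (s : ℂ) = rp s A := by
  obtain ⟨V, a, h, ha⟩ := exists_diag_psd hA
  rw [mpow_eq_fc, rp]
  exact h.fc_congr fun i => pw_real hs (ha i)

theorem rp_posSemidef {A : Matrix κ κ ℂ} (hA : A.PosSemidef) (s : ℝ) : (rp s A).PosSemidef :=
  fc_posSemidef hA fun x hx => Real.rpow_nonneg hx s

theorem rp_isHermitian {A : Matrix κ κ ℂ} (hA : A.IsHermitian) (s : ℝ) : (rp s A).IsHermitian :=
  fc_isHermitian _ hA

theorem rp_mul {A : Matrix κ κ ℂ} (hA : A.PosSemidef) {s t : ℝ} (h : s + t ≠ 0) :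
    rp s A * rp t A = rp (s + t) A := by
  obtain ⟨V, a, hd, ha⟩ := exists_diag_psd hA
  rw [rp, rp, rp, hd.fc_mul]
  apply hd.fc_congr
  intro i
  rw [Real.rpow_add' (ha i) h]; simp

theorem rp_one {A : Matrix κ κ ℂ} (hA : A.IsHermitian) : rp 1 A = A := by
  simp only [rp, Real.rpow_one]; exact fc_id hA

theorem rp_diagonal (s : ℝ) (a : κ → ℝ) :
    rp s (Matrix.diagonal (fun i => (a i : ℂ))) = Matrix.diagonal (fun i => ((a i ^ s : ℝ) : ℂ)) :=
  fc_diagonal _ _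

theorem Diag.rp_diag {A V : Matrix κ κ ℂ} {a : κ → ℝ} (h : Diag A V a) (s : ℝ) :
    Diag (rp s A) V (fun i => a i ^ s) := h.diag_fc _

theorem Diag.rtr_rp {A V : Matrix κ κ ℂ} {a : κ → ℝ} (h : Diag A V a) (s : ℝ) :
    rtr (rp s A) = ∑ i, a i ^ s := by
  rw [rtr, rp, h.trace_fc, ← Complex.ofReal_sum, Complex.ofReal_re]

/-- `(C Cᴴ)^s C = C (Cᴴ C)^s`. -/
theorem rp_mul_comm_conj (C : Matrix κ κ' ℂ) (s : ℝ) :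
    rp s (C * C.conjTranspose) * C = C * rp s (C.conjTranspose * C) :=
  fc_intertwine (Matrix.isHermitian_mul_conjTranspose_self C)
    (Matrix.isHermitian_conjTranspose_mul_self C) (by rw [Matrix.mul_assoc]) _

theorem rp_swap (C : Matrix κ κ' ℂ) {s : ℝ} (hs : 0 < s) :
    C * rp (s - 1) (C.conjTranspose * C) * C.conjTranspose = rp s (C * C.conjTranspose) := by
  rw [← rp_mul_comm_conj, Matrix.mul_assoc]
  have h := Matrix.posSemidef_self_mul_conjTranspose C
  nth_rw 2 [← rp_one h.1]
  rw [rp_mul h (by linarith)]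
  congr 1; ring

theorem rtr_mul_comm (A : Matrix κ κ' ℂ) (B : Matrix κ' κ ℂ) : rtr (A * B) = rtr (B * A) := by
  rw [rtr, rtr, Matrix.trace_mul_comm]

theorem rtr_rp_swap (C : Matrix κ κ' ℂ) {s : ℝ} (hs : 0 < s) :
    rtr (rp s (C * C.conjTranspose)) = rtr (rp s (C.conjTranspose * C)) := by
  rw [← rp_swap C hs, rtr_mul_comm, ← Matrix.mul_assoc]
  have h := Matrix.posSemidef_conjTranspose_mul_self C
  nth_rw 1 [← rp_one h.1]
  rw [rp_mul h (by linarith)]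
  congr 2; ring

theorem rtr_add (A B : Matrix κ κ ℂ) : rtr (A + B) = rtr A + rtr B := by
  simp [rtr, Matrix.trace_add]

theorem rtr_sub (A B : Matrix κ κ ℂ) : rtr (A - B) = rtr A - rtr B := by
  simp [rtr, Matrix.trace_sub]

theorem rtr_smul (c : ℝ) (A : Matrix κ κ ℂ) : rtr ((c : ℂ) • A) = c * rtr A := by
  simp [rtr, Matrix.trace_smul]

theorem rtr_nonneg {A : Matrix κ κ ℂ} (hA : A.PosSemidef) : 0 ≤ rtr A :=
  (Complex.le_def.1 hA.trace_nonneg).1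

theorem exists_factor {B : Matrix κ κ ℂ} (hB : B.PosSemidef) :
    ∃ C : Matrix κ κ ℂ, B = C.conjTranspose * C := by
  refine ⟨rp (1 / 2) B, ?_⟩
  rw [(rp_isHermitian hB.1 _).eq, rp_mul hB (by norm_num)]
  norm_num [rp_one hB.1]

theorem rtr_mul_nonneg {A B : Matrix κ κ ℂ} (hA : A.PosSemidef) (hB : B.PosSemidef) :
    0 ≤ rtr (A * B) := by
  obtain ⟨C, rfl⟩ := exists_factor hB
  rw [← Matrix.mul_assoc, rtr_mul_comm, ← Matrix.mul_assoc]
  exact rtr_nonneg (hA.mul_mul_conjTranspose_same C)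

theorem rtr_mul_mono {A B T : Matrix κ κ ℂ} (h : (B - A).PosSemidef) (hT : T.PosSemidef) :
    rtr (T * A) ≤ rtr (T * B) := by
  have := rtr_mul_nonneg hT h
  rw [Matrix.mul_sub, rtr_sub] at this
  linarith

end RealPower

section Klein

variable {κ κ' : Type*} [Fintype κ] [DecidableEq κ] [Fintype κ'] [DecidableEq κ']

theorem rpow_tangent {s a b : ℝ} (hs : 1 < s) (ha : 0 ≤ a) (hb : 0 ≤ b) :
    a ^ s + s * (a ^ (s - 1) * (b - a)) ≤ b ^ s := by
  rcases ha.eq_or_lt with rfl | ha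
  · rw [Real.zero_rpow (by linarith), Real.zero_rpow (by linarith)]
    simpa using Real.rpow_nonneg hb s
  · have h1 : -1 ≤ (b - a) / a := by
      rw [le_div_iff₀ ha]; linarith
    have h2 := one_add_mul_self_le_rpow_one_add h1 hs.le
    have h3 : 1 + (b - a) / a = b / a := by field_simp; ring
    rw [h3, Real.div_rpow hb ha.le, le_div_iff₀ (Real.rpow_pos_of_pos ha s)] at h2
    rw [Real.rpow_sub_one ha.ne']
    calc _ = (1 + s * ((b - a) / a)) * a ^ s := by field_simp
      _ ≤ _ := h2

theorem sum_normSq_row {N : Matrix κ κ ℂ} (h : N * N.conjTranspose = 1) (i : κ) :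
    ∑ j, Complex.normSq (N i j) = 1 := by
  have := congrFun (congrFun h i) i
  rw [Matrix.mul_apply, Matrix.one_apply_eq] at this
  have h2 : ((∑ j, Complex.normSq (N i j) : ℝ) : ℂ) = 1 := by
    rw [← this]; push_cast
    refine Finset.sum_congr rfl fun j _ => ?_
    rw [Complex.normSq_eq_conj_mul_self, Matrix.conjTranspose_apply, mul_comm]; rfl
  exact_mod_cast h2

theorem sum_normSq_col {N : Matrix κ κ ℂ} (h : N.conjTranspose * N = 1) (j : κ) :
    ∑ i, Complex.normSq (N i j) = 1 := by
  have := sum_normSq_row (N := N.conjTranspose) (by rwa [Matrix.conjTranspose_conjTranspose]) j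
  simpa [Matrix.conjTranspose_apply] using this

theorem rtr_mul_diag {A B V W : Matrix κ κ ℂ} {a b : κ → ℝ} (hA : Diag A V a) (hB : Diag B W b) :
    rtr (A * B) = ∑ i, ∑ j, a i * b j * Complex.normSq ((V.conjTranspose * W) i j) := by
  have h1 : (A * B).trace = (Matrix.diagonal (fun i => (a i : ℂ)) * (V.conjTranspose * W) *
      Matrix.diagonal (fun i => (b i : ℂ)) * (V.conjTranspose * W).conjTranspose).trace := by
    rw [hA.eq, hB.eq, Matrix.conjTranspose_mul, Matrix.conjTranspose_conjTranspose]
    rw [Matrix.mul_assoc V, Matrix.mul_assoc V, Matrix.trace_mul_comm]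
    simp only [Matrix.mul_assoc]
  rw [rtr, h1, Matrix.trace]
  rw [Complex.re_sum]
  refine Finset.sum_congr rfl fun i _ => ?_
  rw [Matrix.diag_apply, Matrix.mul_apply, Complex.re_sum]
  refine Finset.sum_congr rfl fun j _ => ?_
  rw [Matrix.mul_diagonal, Matrix.diagonal_mul, Matrix.conjTranspose_apply]
  set z := (V.conjTranspose * W) i j
  have : (a i : ℂ) * z * (b j : ℂ) * star z = ((a i * b j * Complex.normSq z : ℝ) : ℂ) := by
    push_cast; rw [Complex.normSq_eq_conj_mul_self]
    show _ * _ * _ * (starRingEnd ℂ) z = _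
    ring
  rw [this, Complex.ofReal_re]

/-- Klein's inequality for the power function. -/
theorem klein {A B : Matrix κ κ ℂ} (hA : A.PosSemidef) (hB : B.PosSemidef) {s : ℝ} (hs : 1 < s) :
    rtr (rp s A) + s * rtr (rp (s - 1) A * (B - A)) ≤ rtr (rp s B) := by
  obtain ⟨V, a, dA, ha⟩ := exists_diag_psd hA
  obtain ⟨W, b, dB, hb⟩ := exists_diag_psd hB
  have hl : (V.conjTranspose * W) * (V.conjTranspose * W).conjTranspose = 1 := by
    rw [Matrix.conjTranspose_mul, Matrix.conjTranspose_conjTranspose, Matrix.mul_assoc,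
      ← Matrix.mul_assoc W, dB.r, Matrix.one_mul, dA.l]
  have hr : (V.conjTranspose * W).conjTranspose * (V.conjTranspose * W) = 1 := by
    rw [Matrix.conjTranspose_mul, Matrix.conjTranspose_conjTranspose, Matrix.mul_assoc,
      ← Matrix.mul_assoc V, dA.r, Matrix.one_mul, dB.l]
  have h1 : rtr (rp s A) = ∑ i, ∑ j, a i ^ s * Complex.normSq ((V.conjTranspose * W) i j) := by
    rw [dA.rtr_rp]
    refine Finset.sum_congr rfl fun i _ => ?_
    rw [← Finset.mul_sum, sum_normSq_row hl, mul_one]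
  have h2 : rtr (rp s B) = ∑ i, ∑ j, b j ^ s * Complex.normSq ((V.conjTranspose * W) i j) := by
    rw [dB.rtr_rp, Finset.sum_comm]
    refine Finset.sum_congr rfl fun i _ => ?_
    rw [← Finset.mul_sum, sum_normSq_col hr, mul_one]
  have h3 : rtr (rp (s - 1) A * A) = ∑ i, ∑ j, a i ^ (s - 1) * a i *
      Complex.normSq ((V.conjTranspose * W) i j) := by
    rw [rtr_mul_diag (dA.rp_diag (s - 1)) dA]
    refine Finset.sum_congr rfl fun i _ => ?_
    rw [← Finset.mul_sum, sum_normSq_row hl, dA.l, Finset.sum_eq_single i]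
    · simp
    · intro j _ hj; rw [Matrix.one_apply_ne hj.symm]; simp
    · simp
  rw [Matrix.mul_sub, rtr_sub, h1, h2, h3, rtr_mul_diag (dA.rp_diag (s - 1)) dB]
  rw [← Finset.sum_sub_distrib, Finset.mul_sum, ← Finset.sum_add_distrib]
  refine Finset.sum_le_sum fun i _ => ?_
  rw [← Finset.sum_sub_distrib, Finset.mul_sum, ← Finset.sum_add_distrib]
  refine Finset.sum_le_sum fun j _ => ?_
  have := mul_le_mul_of_nonneg_right (rpow_tangent hs (ha i) (hb j))
    (Complex.normSq_nonneg ((V.conjTranspose * W) i j))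
  linarith

theorem rtr_rp_mono {A B : Matrix κ κ ℂ} (hA : A.PosSemidef) (hB : B.PosSemidef)
    (h : (B - A).PosSemidef) {s : ℝ} (hs : 1 < s) : rtr (rp s A) ≤ rtr (rp s B) := by
  have h1 := klein hA hB hs
  have h2 := rtr_mul_nonneg (rp_posSemidef hA (s - 1)) h
  nlinarith

theorem rtr_diagonal_mul (f : κ → ℝ) (M : Matrix κ κ ℂ) :
    rtr (Matrix.diagonal (fun i => (f i : ℂ)) * M) = ∑ i, f i * (M i i).re := by
  rw [rtr, Matrix.trace, Complex.re_sum]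
  refine Finset.sum_congr rfl fun i _ => ?_
  rw [Matrix.diag_apply, Matrix.diagonal_mul, Complex.re_ofReal_mul]

theorem peierls {A E : Matrix κ κ ℂ} (hA : A.PosSemidef) (hl : E.conjTranspose * E = 1)
    (hr : E * E.conjTranspose = 1) {s : ℝ} (hs : 1 < s) :
    ∑ j, ((E.conjTranspose * A * E) j j).re ^ s ≤ rtr (rp s A) := by
  set m : κ → ℝ := fun j => ((E.conjTranspose * A * E) j j).re with hm
  have hm0 : ∀ j, 0 ≤ m j := fun j =>
    (Complex.le_def.1 ((hA.conjTranspose_mul_mul_same E).diag_nonneg (i := j))).1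
  set D := E * Matrix.diagonal (fun i => (m i : ℂ)) * E.conjTranspose with hD
  have dD : Diag D E m := ⟨hl, hr, rfl⟩
  have h1 := klein (dD.posSemidef hm0) hA hs
  have h2 : rtr (rp (s - 1) D * A) = ∑ j, m j ^ (s - 1) * m j := by
    rw [(dD.rp_diag (s - 1)).eq, Matrix.mul_assoc, Matrix.mul_assoc, rtr_mul_comm,
      Matrix.mul_assoc, rtr_diagonal_mul]
  have h3 : rtr (rp (s - 1) D * D) = ∑ j, m j ^ (s - 1) * m j := by
    rw [(dD.rp_diag (s - 1)).eq, Matrix.mul_assoc, Matrix.mul_assoc, rtr_mul_comm,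
      Matrix.mul_assoc, rtr_diagonal_mul]
    refine Finset.sum_congr rfl fun j _ => ?_
    have : E.conjTranspose * D * E = Matrix.diagonal (fun i => (m i : ℂ)) := by
      rw [hD]
      calc _ = (E.conjTranspose * E) * Matrix.diagonal (fun i => (m i : ℂ)) *
            (E.conjTranspose * E) := by simp only [Matrix.mul_assoc]
        _ = _ := by rw [hl]; simp
    rw [this]; simp
  rw [Matrix.mul_sub, rtr_sub, h2, h3, sub_self, mul_zero, add_zero, dD.rtr_rp] at h1
  exact h1

end Klein

section Continuity

variable {κ : Type*} [Fintype κ] [DecidableEq κ]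

theorem exists_subseq_of_norm_le_one (V : ℕ → κ → κ → ℂ) (h : ∀ n i j, ‖V n i j‖ ≤ 1) :
    ∃ (V₀ : κ → κ → ℂ) (φ : ℕ → ℕ), StrictMono φ ∧ Tendsto (V ∘ φ) atTop (nhds V₀) := by
  have hK : IsCompact (Set.pi univ (fun _ : κ => Set.pi univ
      (fun _ : κ => Metric.closedBall (0 : ℂ) 1)) : Set (κ → κ → ℂ)) :=
    isCompact_univ_pi fun _ => isCompact_univ_pi fun _ => isCompact_closedBall _ _
  obtain ⟨V₀, -, φ, hφ, hlim⟩ := hK.tendsto_subseq (x := V)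
    (fun n i _ j _ => mem_closedBall_zero_iff.2 (h n i j))
  exact ⟨V₀, φ, hφ, hlim⟩

theorem tendsto_conjTranspose {V : ℕ → Matrix κ κ ℂ} {V₀ : Matrix κ κ ℂ}
    (hV : Tendsto V atTop (nhds V₀)) :
    Tendsto (fun k => (V k).conjTranspose) atTop (nhds V₀.conjTranspose) :=
  ((continuous_id.matrix_conjTranspose).tendsto V₀).comp hV

theorem exists_subseq_unitary (V : ℕ → Matrix κ κ ℂ) (hV : ∀ n, (V n).conjTranspose * V n = 1) :
    ∃ (V₀ : Matrix κ κ ℂ) (φ : ℕ → ℕ), StrictMono φ ∧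
      Tendsto (fun k => V (φ k)) atTop (nhds V₀) ∧
      V₀.conjTranspose * V₀ = 1 ∧ V₀ * V₀.conjTranspose = 1 := by
  obtain ⟨V₀, φ, hφ, hlim⟩ := exists_subseq_of_norm_le_one (fun n => (V n : κ → κ → ℂ)) (by
    intro n i j
    have h1 := sum_normSq_col (hV n) j
    have h2 : Complex.normSq (V n i j) ≤ 1 := by
      rw [← h1]
      exact Finset.single_le_sum (f := fun i => Complex.normSq (V n i j))
        (fun i _ => Complex.normSq_nonneg _) (Finset.mem_univ i)
    rw [Complex.normSq_eq_norm_sq] at h2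
    have := norm_nonneg (V n i j)
    nlinarith)
  have hlim' : Tendsto (fun k => V (φ k)) atTop (nhds (Matrix.of V₀)) := hlim
  have hl : (Matrix.of V₀).conjTranspose * (Matrix.of V₀) = 1 := by
    refine tendsto_nhds_unique ((tendsto_conjTranspose hlim').mul hlim') ?_
    simp only [hV]; exact tendsto_const_nhds
  exact ⟨Matrix.of V₀, φ, hφ, hlim', hl, mul_eq_one_comm.1 hl⟩

theorem tendsto_diag {A V : ℕ → Matrix κ κ ℂ} {a : ℕ → κ → ℝ} {A₀ V₀ : Matrix κ κ ℂ}
    (d : ∀ k, Diag (A k) (V k) (a k)) (hA : Tendsto A atTop (nhds A₀))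
    (hV : Tendsto V atTop (nhds V₀)) (hl : V₀.conjTranspose * V₀ = 1)
    (hr : V₀ * V₀.conjTranspose = 1) :
    ∃ a₀ : κ → ℝ, Diag A₀ V₀ a₀ ∧ ∀ i, Tendsto (fun k => a k i) atTop (nhds (a₀ i)) := by
  have hdiag : ∀ k, (V k).conjTranspose * A k * V k =
      Matrix.diagonal (fun i => ((a k i : ℝ) : ℂ)) := by
    intro k
    rw [(d k).eq]
    calc _ = ((V k).conjTranspose * V k) * Matrix.diagonal (fun i => ((a k i : ℝ) : ℂ)) *
          ((V k).conjTranspose * V k) := by simp only [Matrix.mul_assoc]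
      _ = _ := by rw [(d k).l]; simp
  have hD : Tendsto (fun k => (V k).conjTranspose * A k * V k) atTop
      (nhds (V₀.conjTranspose * A₀ * V₀)) :=
    ((tendsto_conjTranspose hV).mul hA).mul hV
  generalize hD₀ : V₀.conjTranspose * A₀ * V₀ = D₀ at hD
  simp only [hdiag] at hD
  have hDij : ∀ i j, Tendsto (fun k => Matrix.diagonal (fun i => ((a k i : ℝ) : ℂ)) i j) atTop
      (nhds (D₀ i j)) := fun i j => tendsto_pi_nhds.1 (tendsto_pi_nhds.1 hD i) j
  have haii : ∀ i, Tendsto (fun k => a k i) atTop (nhds (D₀ i i).re) := by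
    intro i
    have := (Complex.continuous_re.tendsto _).comp (hDij i i)
    simpa only [Function.comp_def, Matrix.diagonal_apply_eq, Complex.ofReal_re] using this
  have hD₀' : Matrix.diagonal (fun i => (((D₀ i i).re : ℝ) : ℂ)) = D₀ := by
    ext i j
    refine tendsto_nhds_unique ?_ (hDij i j)
    by_cases hij : i = j
    · subst hij
      simp only [Matrix.diagonal_apply_eq]
      exact (Complex.continuous_ofReal.tendsto _).comp (haii i)
    · simp only [Matrix.diagonal_apply_ne _ hij]; exact tendsto_const_nhds
  refine ⟨fun i => (D₀ i i).re, ⟨hl, hr, ?_⟩, haii⟩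
  rw [hD₀', ← hD₀]
  calc A₀ = (V₀ * V₀.conjTranspose) * A₀ * (V₀ * V₀.conjTranspose) := by rw [hr]; simp
    _ = _ := by simp only [Matrix.mul_assoc]

/-- Joint continuity of the functional calculus on positive semidefinite matrices. -/
theorem tendsto_fc {P : Type*} [TopologicalSpace P] {F : P → ℝ → ℂ} {p : ℕ → P} {p₀ : P}
    (hp : Tendsto p atTop (nhds p₀))
    (hF : ∀ x, 0 ≤ x → ContinuousWithinAt (Function.uncurry F) (univ ×ˢ Set.Ici 0) (p₀, x))
    {A : ℕ → Matrix κ κ ℂ} {A₀ : Matrix κ κ ℂ} (hA : ∀ k, (A k).PosSemidef)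
    (hlim : Tendsto A atTop (nhds A₀)) :
    Tendsto (fun k => fc (F (p k)) (A k)) atTop (nhds (fc (F p₀) A₀)) := by
  refine tendsto_of_subseq_tendsto fun ns hns => ?_
  choose V a dA ha using fun k => exists_diag_psd (hA (ns k))
  obtain ⟨V₀, φ, hφ, hV, hl, hr⟩ := exists_subseq_unitary V fun k => (dA k).l
  obtain ⟨a₀, d₀, ha₀⟩ := tendsto_diag (fun k => dA (φ k))
    (hlim.comp (hns.comp hφ.tendsto_atTop)) hV hl hr
  have hpos : ∀ i, 0 ≤ a₀ i := fun i => ge_of_tendsto' (ha₀ i) fun k => ha _ i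
  refine ⟨φ, ?_⟩
  simp only [(dA _).fc_eq, d₀.fc_eq]
  have hd : Tendsto (fun k => Matrix.diagonal (fun i => F (p (ns (φ k))) (a (φ k) i))) atTop
      (nhds (Matrix.diagonal (fun i => F p₀ (a₀ i)))) := by
    refine tendsto_pi_nhds.2 fun i => tendsto_pi_nhds.2 fun j => ?_
    by_cases hij : i = j
    · subst hij
      simp only [Matrix.diagonal_apply_eq]
      have h1 : Tendsto (fun k => (p (ns (φ k)), a (φ k) i)) atTop
          (nhdsWithin (p₀, a₀ i) (univ ×ˢ Set.Ici 0)) := by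
        refine tendsto_nhdsWithin_iff.2 ⟨?_, Eventually.of_forall fun k => ⟨trivial, ha _ i⟩⟩
        exact (hp.comp (hns.comp hφ.tendsto_atTop)).prodMk_nhds (ha₀ i)
      exact (hF _ (hpos i)).tendsto.comp h1
    · simp only [Matrix.diagonal_apply_ne _ hij]; exact tendsto_const_nhds
  exact (hV.mul hd).mul (tendsto_conjTranspose hV)

end Continuity

section TensorPower

variable {κ : Type*} [Fintype κ] [DecidableEq κ]

/-- Tensor power of a matrix over an arbitrary index type. -/
def tpowG (A : Matrix κ κ ℂ) (n : ℕ) : Matrix (Fin n → κ) (Fin n → κ) ℂ :=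
  Matrix.of fun x y => ∏ i, A (x i) (y i)

theorem tpowG_apply (A : Matrix κ κ ℂ) (n : ℕ) (x y : Fin n → κ) :
    tpowG A n x y = ∏ i, A (x i) (y i) := rfl

theorem tpow_eq_tpowG {d : ℕ} (A : Matrix (Fin d) (Fin d) ℂ) (n : ℕ) : tpow A n = tpowG A n := rfl

theorem sum_prod_fun {n : ℕ} {R : Type*} [CommSemiring R] (f : Fin n → κ → R) :
    ∑ x : Fin n → κ, ∏ i, f i (x i) = ∏ i, ∑ j, f i j := by
  rw [Finset.prod_univ_sum, Fintype.piFinset_univ]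

theorem tpowG_mul (A B : Matrix κ κ ℂ) (n : ℕ) : tpowG A n * tpowG B n = tpowG (A * B) n := by
  ext x y
  rw [Matrix.mul_apply, tpowG_apply]
  simp only [tpowG_apply, Matrix.mul_apply]
  rw [← sum_prod_fun]
  simp only [Finset.prod_mul_distrib]

theorem tpowG_conjTranspose (A : Matrix κ κ ℂ) (n : ℕ) :
    (tpowG A n).conjTranspose = tpowG A.conjTranspose n := by
  ext x y
  simp [tpowG_apply, Matrix.conjTranspose_apply]

theorem tpowG_diagonal (a : κ → ℂ) (n : ℕ) :
    tpowG (Matrix.diagonal a) n = Matrix.diagonal (fun x => ∏ i, a (x i)) := by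
  ext x y
  rw [tpowG_apply]
  by_cases h : x = y
  · subst h; simp
  · rw [Matrix.diagonal_apply_ne _ h]
    obtain ⟨i, hi⟩ := Function.ne_iff.1 h
    exact Finset.prod_eq_zero (Finset.mem_univ i) (Matrix.diagonal_apply_ne _ hi)

theorem tpowG_one (n : ℕ) : tpowG (1 : Matrix κ κ ℂ) n = 1 := by
  rw [← Matrix.diagonal_one, tpowG_diagonal]; simp

theorem tpowG_trace (A : Matrix κ κ ℂ) (n : ℕ) : (tpowG A n).trace = A.trace ^ n := by
  simp only [Matrix.trace, Matrix.diag_apply, tpowG_apply]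
  rw [sum_prod_fun (fun _ j => A j j)]; simp

theorem Diag.tens {A V : Matrix κ κ ℂ} {a : κ → ℝ} (h : Diag A V a) (n : ℕ) :
    Diag (tpowG A n) (tpowG V n) (fun x => ∏ i, a (x i)) where
  l := by rw [tpowG_conjTranspose, tpowG_mul, h.l, tpowG_one]
  r := by rw [tpowG_conjTranspose, tpowG_mul, h.r, tpowG_one]
  eq := by
    rw [tpowG_conjTranspose]
    push_cast
    rw [← tpowG_diagonal (fun i => (a i : ℂ)), tpowG_mul, tpowG_mul, ← h.eq]

theorem tpowG_posSemidef {A : Matrix κ κ ℂ} (hA : A.PosSemidef) (n : ℕ) :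
    (tpowG A n).PosSemidef := by
  obtain ⟨V, a, h, ha⟩ := exists_diag_psd hA
  exact (h.tens n).posSemidef fun x => Finset.prod_nonneg fun i _ => ha _

theorem rp_tpowG {A : Matrix κ κ ℂ} (hA : A.PosSemidef) (s : ℝ) (n : ℕ) :
    rp s (tpowG A n) = tpowG (rp s A) n := by
  obtain ⟨V, a, h, ha⟩ := exists_diag_psd hA
  rw [((h.tens n).rp_diag s).eq, ((h.rp_diag s).tens n).eq]
  simp only [Real.finsetProd_rpow _ _ fun i _ => ha _]

theorem rtr_tpowG {A : Matrix κ κ ℂ} (hA : A.IsHermitian) (n : ℕ) :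
    rtr (tpowG A n) = rtr A ^ n := by
  have h : A.trace = ((rtr A : ℝ) : ℂ) := by
    rw [(exists_diag hA).eq, rtr, Matrix.trace_mul_comm, ← Matrix.mul_assoc, (exists_diag hA).l,
      Matrix.one_mul, Matrix.trace_diagonal, ← Complex.ofReal_sum, Complex.ofReal_re]
  rw [rtr, tpowG_trace, h, ← Complex.ofReal_pow, Complex.ofReal_re]

end TensorPower

section Pinching

variable {κ : Type*} [Fintype κ] [DecidableEq κ]

/-- Pinching of a matrix with respect to the level sets of `L`. -/
def pinch (L : κ → ℝ) (A : Matrix κ κ ℂ) : Matrix κ κ ℂ :=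
  Matrix.of fun x y => if L x = L y then A x y else 0

/-- Diagonal projection onto the level set `L = l`. -/
def lev (L : κ → ℝ) (l : ℝ) : Matrix κ κ ℂ :=
  Matrix.diagonal fun x => if L x = l then 1 else 0

/-- Number of values of `L`. -/
def nval (L : κ → ℝ) : ℕ := (Finset.univ.image L).card

theorem lev_mul_mul_lev (L : κ → ℝ) (l m : ℝ) (A : Matrix κ κ ℂ) (x y : κ) :
    (lev L l * A * lev L m) x y = if L x = l ∧ L y = m then A x y else 0 := by
  rw [lev, lev, Matrix.mul_diagonal, Matrix.diagonal_mul]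
  by_cases h1 : L x = l <;> by_cases h2 : L y = m <;> simp [h1, h2]

theorem lev_isHermitian (L : κ → ℝ) (l : ℝ) : (lev L l).conjTranspose = lev L l := by
  rw [lev, Matrix.diagonal_conjTranspose]
  congr 1; ext x; simp only [Pi.star_apply]; split_ifs <;> simp

theorem pinch_eq_sum (L : κ → ℝ) (A : Matrix κ κ ℂ) :
    pinch L A = ∑ l ∈ Finset.univ.image L, lev L l * A * lev L l := by
  ext x y
  rw [Matrix.sum_apply]
  simp only [lev_mul_mul_lev, pinch, Matrix.of_apply]
  rw [Finset.sum_eq_single (L x)]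
  · simp [eq_comm]
  · intro l _ hl; rw [if_neg]; exact fun h => hl h.1.symm
  · intro h; exact absurd (Finset.mem_image_of_mem L (Finset.mem_univ x)) h

theorem eq_sum_lev (L : κ → ℝ) (A : Matrix κ κ ℂ) :
    A = ∑ l ∈ Finset.univ.image L, ∑ m ∈ Finset.univ.image L, lev L l * A * lev L m := by
  ext x y
  rw [Matrix.sum_apply]
  simp only [Matrix.sum_apply, lev_mul_mul_lev]
  rw [Finset.sum_eq_single (L x), Finset.sum_eq_single (L y)]
  · simp
  · intro l _ hl; rw [if_neg]; exact fun h => hl h.2.symm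
  · intro h; exact absurd (Finset.mem_image_of_mem L (Finset.mem_univ y)) h
  · intro l _ hl
    refine Finset.sum_eq_zero fun m _ => ?_
    rw [if_neg]; exact fun h => hl h.1.symm
  · intro h; exact absurd (Finset.mem_image_of_mem L (Finset.mem_univ x)) h

theorem lev_conj_posSemidef {A : Matrix κ κ ℂ} (hA : A.PosSemidef) (L : κ → ℝ) (l : ℝ) :
    (lev L l * A * lev L l).PosSemidef := by
  have := hA.mul_mul_conjTranspose_same (lev L l)
  rwa [lev_isHermitian] at this

theorem pinch_posSemidef {A : Matrix κ κ ℂ} (hA : A.PosSemidef) (L : κ → ℝ) :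
    (pinch L A).PosSemidef := by
  rw [pinch_eq_sum]
  exact Matrix.posSemidef_sum _ fun l _ => lev_conj_posSemidef hA L l

/-- The pinching inequality. -/
theorem pinching {A : Matrix κ κ ℂ} (hA : A.PosSemidef) (L : κ → ℝ) :
    ((nval L : ℂ) • pinch L A - A).PosSemidef := by
  have h : ((1 / 2 : ℝ) : ℂ) • (∑ l ∈ Finset.univ.image L, ∑ m ∈ Finset.univ.image L,
      (lev L l - lev L m) * A * (lev L l - lev L m)) = (nval L : ℂ) • pinch L A - A := by
    have e : ∀ l m, (lev L l - lev L m) * A * (lev L l - lev L m) =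
        lev L l * A * lev L l + lev L m * A * lev L m - lev L l * A * lev L m -
          lev L m * A * lev L l := by
      intro l m; noncomm_ring
    simp only [e, Finset.sum_sub_distrib, Finset.sum_add_distrib, Finset.sum_const]
    rw [← pinch_eq_sum, ← Finset.smul_sum, ← pinch_eq_sum, ← eq_sum_lev, Finset.sum_comm,
      ← eq_sum_lev]
    rw [← Nat.cast_smul_eq_nsmul ℂ]
    show _ = ((Finset.univ.image L).card : ℂ) • pinch L A - A
    push_cast
    module
  rw [← h]
  refine Matrix.PosSemidef.smul ?_ (by norm_num [Complex.le_def])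
  refine Matrix.posSemidef_sum _ fun l _ => Matrix.posSemidef_sum _ fun m _ => ?_
  have := hA.mul_mul_conjTranspose_same (lev L l - lev L m)
  rwa [Matrix.conjTranspose_sub, lev_isHermitian, lev_isHermitian] at this

theorem pinch_isHermitian {A : Matrix κ κ ℂ} (hA : A.IsHermitian) (L : κ → ℝ) :
    (pinch L A).IsHermitian := by
  ext x y
  have := congrFun (congrFun hA x) y
  rw [Matrix.conjTranspose_apply] at this ⊢
  simp only [pinch, Matrix.of_apply, eq_comm (a := L y)]
  split_ifs <;> simp [this]

theorem Diag.submatrix {κ' : Type*} [Fintype κ'] [DecidableEq κ'] {A V : Matrix κ κ ℂ} {a : κ → ℝ}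
    (h : Diag A V a) (e : κ' ≃ κ) : Diag (A.submatrix e e) (V.submatrix e e) (fun i => a (e i)) where
  l := by
    rw [Matrix.conjTranspose_submatrix, Matrix.submatrix_mul_equiv, h.l, Matrix.submatrix_one_equiv]
  r := by
    rw [Matrix.conjTranspose_submatrix, Matrix.submatrix_mul_equiv, h.r, Matrix.submatrix_one_equiv]
  eq := by
    have : Matrix.diagonal (fun i => (a (e i) : ℂ)) =
        (Matrix.diagonal (fun i => (a i : ℂ))).submatrix e e := by
      rw [Matrix.submatrix_diagonal_equiv]; rfl
    rw [this, Matrix.conjTranspose_submatrix, Matrix.submatrix_mul_equiv,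
      Matrix.submatrix_mul_equiv, ← h.eq]

theorem exists_block_diag_aux {β : Type*} [Fintype β] [DecidableEq β] (L : κ → β)
    {A : Matrix κ κ ℂ} (hA : A.IsHermitian) (hz : ∀ x y, L x ≠ L y → A x y = 0) :
    ∃ V a, Diag A V a ∧ ∀ x y, L x ≠ L y → V x y = 0 := by
  let B : (l : β) → Matrix {x // L x = l} {x // L x = l} ℂ := fun l =>
    A.submatrix Subtype.val Subtype.val
  have hB : ∀ l, (B l).IsHermitian := fun l => hA.submatrix _
  choose V a hd using fun l => show ∃ V a, Diag (B l) V a from ⟨_, _, exists_diag (hB l)⟩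
  have hD : Diag (Matrix.blockDiagonal' B) (Matrix.blockDiagonal' V) (fun i => a i.1 i.2) := by
    refine ⟨?_, ?_, ?_⟩
    · rw [Matrix.blockDiagonal'_conjTranspose, ← Matrix.blockDiagonal'_mul]
      simp only [(hd _).l]; exact Matrix.blockDiagonal'_one
    · rw [Matrix.blockDiagonal'_conjTranspose, ← Matrix.blockDiagonal'_mul]
      simp only [(hd _).r]; exact Matrix.blockDiagonal'_one
    · have : Matrix.diagonal (fun i : (l : β) × {x // L x = l} => ((a i.1 i.2 : ℝ) : ℂ)) =
          Matrix.blockDiagonal' fun l => Matrix.diagonal fun i => ((a l i : ℝ) : ℂ) := by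
        rw [Matrix.blockDiagonal'_diagonal]
      rw [this, Matrix.blockDiagonal'_conjTranspose, ← Matrix.blockDiagonal'_mul,
        ← Matrix.blockDiagonal'_mul]
      congr 1; ext1 l; exact (hd l).eq
  have hS := hD.submatrix (Equiv.sigmaFiberEquiv L).symm
  have hAB : A.submatrix (Equiv.sigmaFiberEquiv L) (Equiv.sigmaFiberEquiv L) =
      Matrix.blockDiagonal' B := by
    ext ⟨l, x, hx⟩ ⟨m, y, hy⟩
    by_cases h : l = m
    · subst h; rw [Matrix.blockDiagonal'_apply_eq]; rfl
    · rw [Matrix.blockDiagonal'_apply_ne _ _ _ h]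
      exact hz x y (by rw [hx, hy]; exact h)
  have hA' : (Matrix.blockDiagonal' B).submatrix (Equiv.sigmaFiberEquiv L).symm
      (Equiv.sigmaFiberEquiv L).symm = A := by
    rw [← hAB, Matrix.submatrix_submatrix]; simp
  rw [hA'] at hS
  refine ⟨_, _, hS, fun x y h => ?_⟩
  rw [Matrix.submatrix_apply]
  exact Matrix.blockDiagonal'_apply_ne _ _ _ h

theorem exists_block_diag (L : κ → ℝ)
    {A : Matrix κ κ ℂ} (hA : A.IsHermitian) (hz : ∀ x y, L x ≠ L y → A x y = 0) :
    ∃ V a, Diag A V a ∧ ∀ x y, L x ≠ L y → V x y = 0 := by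
  have hL : ∀ x y, L x ≠ L y ↔ Set.rangeFactorization L x ≠ Set.rangeFactorization L y := by
    intro x y; rw [Ne, Ne, ← Subtype.coe_inj]; rfl
  simp only [hL] at hz ⊢
  exact exists_block_diag_aux _ hA hz

end Pinching

section PinchedData

variable {κ : Type*} [Fintype κ] [DecidableEq κ]

theorem nval_prod_le (lam : κ → ℝ) (n : ℕ) :
    nval (fun x : Fin n → κ => ∏ i, lam (x i)) ≤ (n + 1) ^ Fintype.card κ := by
  let g : (κ → Fin (n + 1)) → ℝ := fun c => ∏ j, lam j ^ (c j : ℕ)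
  have hsub : Finset.univ.image (fun x : Fin n → κ => ∏ i, lam (x i)) ⊆ Finset.univ.image g := by
    intro l hl
    obtain ⟨x, -, rfl⟩ := Finset.mem_image.1 hl
    refine Finset.mem_image.2 ⟨fun j => ⟨(Finset.univ.filter fun i => x i = j).card, ?_⟩,
      Finset.mem_univ _, ?_⟩
    · exact Nat.lt_succ_of_le ((Finset.card_le_univ _).trans (by simp))
    · show ∏ j, lam j ^ (Finset.univ.filter fun i => x i = j).card = _
      rw [← Finset.prod_fiberwise Finset.univ x (fun i => lam (x i))]
      refine Finset.prod_congr rfl fun j _ => ?_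
      rw [Finset.prod_congr rfl (g := fun _ => lam j), Finset.prod_const]
      intro i hi
      rw [(Finset.mem_filter.1 hi).2]
  calc _ ≤ (Finset.univ.image g).card := Finset.card_le_card hsub
    _ ≤ (Finset.univ : Finset (κ → Fin (n + 1))).card := Finset.card_image_le
    _ = _ := by simp

theorem one_le_nval [Nonempty κ] (L : κ → ℝ) : 1 ≤ nval L := by
  rw [nval, Nat.one_le_iff_ne_zero, Finset.card_ne_zero]
  exact Finset.univ_nonempty.image _

theorem Diag.conj_apply {A V : Matrix κ κ ℂ} {a : κ → ℝ} (h : Diag A V a) (x : κ) :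
    (V.conjTranspose * A * V) x x = (a x : ℂ) := by
  have : V.conjTranspose * A * V = Matrix.diagonal (fun i => (a i : ℂ)) := by
    rw [h.eq]
    calc _ = (V.conjTranspose * V) * Matrix.diagonal (fun i => (a i : ℂ)) *
          (V.conjTranspose * V) := by simp only [Matrix.mul_assoc]
      _ = _ := by rw [h.l]; simp
  rw [this, Matrix.diagonal_apply_eq]

theorem conj_apply_eq (W A : Matrix κ κ ℂ) (x : κ) :
    (W.conjTranspose * A * W) x x = ∑ y, ∑ z, star (W y x) * A y z * W z x := by
  simp only [Matrix.mul_apply, Finset.sum_mul, Matrix.conjTranspose_apply]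
  rw [Finset.sum_comm]

theorem block_conj_pinch {L : κ → ℝ} {W : Matrix κ κ ℂ} (hW : ∀ x y, L x ≠ L y → W x y = 0)
    (A : Matrix κ κ ℂ) (x : κ) :
    (W.conjTranspose * A * W) x x = (W.conjTranspose * pinch L A * W) x x := by
  rw [conj_apply_eq, conj_apply_eq]
  refine Finset.sum_congr rfl fun y _ => Finset.sum_congr rfl fun z _ => ?_
  by_cases hy : L y = L x
  · by_cases hz : L z = L x
    · simp [pinch, hy, hz]
    · simp [hW z x hz]
  · simp [hW y x hy]

theorem block_comm {L : κ → ℝ} {W : Matrix κ κ ℂ} (hW : ∀ x y, L x ≠ L y → W x y = 0)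
    (f : ℝ → ℂ) :
    Matrix.diagonal (fun x => f (L x)) * W = W * Matrix.diagonal (fun x => f (L x)) := by
  ext x y
  rw [Matrix.diagonal_mul, Matrix.mul_diagonal]
  by_cases h : L x = L y
  · rw [h, mul_comm]
  · simp [hW x y h]

theorem block_conj_scale {L : κ → ℝ} {W : Matrix κ κ ℂ} (hW : ∀ x y, L x ≠ L y → W x y = 0)
    (f : ℝ → ℝ) (A : Matrix κ κ ℂ) (x : κ) :
    (W.conjTranspose * (Matrix.diagonal (fun x => (f (L x) : ℂ)) * A *
      Matrix.diagonal (fun x => (f (L x) : ℂ))) * W) x x =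
      ((f (L x) ^ 2 : ℝ) : ℂ) * (W.conjTranspose * A * W) x x := by
  rw [conj_apply_eq, conj_apply_eq, Finset.mul_sum]
  refine Finset.sum_congr rfl fun y _ => ?_
  rw [Finset.mul_sum]
  refine Finset.sum_congr rfl fun z _ => ?_
  rw [Matrix.mul_diagonal, Matrix.diagonal_mul]
  by_cases hy : L y = L x
  · by_cases hz : L z = L x
    · rw [hy, hz]; push_cast; ring
    · simp [hW z x hz]
  · simp [hW y x hy]

theorem exists_pinch (L : κ → ℝ) {B : Matrix κ κ ℂ} (hB : B.PosSemidef) :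
    ∃ W b, Diag (pinch L B) W b ∧ (∀ x, 0 ≤ b x) ∧ (∀ x y, L x ≠ L y → W x y = 0) ∧
      ∀ x, (W.conjTranspose * B * W) x x = (b x : ℂ) := by
  obtain ⟨W, b, hd, hW⟩ := exists_block_diag L (pinch_isHermitian hB.1 L)
    (fun x y h => by simp [pinch, h])
  exact ⟨W, b, hd, hd.nonneg (pinch_posSemidef hB L), hW,
    fun x => by rw [block_conj_pinch hW, hd.conj_apply]⟩

theorem Diag.real_smul {A V : Matrix κ κ ℂ} {a : κ → ℝ} (h : Diag A V a) (c : ℝ) :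
    Diag ((c : ℂ) • A) V (fun i => c * a i) where
  l := h.l
  r := h.r
  eq := by
    have : Matrix.diagonal (fun i => ((c * a i : ℝ) : ℂ)) =
        (c : ℂ) • Matrix.diagonal (fun i => (a i : ℂ)) := by
      rw [← Matrix.diagonal_smul]; congr 1; ext i; simp
    rw [this, Matrix.mul_smul, Matrix.smul_mul, ← h.eq]

theorem rtr_rp_le_pinch (L : κ → ℝ) {B W : Matrix κ κ ℂ} (hB : B.PosSemidef) {b : κ → ℝ}
    (hd : Diag (pinch L B) W b) {s : ℝ} (hs : 1 < s) :
    rtr (rp s B) ≤ (nval L : ℝ) ^ s * ∑ x, b x ^ s := by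
  have hb := hd.nonneg (pinch_posSemidef hB L)
  have hd' := hd.real_smul (nval L : ℝ)
  have h1 := rtr_rp_mono hB (hd'.posSemidef fun i => mul_nonneg (Nat.cast_nonneg _) (hb i))
    (by simpa using pinching hB L) hs
  rw [hd'.rtr_rp] at h1
  rw [Finset.mul_sum]
  refine h1.trans_eq (Finset.sum_congr rfl fun x _ => ?_)
  rw [Real.mul_rpow (Nat.cast_nonneg _) (hb x)]

theorem pinch_diag_eq_zero {L : κ → ℝ} {B W : Matrix κ κ ℂ} {b : κ → ℝ}
    (hW : ∀ x y, L x ≠ L y → W x y = 0) (hb : ∀ x, (W.conjTranspose * B * W) x x = (b x : ℂ))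
    {x : κ} (hx : ∀ y z, L y = L x → B y z = 0) : b x = 0 := by
  have h := hb x
  rw [conj_apply_eq] at h
  have h2 : ((b x : ℝ) : ℂ) = 0 := by
    rw [← h]
    refine Finset.sum_eq_zero fun y _ => Finset.sum_eq_zero fun z _ => ?_
    by_cases hy : L y = L x
    · simp [hx y z hy]
    · simp [hW y x hy]
  exact_mod_cast h2

/-- Sandwiched operator `σ^{(1-s)/2s} ρ σ^{(1-s)/2s}`. -/
def Xs (s : ℝ) (ρ σ : Matrix κ κ ℂ) : Matrix κ κ ℂ :=
  rp ((1 - s) / (2 * s)) σ * ρ * rp ((1 - s) / (2 * s)) σ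

theorem Xs_posSemidef (s : ℝ) {ρ σ : Matrix κ κ ℂ} (hρ : ρ.PosSemidef) (hσ : σ.PosSemidef) :
    (Xs s ρ σ).PosSemidef := by
  have := hρ.mul_mul_conjTranspose_same (rp ((1 - s) / (2 * s)) σ)
  rwa [(rp_isHermitian hσ.1 _).eq] at this

theorem mpow_sand {s : ℝ} (hs : 1 < s) {ρ σ : Matrix κ κ ℂ} (hρ : ρ.PosSemidef)
    (hσ : σ.PosSemidef) :
    mpow (mpow σ (((1 - s) / (2 * s) : ℝ) : ℂ) * ρ * mpow σ (((1 - s) / (2 * s) : ℝ) : ℂ))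
      ((s : ℝ) : ℂ) = rp s (Xs s ρ σ) := by
  have h : (1 - s) / (2 * s) ≠ 0 := by
    apply div_ne_zero <;> linarith
  rw [mpow_eq_rp hσ h, ← Xs, mpow_eq_rp (Xs_posSemidef s hρ hσ) (by linarith)]

theorem Qsand_eq {s : ℝ} (hs : 1 < s) {ρ σ : Matrix κ κ ℂ} (hρ : ρ.PosSemidef)
    (hσ : σ.PosSemidef) : Qsand s ρ σ = rtr (rp s (Xs s ρ σ)) := by
  rw [Qsand, mpow_sand hs hρ hσ]

theorem Xs_tpowG (s : ℝ) {ρ σ : Matrix κ κ ℂ} (hσ : σ.PosSemidef) (n : ℕ) :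
    Xs s (tpowG ρ n) (tpowG σ n) = tpowG (Xs s ρ σ) n := by
  rw [Xs, Xs, rp_tpowG hσ, tpowG_mul, tpowG_mul]

theorem Qsand_tpowG {s : ℝ} (hs : 1 < s) {ρ σ : Matrix κ κ ℂ} (hρ : ρ.PosSemidef)
    (hσ : σ.PosSemidef) (n : ℕ) : Qsand s (tpowG ρ n) (tpowG σ n) = Qsand s ρ σ ^ n := by
  rw [Qsand_eq hs hρ hσ, Qsand_eq hs (tpowG_posSemidef hρ n) (tpowG_posSemidef hσ n),
    Xs_tpowG s hσ, rp_tpowG (Xs_posSemidef s hρ hσ), rtr_tpowG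
    (rp_isHermitian (Xs_posSemidef s hρ hσ).1 _)]

theorem Xs_conj (s : ℝ) {ρ σ U : Matrix κ κ ℂ} (hσ : σ.IsHermitian)
    (hl : U.conjTranspose * U = 1) (hr : U * U.conjTranspose = 1) :
    Xs s (U * ρ * U.conjTranspose) (U * σ * U.conjTranspose) =
      U * Xs s ρ σ * U.conjTranspose := by
  rw [Xs, Xs, rp, fc_conj _ hσ hl hr]
  simp only [Matrix.mul_assoc]
  simp only [← Matrix.mul_assoc U.conjTranspose U, hl, Matrix.one_mul]
  rfl

theorem rtr_conj {A U : Matrix κ κ ℂ} (hl : U.conjTranspose * U = 1) :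
    rtr (U * A * U.conjTranspose) = rtr A := by
  rw [rtr_mul_comm, ← Matrix.mul_assoc, hl, Matrix.one_mul]

theorem Qsand_conj {s : ℝ} (hs : 1 < s) {ρ σ U : Matrix κ κ ℂ} (hρ : ρ.PosSemidef)
    (hσ : σ.PosSemidef) (hl : U.conjTranspose * U = 1) (hr : U * U.conjTranspose = 1) :
    Qsand s (U * ρ * U.conjTranspose) (U * σ * U.conjTranspose) = Qsand s ρ σ := by
  rw [Qsand_eq hs hρ hσ, Qsand_eq hs (hρ.mul_mul_conjTranspose_same U)
    (hσ.mul_mul_conjTranspose_same U), Xs_conj s hσ.1 hl hr, rp,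
    fc_conj _ (Xs_posSemidef s hρ hσ).1 hl hr, rtr_conj hl, rp]

end PinchedData

section TestBound

variable {κ : Type*} [Fintype κ] [DecidableEq κ]

theorem eq_Xs_diagonal {s : ℝ} (hs : 1 < s) {L : κ → ℝ} (hL : ∀ x, 0 ≤ L x) {ρ : Matrix κ κ ℂ}
    (hρ : ρ.IsHermitian) (h0 : ∀ x y, L x = 0 → ρ x y = 0) :
    ρ = Matrix.diagonal (fun x => ((L x ^ ((s - 1) / (2 * s)) : ℝ) : ℂ)) *
      Xs s ρ (Matrix.diagonal fun x => (L x : ℂ)) *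
      Matrix.diagonal (fun x => ((L x ^ ((s - 1) / (2 * s)) : ℝ) : ℂ)) := by
  have key : ∀ x, L x ≠ 0 → ((L x ^ ((s - 1) / (2 * s)) : ℝ) : ℂ) *
      ((L x ^ ((1 - s) / (2 * s)) : ℝ) : ℂ) = 1 := by
    intro x hx
    rw [← Complex.ofReal_mul, ← Real.rpow_add ((hL x).lt_of_ne' hx)]
    rw [show (s - 1) / (2 * s) + (1 - s) / (2 * s) = 0 by ring]; simp
  ext x y
  rw [Xs, rp_diagonal, Matrix.mul_diagonal, Matrix.diagonal_mul, Matrix.mul_diagonal,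
    Matrix.diagonal_mul]
  by_cases hx : L x = 0
  · rw [h0 x y hx]; simp
  by_cases hy : L y = 0
  · have : ρ x y = 0 := by
      have := congrFun (congrFun hρ x) y
      rw [Matrix.conjTranspose_apply, h0 y x hy] at this
      rw [← this]; simp
    rw [this]; simp
  · have h1 := key x hx
    have h2 := key y hy
    linear_combination (-(ρ x y)) * h1 - (ρ x y * ((L x ^ ((s - 1) / (2 * s)) : ℝ) : ℂ) *
      ((L x ^ ((1 - s) / (2 * s)) : ℝ) : ℂ)) * h2

theorem rtr_mul_diag_conj (M W : Matrix κ κ ℂ) (b : κ → ℝ) :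
    rtr (M * (W * Matrix.diagonal (fun x => (b x : ℂ)) * W.conjTranspose)) =
      ∑ x, b x * ((W.conjTranspose * M * W) x x).re := by
  rw [← rtr_diagonal_mul, rtr_mul_comm, Matrix.mul_assoc, Matrix.mul_assoc, rtr_mul_comm]
  simp only [Matrix.mul_assoc]

theorem conj_apply_nonneg {T : Matrix κ κ ℂ} (hT : T.PosSemidef) (W : Matrix κ κ ℂ) (x : κ) :
    0 ≤ ((W.conjTranspose * T * W) x x).re :=
  (Complex.le_def.1 ((hT.conjTranspose_mul_mul_same W).diag_nonneg (i := x))).1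

theorem conj_apply_le_one {T : Matrix κ κ ℂ} (hT : (1 - T).PosSemidef) {W : Matrix κ κ ℂ}
    (hl : W.conjTranspose * W = 1) (x : κ) : ((W.conjTranspose * T * W) x x).re ≤ 1 := by
  have := conj_apply_nonneg hT W x
  rw [Matrix.mul_sub, Matrix.sub_mul, Matrix.mul_one, hl, Matrix.sub_apply,
    Matrix.one_apply_eq, Complex.sub_re, Complex.one_re] at this
  linarith

theorem rtr_mul_block {L : κ → ℝ} {W : Matrix κ κ ℂ} (hW : ∀ x y, L x ≠ L y → W x y = 0)
    (hr : W * W.conjTranspose = 1) (M : Matrix κ κ ℂ) :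
    rtr (M * Matrix.diagonal (fun x => (L x : ℂ))) =
      ∑ x, L x * ((W.conjTranspose * M * W) x x).re := by
  rw [← rtr_mul_diag_conj, ← block_comm hW (fun x => (x : ℂ)), Matrix.mul_assoc _ W, hr,
    Matrix.mul_one]

theorem test_bound_diagonal {s : ℝ} (hs : 1 < s) {L : κ → ℝ} (hL : ∀ x, 0 ≤ L x)
    {ρ T : Matrix κ κ ℂ} (hρ : ρ.PosSemidef) (h0 : ∀ x y, L x = 0 → ρ x y = 0)
    (hT : T.PosSemidef) (hT1 : (1 - T).PosSemidef) :
    rtr (T * ρ) ≤ nval L * Qsand s ρ (Matrix.diagonal fun x => (L x : ℂ)) ^ (1 / s) *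
      rtr (T * Matrix.diagonal fun x => (L x : ℂ)) ^ ((s - 1) / s) := by
  have hσ : (Matrix.diagonal fun x => (L x : ℂ)).PosSemidef := (diag_diagonal L).posSemidef hL
  rw [Qsand_eq hs hρ hσ]
  set B := Xs s ρ (Matrix.diagonal fun x => (L x : ℂ)) with hB
  have hBp : B.PosSemidef := Xs_posSemidef s hρ hσ
  obtain ⟨W, b, hd, hb, hW, hbe⟩ := exists_pinch L hBp
  set D : Matrix κ κ ℂ := Matrix.diagonal (fun x => ((L x ^ ((s - 1) / (2 * s)) : ℝ) : ℂ)) with hD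
  have hDh : D.conjTranspose = D := by
    rw [hD, Matrix.diagonal_conjTranspose]; congr 1; ext x; simp
  have hDT : (D * T * D).PosSemidef := by
    have := hT.mul_mul_conjTranspose_same D
    rwa [hDh] at this
  have s0 : 0 < s := by linarith
  set t : κ → ℝ := fun x => ((W.conjTranspose * T * W) x x).re with ht
  have ht0 : ∀ x, 0 ≤ t x := conj_apply_nonneg hT W
  have ht1 : ∀ x, t x ≤ 1 := conj_apply_le_one hT1 hd.l
  have h1 : rtr (T * ρ) ≤ nval L * ∑ x, b x * (L x ^ ((s - 1) / s) * t x) := by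
    have e1 : rtr (T * ρ) = rtr ((D * T * D) * B) := by
      conv_lhs => rw [eq_Xs_diagonal hs hL hρ.1 h0]
      rw [← hB, ← hD, ← Matrix.mul_assoc, rtr_mul_comm]
      simp only [Matrix.mul_assoc]
    rw [e1]
    refine (rtr_mul_mono (pinching hBp L) hDT).trans_eq ?_
    have e2 : ((nval L : ℂ)) = (((nval L : ℝ)) : ℂ) := by simp
    rw [e2, Matrix.mul_smul, rtr_smul, hd.eq, rtr_mul_diag_conj]
    congr 1
    refine Finset.sum_congr rfl fun x _ => ?_
    rw [hD, block_conj_scale hW (fun l => l ^ ((s - 1) / (2 * s))), Complex.re_ofReal_mul,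
      ← Real.rpow_natCast, ← Real.rpow_mul (hL x)]
    congr 3
    push_cast; field_simp
  have hpq : s.HolderConjugate (s / (s - 1)) := Real.HolderConjugate.conjExponent hs
  have h2 : ∑ x, b x * (L x ^ ((s - 1) / s) * t x) ≤
      (∑ x, b x ^ s * t x) ^ (1 / s) * (∑ x, L x * t x) ^ ((s - 1) / s) := by
    have := Real.inner_le_Lp_mul_Lq_of_nonneg Finset.univ hpq
      (f := fun x => b x * t x ^ (1 / s)) (g := fun x => (L x * t x) ^ ((s - 1) / s))
      (fun x _ => mul_nonneg (hb x) (Real.rpow_nonneg (ht0 x) _))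
      (fun x _ => Real.rpow_nonneg (mul_nonneg (hL x) (ht0 x)) _)
    have hs1 : s - 1 ≠ 0 := by linarith
    have f1 : ∀ x, (b x * t x ^ (1 / s)) ^ s = b x ^ s * t x := by
      intro x
      rw [Real.mul_rpow (hb x) (Real.rpow_nonneg (ht0 x) _), ← Real.rpow_mul (ht0 x),
        one_div_mul_cancel s0.ne', Real.rpow_one]
    have f2 : ∀ x, ((L x * t x) ^ ((s - 1) / s)) ^ (s / (s - 1)) = L x * t x := by
      intro x
      rw [← Real.rpow_mul (mul_nonneg (hL x) (ht0 x)),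
        show (s - 1) / s * (s / (s - 1)) = 1 by field_simp, Real.rpow_one]
    have f3 : ∀ x, b x * t x ^ (1 / s) * (L x * t x) ^ ((s - 1) / s) =
        b x * (L x ^ ((s - 1) / s) * t x) := by
      intro x
      rw [Real.mul_rpow (hL x) (ht0 x)]
      have : t x ^ (1 / s) * t x ^ ((s - 1) / s) = t x := by
        have e : 1 / s + (s - 1) / s = 1 := by field_simp; ring
        rw [← Real.rpow_add_of_nonneg (ht0 x) (by positivity)
          (div_nonneg (by linarith) s0.le), e, Real.rpow_one]
      linear_combination (b x * L x ^ ((s - 1) / s)) * this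
    simp only [f1, f2, f3, one_div_div] at this
    exact this
  have h3 : ∑ x, b x ^ s * t x ≤ rtr (rp s B) := by
    refine le_trans (Finset.sum_le_sum fun x _ => ?_) (peierls hBp hd.l hd.r hs)
    rw [hbe, Complex.ofReal_re]
    exact mul_le_of_le_one_right (Real.rpow_nonneg (hb x) _) (ht1 x)
  rw [rtr_mul_block hW hd.r T]
  refine h1.trans ?_
  rw [mul_assoc]
  refine mul_le_mul_of_nonneg_left (h2.trans ?_) (Nat.cast_nonneg _)
  refine mul_le_mul_of_nonneg_right ?_ (Real.rpow_nonneg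
    (Finset.sum_nonneg fun x _ => mul_nonneg (hL x) (ht0 x)) _)
  exact Real.rpow_le_rpow (Finset.sum_nonneg fun x _ => mul_nonneg (Real.rpow_nonneg (hb x) _)
    (ht0 x)) h3 (by positivity)

theorem kernel_diag {ρ V : Matrix κ κ ℂ} {lam : κ → ℝ} {σ : Matrix κ κ ℂ} (hd : Diag σ V lam)
    (hρ : ρ.IsHermitian)
    (hk : ∀ v, σ.mulVec v = 0 → ρ.mulVec v = 0) (x y : κ) (hx : lam x = 0) :
    (V.conjTranspose * ρ * V) x y = 0 := by
  have h1 : ∀ z, (V.conjTranspose * ρ * V) z x = 0 := by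
    intro z
    have h2 : σ.mulVec (V.mulVec (Pi.single x 1)) = 0 := by
      rw [hd.eq, Matrix.mulVec_mulVec, Matrix.mul_assoc, hd.l, Matrix.mul_one, ← Matrix.mulVec_mulVec]
      have : (Matrix.diagonal fun i => (lam i : ℂ)).mulVec (Pi.single x 1) = 0 := by
        ext i
        simp [Matrix.mulVec_single, Matrix.diagonal_apply]
        rw [hx]; simp
      rw [this, Matrix.mulVec_zero]
    have h3 := hk _ h2
    have h4 : (V.conjTranspose * ρ * V).mulVec (Pi.single x 1) = 0 := by
      rw [Matrix.mul_assoc, ← Matrix.mulVec_mulVec, ← Matrix.mulVec_mulVec, h3, Matrix.mulVec_zero]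
    have h5 := congrFun h4 z
    simpa [Matrix.mulVec_single] using h5
  have hH : (V.conjTranspose * ρ * V).IsHermitian := Matrix.isHermitian_conjTranspose_mul_mul V hρ
  have := congrFun (congrFun hH x) y
  rw [Matrix.conjTranspose_apply, h1 y] at this
  rw [← this]; simp

theorem Diag.conj_eq {A V : Matrix κ κ ℂ} {a : κ → ℝ} (h : Diag A V a) :
    V.conjTranspose * A * V = Matrix.diagonal fun i => (a i : ℂ) := by
  rw [h.eq]
  calc _ = (V.conjTranspose * V) * Matrix.diagonal (fun i => (a i : ℂ)) *
        (V.conjTranspose * V) := by simp only [Matrix.mul_assoc]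
    _ = _ := by rw [h.l]; simp

theorem conj_test {T U : Matrix κ κ ℂ} (hr : U.conjTranspose * U = 1) (hT : IsTest T) :
    IsTest (U.conjTranspose * T * U) := by
  refine ⟨hT.1.conjTranspose_mul_mul_same U, ?_⟩
  have := hT.2.conjTranspose_mul_mul_same U
  rwa [Matrix.mul_sub, Matrix.sub_mul, Matrix.mul_one, hr] at this

theorem rtr_conj_mul {U : Matrix κ κ ℂ} (hr : U * U.conjTranspose = 1) (A B : Matrix κ κ ℂ) :
    rtr ((U.conjTranspose * A * U) * (U.conjTranspose * B * U)) = rtr (A * B) := by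
  calc _ = rtr (U.conjTranspose * (A * (U * U.conjTranspose) * B) * U) := by
        simp only [Matrix.mul_assoc]
    _ = _ := by rw [hr, Matrix.mul_one, rtr_mul_comm, ← Matrix.mul_assoc, hr, Matrix.one_mul]

theorem Qsand_conj' {s : ℝ} (hs : 1 < s) {ρ σ U : Matrix κ κ ℂ} (hρ : ρ.PosSemidef)
    (hσ : σ.PosSemidef) (hl : U.conjTranspose * U = 1) (hr : U * U.conjTranspose = 1) :
    Qsand s (U.conjTranspose * ρ * U) (U.conjTranspose * σ * U) = Qsand s ρ σ := by
  have := Qsand_conj (U := U.conjTranspose) hs hρ hσ (by simpa using hr) (by simpa using hl)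
  simpa using this

/-- Converse bound for tests on `n` copies. -/
theorem test_bound {s : ℝ} (hs : 1 < s) {ρ σ : Matrix κ κ ℂ} (hρ : ρ.PosSemidef)
    (hσ : σ.PosSemidef) (hk : ∀ v, σ.mulVec v = 0 → ρ.mulVec v = 0) (n : ℕ)
    {T : Matrix (Fin n → κ) (Fin n → κ) ℂ} (hT : IsTest T) :
    rtr (T * tpowG ρ n) ≤ ((n : ℝ) + 1) ^ Fintype.card κ * (Qsand s ρ σ ^ n) ^ (1 / s) *
      rtr (T * tpowG σ n) ^ ((s - 1) / s) := by
  obtain ⟨V, lam, hd, hlam⟩ := exists_diag_psd hσ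
  have hdn := hd.tens n
  have hρ' := (tpowG_posSemidef hρ n).conjTranspose_mul_mul_same (tpowG V n)
  have hL : ∀ x : Fin n → κ, 0 ≤ ∏ i, lam (x i) := fun x => Finset.prod_nonneg fun i _ => hlam _
  have hT' := conj_test hdn.l hT
  have h0 : ∀ x y : Fin n → κ, ∏ i, lam (x i) = 0 →
      ((tpowG V n).conjTranspose * tpowG ρ n * tpowG V n) x y = 0 := by
    intro x y hx
    obtain ⟨i, -, hi⟩ := Finset.prod_eq_zero_iff.1 hx
    rw [tpowG_conjTranspose, tpowG_mul, tpowG_mul, tpowG_apply]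
    exact Finset.prod_eq_zero (Finset.mem_univ i) (kernel_diag hd hρ.1 hk _ _ hi)
  have h := test_bound_diagonal hs hL hρ' h0 hT'.1 hT'.2
  rw [← hdn.conj_eq, rtr_conj_mul hdn.r, rtr_conj_mul hdn.r,
    Qsand_conj' hs (tpowG_posSemidef hρ n) (tpowG_posSemidef hσ n) hdn.l hdn.r,
    Qsand_tpowG hs hρ hσ] at h
  refine h.trans ?_
  have hQ : 0 ≤ Qsand s ρ σ := by
    rw [Qsand_eq hs hρ hσ]; exact rtr_nonneg (rp_posSemidef (Xs_posSemidef s hρ hσ) _)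
  have hv : (nval (fun x : Fin n → κ => ∏ i, lam (x i)) : ℝ) ≤ ((n : ℝ) + 1) ^ Fintype.card κ := by
    exact_mod_cast nval_prod_le lam n
  gcongr
  exact Real.rpow_nonneg (rtr_mul_nonneg hT.1 (tpowG_posSemidef hσ n)) _

end TestBound

section Reindex

theorem exists_reindex {d : ℕ} (N : ℕ) (hN : 1 ≤ N) (k : ℕ) (hk : 1 ≤ k) :
    ∀ n, n = N * k → ∃ e : (Fin n → Fin d) ≃ (Fin k → Fin N → Fin d),
      (∀ A : Matrix (Fin d) (Fin d) ℂ, tpow A n = (tpowG (tpow A N) k).submatrix e e) ∧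
      ∀ F : (n : ℕ) → Set (Matrix (Fin n → Fin d) (Fin n → Fin d) ℂ),
        (∀ m n, 1 ≤ m → 1 ≤ n → ∀ A ∈ F m, ∀ B ∈ F n, tensOp A B ∈ F (m + n)) →
        ∀ ω ∈ F N, (tpowG ω k).submatrix e e ∈ F n := by
  induction k, hk using Nat.le_induction with
  | base =>
    intro n hn
    rw [Nat.mul_one] at hn
    subst hn
    refine ⟨(Equiv.funUnique (Fin 1) (Fin n → Fin d)).symm, ?_, ?_⟩
    · intro A; ext x y
      simp [tpowG_apply, Matrix.submatrix_apply]
    · intro F _ ω hω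
      convert hω using 1
      ext x y
      simp [tpowG_apply, Matrix.submatrix_apply]
  | succ k hk ih =>
    intro n hn
    obtain ⟨e, h1, h2⟩ := ih (N * k) rfl
    have hn' : n = N * k + N := hn
    subst hn'
    let e' : (Fin (N * k + N) → Fin d) ≃ (Fin (k + 1) → Fin N → Fin d) :=
      (Fin.appendEquiv (N * k) N).symm.trans ((Equiv.prodComm _ _).trans
        ((Equiv.prodCongr (Equiv.refl _) e).trans (Fin.snocEquiv fun _ => Fin N → Fin d)))
    have e1 : ∀ x i, e' x (Fin.castSucc i) = e (fun j => x (Fin.castAdd N j)) i := by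
      intro x i
      simp [e', Fin.appendEquiv, Fin.snocEquiv]
    have e2 : ∀ x, e' x (Fin.last k) = fun j => x (Fin.natAdd (N * k) j) := by
      intro x
      simp [e', Fin.appendEquiv, Fin.snocEquiv]
    have e3 : ∀ ω : Matrix (Fin N → Fin d) (Fin N → Fin d) ℂ,
        (tpowG ω (k + 1)).submatrix e' e' = tensOp ((tpowG ω k).submatrix e e) ω := by
      intro ω
      ext x y
      simp only [Matrix.submatrix_apply, tpowG_apply, Fin.prod_univ_castSucc, e1, e2, tensOp,
        Matrix.of_apply]
    refine ⟨e', ?_, ?_⟩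
    · intro A
      rw [e3, ← h1]
      ext x y
      simp only [tpow, tensOp, Matrix.of_apply, Fin.prod_univ_add]
    · intro F hF ω hω
      rw [e3]
      exact hF _ _ (Nat.mul_pos hN hk) hN _ (h2 F hF ω hω) _ hω

variable {κ κ' : Type*} [Fintype κ] [DecidableEq κ] [Fintype κ'] [DecidableEq κ']

theorem rtr_submatrix (A : Matrix κ κ ℂ) (e : κ' ≃ κ) : rtr (A.submatrix e e) = rtr A := by
  rw [rtr, rtr, Matrix.trace, Matrix.trace]
  simp only [Matrix.diag_apply, Matrix.submatrix_apply]
  rw [Equiv.sum_comp e (fun i => A i i)]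

theorem isTest_submatrix {T : Matrix κ κ ℂ} (hT : IsTest T) (e : κ' ≃ κ) :
    IsTest (T.submatrix e e) := by
  refine ⟨hT.1.submatrix e, ?_⟩
  have e1 : (1 - T).submatrix e e = 1 - T.submatrix e e := by
    ext x y
    simp [Matrix.one_apply]
  exact e1 ▸ hT.2.submatrix e

theorem fc_submatrix (f : ℝ → ℂ) {A : Matrix κ κ ℂ} (hA : A.IsHermitian) (e : κ' ≃ κ) :
    fc f (A.submatrix e e) = (fc f A).submatrix e e := by
  rw [((exists_diag hA).submatrix e).fc_eq, (exists_diag hA).fc_eq]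
  rw [← Matrix.submatrix_mul_equiv _ _ _ e, ← Matrix.submatrix_mul_equiv _ _ _ e,
    Matrix.conjTranspose_submatrix]
  congr 2
  ext x y
  simp [Matrix.diagonal_apply]

theorem Qsand_submatrix {s : ℝ} (hs : 1 < s) {ρ σ : Matrix κ κ ℂ} (hρ : ρ.PosSemidef)
    (hσ : σ.PosSemidef) (e : κ' ≃ κ) :
    Qsand s (ρ.submatrix e e) (σ.submatrix e e) = Qsand s ρ σ := by
  rw [Qsand_eq hs hρ hσ, Qsand_eq hs (hρ.submatrix e) (hσ.submatrix e)]
  have : Xs s (ρ.submatrix e e) (σ.submatrix e e) = (Xs s ρ σ).submatrix e e := by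
    rw [Xs, Xs, rp, fc_submatrix _ hσ.1, Matrix.submatrix_mul_equiv, Matrix.submatrix_mul_equiv]
    rfl
  rw [this, rp, fc_submatrix _ (Xs_posSemidef s hρ hσ).1, rtr_submatrix, rp]

theorem Qsand_pos {s : ℝ} (hs : 1 < s) {ρ σ : Matrix κ κ ℂ} (hρ : ρ.PosSemidef) (hρ0 : ρ ≠ 0)
    (hσ : σ.PosSemidef) (hk : ∀ v, σ.mulVec v = 0 → ρ.mulVec v = 0) : 0 < Qsand s ρ σ := by
  obtain ⟨V, lam, hd, hlam⟩ := exists_diag_psd hσ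
  have hρ' := hρ.conjTranspose_mul_mul_same V
  rw [← Qsand_conj' hs hρ hσ hd.l hd.r, Qsand_eq hs hρ' (hσ.conjTranspose_mul_mul_same V)]
  have hX := Xs_posSemidef s hρ' (hσ.conjTranspose_mul_mul_same V)
  refine (rtr_nonneg (rp_posSemidef hX s)).lt_of_ne' fun h => hρ0 ?_
  obtain ⟨W, x, hx, hx0⟩ := exists_diag_psd hX
  rw [hx.rtr_rp, Finset.sum_eq_zero_iff_of_nonneg fun i _ => Real.rpow_nonneg (hx0 i) _] at h
  have hxz : ∀ i, x i = 0 := fun i =>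
    (Real.rpow_eq_zero (hx0 i) (by linarith)).1 (h i (Finset.mem_univ i))
  have hXz : Xs s (V.conjTranspose * ρ * V) (V.conjTranspose * σ * V) = 0 := by
    rw [hx.eq]; simp [hxz]
  have h2 := eq_Xs_diagonal hs hlam hρ'.1 (fun x y hx => kernel_diag hd hρ.1 hk x y hx)
  rw [← hd.conj_eq, hXz, Matrix.mul_zero, Matrix.zero_mul] at h2
  calc ρ = (V * V.conjTranspose) * ρ * (V * V.conjTranspose) := by rw [hd.r]; simp
    _ = V * (V.conjTranspose * ρ * V) * V.conjTranspose := by simp only [Matrix.mul_assoc]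
    _ = 0 := by rw [h2]; simp

end Reindex

section Exponents

theorem le_rate_iff {n : ℕ} (hn : 1 ≤ n) (c x : ℝ) :
    (c : EReal) ≤ rate n x ↔ x ≤ Real.exp (-(n * c)) := by
  have hn0 : (0 : ℝ) < n := by exact_mod_cast hn
  rw [rate, negLog]
  split_ifs with h
  · rw [EReal.coe_mul_top_of_pos (inv_pos.2 hn0)]
    simp only [le_top, true_iff]
    exact h.trans (Real.exp_pos _).le
  · push Not at h
    rw [← EReal.coe_mul, EReal.coe_le_coe_iff, ← Real.log_le_iff_le_exp h, le_inv_mul_iff₀ hn0]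
    constructor <;> intro h <;> linarith

theorem rate_le_iff {n : ℕ} (hn : 1 ≤ n) (c x : ℝ) :
    rate n x ≤ (c : EReal) ↔ Real.exp (-(n * c)) ≤ x := by
  have hn0 : (0 : ℝ) < n := by exact_mod_cast hn
  rw [rate, negLog]
  split_ifs with h
  · rw [EReal.coe_mul_top_of_pos (inv_pos.2 hn0)]
    simp only [top_le_iff, EReal.coe_ne_top, false_iff, not_le]
    exact h.trans_lt (Real.exp_pos _)
  · push Not at h
    rw [← EReal.coe_mul, EReal.coe_le_coe_iff, ← Real.le_log_iff_exp_le h, inv_mul_le_iff₀ hn0]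
    constructor <;> intro h <;> linarith

theorem eventually_poly_le_exp (m : ℕ) {c : ℝ} (hc : 0 < c) :
    ∀ᶠ k : ℕ in atTop, ((k : ℝ) + 1) ^ m ≤ Real.exp (c * k) := by
  have h := (isLittleO_pow_exp_pos_mul_atTop (k := m) hc).bound (Real.exp_pos (-c))
  have ht : Tendsto (fun k : ℕ => (k : ℝ) + 1) atTop atTop :=
    tendsto_atTop_add_const_right _ _ tendsto_natCast_atTop_atTop
  filter_upwards [ht.eventually h] with k hk
  rw [Real.norm_of_nonneg (by positivity), Real.norm_of_nonneg (Real.exp_pos _).le,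
    ← Real.exp_add] at hk
  refine hk.trans_eq ?_
  congr 1; ring

theorem one_sub_typeI {d : ℕ} {ρ : Matrix (Fin d) (Fin d) ℂ} (hρ : IsState ρ) (n : ℕ)
    (T : Matrix (Fin n → Fin d) (Fin n → Fin d) ℂ) : 1 - typeI ρ n T = rtr (T * tpow ρ n) := by
  rw [typeI, Matrix.sub_mul, rtr_sub, Matrix.one_mul, tpow_eq_tpowG, rtr_tpowG hρ.1.1]
  have : rtr ρ = 1 := by rw [rtr, hρ.2]; simp
  rw [this]; simp

theorem continuous_rtr_mul {κ : Type*} [Fintype κ] [DecidableEq κ] (T : Matrix κ κ ℂ) :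
    Continuous fun A : Matrix κ κ ℂ => rtr (A * T) := by
  unfold rtr
  exact Complex.continuous_re.comp (Continuous.matrix_trace (by fun_prop))

theorem le_typeII {d n : ℕ} {S : (n : ℕ) → Set (Matrix (Fin n → Fin d) (Fin n → Fin d) ℂ)}
    (hS : Assumption1 S) (hn : 1 ≤ n) (T : Matrix (Fin n → Fin d) (Fin n → Fin d) ℂ)
    {ω : Matrix (Fin n → Fin d) (Fin n → Fin d) ℂ} (hω : ω ∈ S n) :
    rtr (ω * T) ≤ typeII (S n) T :=
  le_csSup ((hS.compact n hn).bddAbove_image (continuous_rtr_mul T).continuousOn)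
    (Set.mem_image_of_mem _ hω)

theorem sc_lower {d : ℕ} {ρ : Matrix (Fin d) (Fin d) ℂ} (hρ : IsState ρ)
    {S : (n : ℕ) → Set (Matrix (Fin n → Fin d) (Fin n → Fin d) ℂ)} (hS : Assumption1 S) (r : ℝ)
    {s : ℝ} (hs : 1 < s) {N : ℕ} (hN : 1 ≤ N) {ω : Matrix (Fin N → Fin d) (Fin N → Fin d) ℂ}
    (hω : ω ∈ S N) (hk : ∀ v, ω.mulVec v = 0 → (tpow ρ N).mulVec v = 0)
    (hQ : 0 < Qsand s (tpow ρ N) ω) :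
    (((s - 1) / s * r - Real.log (Qsand s (tpow ρ N) ω) / (s * N) : ℝ) : EReal) ≤
      scExp r ρ S := by
  have hN0 : (0 : ℝ) < N := by exact_mod_cast hN
  have s0 : 0 < s := by linarith
  set Q := Qsand s (tpow ρ N) ω with hQd
  set c := (s - 1) / s * r - Real.log Q / (s * N) with hc
  have hωp := hS.psd N hN ω hω
  have hρN : (tpow ρ N).PosSemidef := by
    rw [tpow_eq_tpowG]; exact tpowG_posSemidef hρ.1 N
  refine le_iInf ?_
  rintro ⟨T, hT, hr⟩
  show (c : EReal) ≤ limsup (fun n => rate n (1 - typeI ρ n (T n))) atTop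
  suffices H : ∀ ε > 0, ((c - ε : ℝ) : EReal) ≤
      limsup (fun n => rate n (1 - typeI ρ n (T n))) atTop by
    by_contra hlt
    push Not at hlt
    obtain ⟨z, hz1, hz2⟩ := EReal.lt_iff_exists_real_btwn.1 hlt
    have := H (c - z) (by have := EReal.coe_lt_coe_iff.1 hz2; linarith)
    rw [sub_sub_cancel] at this
    exact absurd hz1 (not_lt.2 this)
  intro ε hε
  have hη : ∀ᶠ n in atTop, ((r - ε / 2 : ℝ) : EReal) < rate n (typeII (S n) (T n)) :=
    Filter.eventually_lt_of_lt_liminf (lt_of_lt_of_le (EReal.coe_lt_coe_iff.2 (by linarith)) hr)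
  obtain ⟨n₀, hn₀⟩ := eventually_atTop.1 hη
  obtain ⟨k₀, hk₀⟩ := eventually_atTop.1
    (eventually_poly_le_exp (Fintype.card (Fin N → Fin d)) (c := ε / 2 * N) (by positivity))
  apply Filter.le_limsup_of_frequently_le'
  rw [Filter.frequently_atTop]
  intro a
  set k := a + n₀ + k₀ + 1 with hkd
  have hk1 : 1 ≤ k := by omega
  have hkN : k ≤ N * k := Nat.le_mul_of_pos_left k hN
  refine ⟨N * k, by omega, ?_⟩
  have hn1 : 1 ≤ N * k := by omega
  obtain ⟨e, he1, he2⟩ := exists_reindex (d := d) N hN k hk1 (N * k) rfl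
  have hωn := he2 S hS.tens ω hω
  set T' := (T (N * k)).submatrix e.symm e.symm with hT'
  have hTe : T (N * k) = T'.submatrix e e := by
    rw [hT', Matrix.submatrix_submatrix]; simp
  have hT't : IsTest T' := isTest_submatrix (hT _) e.symm
  have hb := test_bound hs hρN hωp hk k hT't
  have hII : rtr (T' * tpowG ω k) ≤ Real.exp (-((N * k : ℕ) * (r - ε / 2))) := by
    have h1 := le_typeII hS hn1 (T (N * k)) hωn
    rw [hTe, Matrix.submatrix_mul_equiv, rtr_submatrix, ← hTe, rtr_mul_comm] at h1
    exact h1.trans ((le_rate_iff hn1 _ _).1 (hn₀ (N * k) (by omega)).le)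
  rw [le_rate_iff hn1, one_sub_typeI hρ, hTe, he1, Matrix.submatrix_mul_equiv, rtr_submatrix]
  have hII0 : 0 ≤ rtr (T' * tpowG ω k) := rtr_mul_nonneg hT't.1 (tpowG_posSemidef hωp k)
  have u0 : 0 ≤ (s - 1) / s := div_nonneg (by linarith) s0.le
  have u1 : (s - 1) / s ≤ 1 := by rw [div_le_one s0]; linarith
  calc rtr (T' * tpowG (tpow ρ N) k)
      ≤ Real.exp (ε / 2 * N * k) * (Q ^ k) ^ (1 / s) *
        Real.exp (-((N * k : ℕ) * (r - ε / 2))) ^ ((s - 1) / s) := by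
        refine hb.trans ?_
        have := hk₀ k (by omega)
        gcongr
    _ ≤ _ := by
        have hQk : (Q ^ k) ^ (1 / s) = Real.exp (k * Real.log Q / s) := by
          rw [Real.rpow_def_of_pos (pow_pos hQ k), Real.log_pow]; congr 1; ring
        rw [hQk, ← Real.exp_mul, ← Real.exp_add, ← Real.exp_add]
        apply Real.exp_le_exp.2
        push_cast
        have e1 : k * Real.log Q / s = N * k * (Real.log Q / (s * N)) := by field_simp
        rw [hc, e1]
        have : (N * k : ℝ) * ((s - 1) / s * (ε / 2)) ≤ (N * k : ℝ) * (ε / 2) := by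
          gcongr
          nlinarith
        nlinarith

theorem sc_upper {d : ℕ} {ρ : Matrix (Fin d) (Fin d) ℂ} (hρ : IsState ρ)
    {S : (n : ℕ) → Set (Matrix (Fin n → Fin d) (Fin n → Fin d) ℂ)} (r H : ℝ)
    (T : (n : ℕ) → Matrix (Fin n → Fin d) (Fin n → Fin d) ℂ) (hT : ∀ n, IsTest (T n))
    (hII : ∀ n, 1 ≤ n → typeII (S n) (T n) ≤ Real.exp (-(n * r)))
    (hI : ∀ ε > 0, ∀ᶠ n : ℕ in atTop, Real.exp (-(n * (H + ε))) ≤ rtr (T n * tpow ρ n)) :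
    scExp r ρ S ≤ (H : EReal) := by
  have hr : (r : EReal) ≤ Filter.liminf (fun n => rate n (typeII (S n) (T n))) Filter.atTop := by
    refine Filter.le_liminf_of_le (by isBoundedDefault) ?_
    filter_upwards [eventually_ge_atTop 1] with n hn
    exact (le_rate_iff hn _ _).2 (hII n hn)
  refine (iInf_le _ ⟨T, hT, hr⟩).trans ?_
  show limsup (fun n => rate n (1 - typeI ρ n (T n))) atTop ≤ (H : EReal)
  rw [← EReal.le_of_forall_lt_iff_le]
  intro z hz
  have hz' : 0 < z - H := by have := EReal.coe_lt_coe_iff.1 hz; linarith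
  refine Filter.limsup_le_of_le (by isBoundedDefault) ?_
  filter_upwards [eventually_ge_atTop 1, hI _ hz'] with n hn h
  rw [rate_le_iff hn, one_sub_typeI hρ]
  rwa [add_sub_cancel] at h

end Exponents

section TiltedExponent

variable {κ : Type*} [Fintype κ] [DecidableEq κ]

theorem differentiableAt_rpow_exp {x : ℝ} (hx : 0 ≤ x) {f : ℝ → ℝ} {p : ℝ}
    (hf : DifferentiableAt ℝ f p) (hp : f p ≠ 0) : DifferentiableAt ℝ (fun s => x ^ f s) p := by
  rcases hx.eq_or_lt with h | h
  · have : (fun s => x ^ f s) =ᶠ[nhds p] fun _ => 0 := by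
      filter_upwards [hf.continuousAt.eventually_ne hp] with s hs
      rw [← h, Real.zero_rpow hs]
    exact (differentiableAt_const (0 : ℝ)).congr_of_eventuallyEq this
  · exact DifferentiableAt.rpow (differentiableAt_const x) hf h.ne'

/-- If `D` is differentiable and vanishes at `p`, continuity of `K` suffices for the product. -/
theorem differentiableAt_mul_of_continuousAt {K D : ℝ → ℂ} {p : ℝ} (hK : ContinuousAt K p)
    (hD : DifferentiableAt ℝ D p) (h0 : D p = 0) : DifferentiableAt ℝ (fun s => K s * D s) p := by
  have h := hasDerivAt_iff_tendsto_slope.1 hD.hasDerivAt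
  have : HasDerivAt (fun s => K s * D s) (K p * deriv D p) p := by
    rw [hasDerivAt_iff_tendsto_slope]
    refine ((hK.tendsto.mono_left nhdsWithin_le_nhds).mul h).congr fun s => ?_
    rw [slope_def_module, slope_def_module, h0]
    simp only [mul_zero, sub_zero, Complex.real_smul]
    ring
  exact this.differentiableAt

theorem differentiableAt_Xs {p : ℝ} (hp : 1 < p) (ρ : Matrix κ κ ℂ) {lam : κ → ℝ}
    (hlam : ∀ i, 0 ≤ lam i) (x y : κ) :
    DifferentiableAt ℝ (fun s => Xs s ρ (Matrix.diagonal fun i => (lam i : ℂ)) x y) p := by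
  have he : DifferentiableAt ℝ (fun s : ℝ => (1 - s) / (2 * s)) p := by
    refine DifferentiableAt.div (by fun_prop) (by fun_prop) (by linarith)
  have hne : (1 - p) / (2 * p) ≠ 0 := (div_neg_of_neg_of_pos (by linarith) (by linarith)).ne
  have hd : ∀ i, DifferentiableAt ℝ (fun s : ℝ => ((lam i ^ ((1 - s) / (2 * s)) : ℝ) : ℂ)) p :=
    fun i => (Complex.ofRealCLM.differentiableAt (𝕜 := ℝ)).comp p
      (differentiableAt_rpow_exp (hlam i) he hne)
  simp only [Xs, rp_diagonal, Matrix.diagonal_mul, Matrix.mul_diagonal]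
  exact ((hd x).mul_const _).mul (hd y)

theorem continuousAt_rp_Xs {p : ℝ} (hp : 1 < p) {ρ : Matrix κ κ ℂ} (hρ : ρ.PosSemidef) {lam : κ → ℝ}
    (hlam : ∀ i, 0 ≤ lam i) :
    ContinuousAt (fun s => rp (s - 1) (Xs s ρ (Matrix.diagonal fun i => (lam i : ℂ)))) p := by
  have hD : (Matrix.diagonal fun i => (lam i : ℂ)).PosSemidef :=
    Matrix.posSemidef_diagonal_iff.2 fun i => by exact_mod_cast hlam i
  refine tendsto_of_seq_tendsto fun s hs => ?_
  refine tendsto_fc (F := fun (q : ℝ) x => ((x ^ (q - 1) : ℝ) : ℂ)) hs (fun x hx => ?_)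
    (fun k => Xs_posSemidef _ hρ hD) ?_
  · refine ContinuousAt.continuousWithinAt ?_
    refine Complex.continuous_ofReal.continuousAt.comp ?_
    have h1 : ContinuousAt (fun z : ℝ × ℝ => z.2 ^ (z.1 - 1)) (p, x) :=
      ContinuousAt.rpow (by fun_prop) (by fun_prop) (Or.inr (by simpa using hp))
    exact h1
  · refine tendsto_pi_nhds.2 fun x => tendsto_pi_nhds.2 fun y => ?_
    exact (differentiableAt_Xs hp ρ hlam x y).continuousAt.tendsto.comp hs

theorem eventually_Qsand_le_diagonal {p : ℝ} (hp : 1 < p) {ρ : Matrix κ κ ℂ} (hρ : ρ.PosSemidef)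
    {lam : κ → ℝ} (hlam : ∀ i, 0 ≤ lam i) {a : ℝ}
    (hpos : 0 < Qsand p ρ (Matrix.diagonal fun i => (lam i : ℂ)))
    (h : ∀ s, 1 < s → Qsand p ρ (Matrix.diagonal fun i => (lam i : ℂ)) * Real.exp (a * (s - p)) ≤
      Qsand s ρ (Matrix.diagonal fun i => (lam i : ℂ))) {ε : ℝ} (hε : 0 < ε) :
    ∀ᶠ s in nhds p, Qsand s ρ (Matrix.diagonal fun i => (lam i : ℂ)) ≤
      Qsand p ρ (Matrix.diagonal fun i => (lam i : ℂ)) * Real.exp (a * (s - p) + ε * |s - p|) := by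
  have hD : (Matrix.diagonal fun i => (lam i : ℂ)).PosSemidef :=
    Matrix.posSemidef_diagonal_iff.2 fun i => by exact_mod_cast hlam i
  set D := (Matrix.diagonal fun i => (lam i : ℂ)) with hDdef
  set Q := Qsand p ρ D
  have hX := fun s => Xs_posSemidef s hρ hD
  set F : ℝ → ℝ := fun s => rtr (rp s (Xs p ρ D)) -
    s * rtr (rp (s - 1) (Xs s ρ D) * (Xs p ρ D - Xs s ρ D)) with hF
  have hQF : ∀ s, 1 < s → Qsand s ρ D ≤ F s := by
    intro s hs
    rw [Qsand_eq hs hρ hD]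
    have := klein (hX s) (hX p) hs
    simp only [hF]
    linarith
  have hFp : F p = Q := by
    simp only [hF, sub_self, Matrix.mul_zero]
    rw [show Q = _ from Qsand_eq hp hρ hD]
    simp [rtr]
  have hdF : DifferentiableAt ℝ F p := by
    refine DifferentiableAt.sub ?_ (DifferentiableAt.mul differentiableAt_id ?_)
    · obtain ⟨V, x, hd, hx⟩ := exists_diag_psd (hX p)
      simp only [hd.rtr_rp]
      refine DifferentiableAt.fun_sum fun i _ => ?_
      exact differentiableAt_rpow_exp (hx i) differentiableAt_id (by simp; linarith)
    · have : (fun s => rtr (rp (s - 1) (Xs s ρ D) * (Xs p ρ D - Xs s ρ D))) = fun s =>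
          (∑ x, ∑ y, rp (s - 1) (Xs s ρ D) x y * (Xs p ρ D y x - Xs s ρ D y x)).re := by
        funext s
        simp [rtr, Matrix.trace, Matrix.mul_apply]
      rw [this]
      refine (Complex.reCLM.differentiableAt (𝕜 := ℝ)).comp p ?_
      refine DifferentiableAt.fun_sum fun x _ => DifferentiableAt.fun_sum fun y _ => ?_
      refine differentiableAt_mul_of_continuousAt ?_ ?_ (sub_self _)
      · exact ((continuous_apply_apply x y).continuousAt).comp (continuousAt_rp_Xs hp hρ hlam)
      · exact (differentiableAt_const _).sub (differentiableAt_Xs hp ρ hlam y x)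
  have hE : HasDerivAt (fun s => Q * Real.exp (a * (s - p))) (Q * a) p := by
    have h1 : HasDerivAt (fun s : ℝ => a * (s - p)) a p := by
      simpa using ((hasDerivAt_id p).sub_const p).const_mul a
    have h2 := (h1.exp).const_mul Q
    simpa using h2
  have hmin : IsLocalMin (fun s => F s - Q * Real.exp (a * (s - p))) p := by
    filter_upwards [lt_mem_nhds hp] with s hs
    have := (h s hs).trans (hQF s hs)
    simp only [hFp]
    simp
    linarith
  have hd0 := hmin.hasDerivAt_eq_zero (hdF.hasDerivAt.sub hE)
  have hlog : HasDerivAt (fun s => Real.log (F s)) a p := by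
    have := hdF.hasDerivAt.log (by rw [hFp]; exact hpos.ne')
    rw [hFp, show deriv F p = Q * a by linarith, mul_div_cancel_left₀ _ hpos.ne'] at this
    exact this
  have hlo := hlog.isLittleO.bound hε
  have hFpos : ∀ᶠ s in nhds p, 0 < F s :=
    hdF.continuousAt.tendsto.eventually_const_lt (by rw [hFp]; exact hpos)
  filter_upwards [hlo, hFpos, lt_mem_nhds hp] with s h1 h2 h3
  refine (hQF s h3).trans ?_
  rw [Real.norm_eq_abs, Real.norm_eq_abs, smul_eq_mul, hFp] at h1
  have h4 := (abs_le.1 h1).2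
  rw [← Real.log_le_log_iff h2 (by positivity), Real.log_mul hpos.ne' (Real.exp_ne_zero _),
    Real.log_exp]
  linarith

/-- A tangent line from below is also a first-order upper bound for `s ↦ log Q̃_s`. -/
theorem eventually_Qsand_le {p : ℝ} (hp : 1 < p) {ρ σ : Matrix κ κ ℂ} (hρ : ρ.PosSemidef)
    (hσ : σ.PosSemidef) {a : ℝ} (hpos : 0 < Qsand p ρ σ)
    (h : ∀ s, 1 < s → Qsand p ρ σ * Real.exp (a * (s - p)) ≤ Qsand s ρ σ) {ε : ℝ} (hε : 0 < ε) :
    ∀ᶠ s in nhds p, Qsand s ρ σ ≤ Qsand p ρ σ * Real.exp (a * (s - p) + ε * |s - p|) := by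
  obtain ⟨V, lam, hd, hlam⟩ := exists_diag_psd hσ
  have e : ∀ s, 1 < s → Qsand s (V.conjTranspose * ρ * V) (Matrix.diagonal fun i => (lam i : ℂ)) =
      Qsand s ρ σ := fun s hs => by
    rw [← hd.conj_eq, Qsand_conj' hs hρ hσ hd.l hd.r]
  have := eventually_Qsand_le_diagonal hp (hρ.conjTranspose_mul_mul_same V) hlam (a := a)
    (by rwa [e p hp]) (fun s hs => by rw [e p hp, e s hs]; exact h s hs) hε
  filter_upwards [this, lt_mem_nhds hp] with s h1 h2
  rwa [e p hp, e s h2] at h1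

end TiltedExponent

section PointwiseBound

theorem pointwise_test_bound {p δ ε r H Ψ n : ℝ} (hδ : 0 ≤ δ) (hpδ : 1 < p - δ)
    (hn : 0 ≤ n) (hH : (p - 1) * r - Ψ = p * H) {L b : ℝ} (hL : 0 ≤ L) (hb : 0 ≤ b)
    (h0 : L = 0 → b = 0) :
    Real.exp (-(n * (H + (2 * p - 1) * ε))) * (b ^ p / Real.exp (n * Ψ) -
      (L ^ ((1 - (p + δ)) / (p + δ)) * (L ^ ((p - 1) / p) * b)) ^ (p + δ) / Real.exp (n * Ψ) *
        Real.exp (-(n * (δ * (r - H) + δ * ε))) -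
      (L ^ ((1 - (p - δ)) / (p - δ)) * (L ^ ((p - 1) / p) * b)) ^ (p - δ) / Real.exp (n * Ψ) *
        Real.exp (-(n * (-(δ * (r - H)) + δ * ε)))) ≤
    L ^ ((p - 1) / p) * b * min 1 (Real.exp (-(n * r)) * (b ^ p / (L * Real.exp (n * Ψ)))) := by
  have hp : 1 < p := by linarith
  rcases hb.eq_or_lt with hb0 | hb0
  · rw [← hb0]
    simp [Real.zero_rpow (show p ≠ 0 by linarith), Real.zero_rpow (show p + δ ≠ 0 by linarith),
      Real.zero_rpow (show p - δ ≠ 0 by linarith)]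
  have hL0 : 0 < L := hL.lt_of_ne fun h => hb0.ne' (h0 h.symm)
  obtain ⟨l, rfl⟩ : ∃ l, L = Real.exp l := ⟨Real.log L, (Real.exp_log hL0).symm⟩
  obtain ⟨β, rfl⟩ : ∃ β, b = Real.exp β := ⟨Real.log b, (Real.exp_log hb0).symm⟩
  set y := β - l / p with hy
  have hp0 : p ≠ 0 := by linarith
  have e1 : ∀ s : ℝ, s ≠ 0 → (Real.exp l ^ ((1 - s) / s) * (Real.exp l ^ ((p - 1) / p) *
      Real.exp β)) ^ s / Real.exp (n * Ψ) = Real.exp (p * β - n * Ψ + (s - p) * y) := by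
    intro s hs
    rw [← Real.exp_mul, ← Real.exp_mul, ← Real.exp_add, ← Real.exp_add, ← Real.exp_mul,
      ← Real.exp_sub, hy]
    congr 1
    field_simp
    ring
  rw [e1 _ (by linarith), e1 _ (by linarith), ← Real.exp_mul l, ← Real.exp_mul β p,
    ← Real.exp_add l (n * Ψ), ← Real.exp_sub (β * p) (n * Ψ), ← Real.exp_sub (β * p) (l + n * Ψ),
    ← Real.exp_add (-(n * r)), ← Real.exp_add (l * _) β, ← Real.exp_add, ← Real.exp_add]
  by_cases hc : |y - n * (r - H)| ≤ n * ε
  · have hc' := abs_le.1 hc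
    have hm : Real.exp (-(p * (n * ε))) ≤
        min 1 (Real.exp (-(n * r) + (β * p - (l + n * Ψ)))) := by
      have hpos : 0 ≤ n * ε := (abs_nonneg _).trans hc
      refine le_min (Real.exp_le_one_iff.2 ?_) (Real.exp_le_exp.2 ?_)
      · have := mul_nonneg (show 0 ≤ p by linarith) hpos
        linarith
      · have h1 : -(n * r) + (β * p - (l + n * Ψ)) = p * (y - n * (r - H)) := by
          rw [hy, mul_sub, mul_sub, mul_div_cancel₀ _ hp0]
          linear_combination n * hH
        rw [h1]
        nlinarith
    calc _ ≤ Real.exp (-(n * (H + (2 * p - 1) * ε))) * Real.exp (β * p - n * Ψ) := by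
            refine mul_le_mul_of_nonneg_left ?_ (Real.exp_pos _).le
            have h1 := Real.exp_pos (p * β - n * Ψ + (p + δ - p) * y + -(n * (δ * (r - H) + δ * ε)))
            have h2 := Real.exp_pos
              (p * β - n * Ψ + (p - δ - p) * y + -(n * (-(δ * (r - H)) + δ * ε)))
            linarith
      _ ≤ Real.exp (l * ((p - 1) / p) + β) * Real.exp (-(p * (n * ε))) := by
            rw [← Real.exp_add, ← Real.exp_add]
            refine Real.exp_le_exp.2 ?_
            have h1 : l * ((p - 1) / p) + β = β * p - (p - 1) * y := by
              rw [hy]; field_simp; ring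
            rw [h1]
            nlinarith [mul_le_mul_of_nonneg_left hc'.2 (show 0 ≤ p - 1 by linarith)]
      _ ≤ _ := mul_le_mul_of_nonneg_left hm (Real.exp_pos _).le
  · refine le_trans ?_ (mul_nonneg (Real.exp_pos _).le (le_min zero_le_one (Real.exp_pos _).le))
    refine mul_nonpos_of_nonneg_of_nonpos (Real.exp_pos _).le ?_
    have h1 := Real.exp_pos (p * β - n * Ψ + (p + δ - p) * y + -(n * (δ * (r - H) + δ * ε)))
    have h2 := Real.exp_pos (p * β - n * Ψ + (p - δ - p) * y + -(n * (-(δ * (r - H)) + δ * ε)))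
    rw [not_le, lt_abs] at hc
    rcases hc with hc | hc
    · have : Real.exp (β * p - n * Ψ) ≤
          Real.exp (p * β - n * Ψ + (p + δ - p) * y + -(n * (δ * (r - H) + δ * ε))) := by
        refine Real.exp_le_exp.2 ?_
        nlinarith [mul_le_mul_of_nonneg_left hc.le hδ]
      linarith
    · have : Real.exp (β * p - n * Ψ) ≤
          Real.exp (p * β - n * Ψ + (p - δ - p) * y + -(n * (-(δ * (r - H)) + δ * ε))) := by
        refine Real.exp_le_exp.2 ?_
        nlinarith [mul_le_mul_of_nonneg_left hc.le hδ]
      linarith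

variable {κ : Type*} [Fintype κ] [DecidableEq κ]

theorem exists_test_diagonal {p δ ε r H Ψ n : ℝ} (hδ : 0 ≤ δ) (hpδ : 1 < p - δ)
    (hn : 0 ≤ n) (hH : (p - 1) * r - Ψ = p * H) {L : κ → ℝ} (hL : ∀ x, 0 ≤ L x)
    (hne : Nonempty κ) {ρ : Matrix κ κ ℂ} (hρ : ρ.PosSemidef) (h0 : ∀ x y, L x = 0 → ρ x y = 0)
    (hQ : Qsand p ρ (Matrix.diagonal fun x => (L x : ℂ)) = Real.exp (n * Ψ))
    (hQp : Qsand (p + δ) ρ (Matrix.diagonal fun x => (L x : ℂ)) ≤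
      Real.exp (n * Ψ) * Real.exp (n * (δ * (r - H) + δ * ε / 2)))
    (hQm : Qsand (p - δ) ρ (Matrix.diagonal fun x => (L x : ℂ)) ≤
      Real.exp (n * Ψ) * Real.exp (n * (-(δ * (r - H)) + δ * ε / 2))) :
    ∃ T, IsTest T ∧ (∀ τ : Matrix κ κ ℂ, τ.PosSemidef →
      rtr (τ * (Matrix.diagonal (fun x => ((L x ^ (-(1 / 2) : ℝ) : ℝ) : ℂ)) *
        rp p (pinch L (Xs p ρ (Matrix.diagonal fun x => (L x : ℂ)))) *
        Matrix.diagonal (fun x => ((L x ^ (-(1 / 2) : ℝ) : ℝ) : ℂ)))) ≤ Real.exp (n * Ψ) →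
      rtr (τ * T) ≤ Real.exp (-(n * r))) ∧
      Real.exp (-(n * (H + (2 * p - 1) * ε))) *
        ((nval L : ℝ) ^ (-p) - 2 * Real.exp (-(n * (δ * ε / 2)))) ≤ rtr (T * ρ) := by
  have hp : 1 < p := by linarith
  have hσ : (Matrix.diagonal fun x => (L x : ℂ)).PosSemidef := (diag_diagonal L).posSemidef hL
  set D := (Matrix.diagonal fun x => (L x : ℂ)) with hDdef
  have hBp : (Xs p ρ D).PosSemidef := Xs_posSemidef p hρ hσ
  set B := Xs p ρ D with hB
  obtain ⟨W, b, hd, hb, hW, hbe⟩ := exists_pinch L hBp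
  have hb0 : ∀ x, L x = 0 → b x = 0 := fun x hx => by
    refine pinch_diag_eq_zero hW hbe fun y z hy => ?_
    rw [hB, Xs, rp_diagonal, Matrix.mul_diagonal, Matrix.diagonal_mul, h0 y z (hy.trans hx)]
    simp
  have hρd : ∀ x, (W.conjTranspose * ρ * W) x x = ((L x ^ ((p - 1) / p) * b x : ℝ) : ℂ) := by
    intro x
    rw [eq_Xs_diagonal hp hL hρ.1 h0, block_conj_scale hW (fun l => l ^ ((p - 1) / (2 * p))), hbe,
      ← Real.rpow_natCast, ← Real.rpow_mul (hL x)]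
    rw [show (p - 1) / (2 * p) * ((2 : ℕ) : ℝ) = (p - 1) / p by push_cast; field_simp]
    push_cast
    rfl
  have hpei : ∀ s, 1 < s → ∑ x, (L x ^ ((1 - s) / s) * (L x ^ ((p - 1) / p) * b x)) ^ s ≤
      Qsand s ρ D := by
    intro s hs
    rw [Qsand_eq hs hρ hσ]
    refine le_trans (le_of_eq ?_) (peierls (Xs_posSemidef s hρ hσ) hd.l hd.r hs)
    refine Finset.sum_congr rfl fun x _ => ?_
    congr 1
    rw [Xs, rp_diagonal, block_conj_scale hW (fun l => l ^ ((1 - s) / (2 * s))), hρd,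
      ← Complex.ofReal_mul, Complex.ofReal_re, ← Real.rpow_natCast, ← Real.rpow_mul (hL x)]
    congr 2
    push_cast
    field_simp
  set t : κ → ℝ := fun x =>
    min 1 (Real.exp (-(n * r)) * (b x ^ p / (L x * Real.exp (n * Ψ)))) with ht
  have ht0 : ∀ x, 0 ≤ t x := fun x => le_min zero_le_one (mul_nonneg (Real.exp_pos _).le
    (div_nonneg (Real.rpow_nonneg (hb x) _) (mul_nonneg (hL x) (Real.exp_pos _).le)))
  have ht1 : ∀ x, t x ≤ 1 := fun x => min_le_left _ _
  have hdT : Diag (W * Matrix.diagonal (fun x => (t x : ℂ)) * W.conjTranspose) W t :=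
    ⟨hd.l, hd.r, rfl⟩
  have hdT' : Diag (1 - W * Matrix.diagonal (fun x => (t x : ℂ)) * W.conjTranspose) W
      (fun x => 1 - t x) := by
    refine ⟨hd.l, hd.r, ?_⟩
    have : (Matrix.diagonal fun x => ((1 - t x : ℝ) : ℂ)) =
        1 - Matrix.diagonal fun x => (t x : ℂ) := by
      rw [← Matrix.diagonal_one, Matrix.diagonal_sub]
      simp
    rw [this, Matrix.mul_sub, Matrix.sub_mul, Matrix.mul_one, hd.r]
  refine ⟨_, ⟨hdT.posSemidef ht0, hdT'.posSemidef fun x => sub_nonneg.2 (ht1 x)⟩,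
    fun τ hτ hle => ?_, ?_⟩
  · have e1 : rtr (τ * (Matrix.diagonal (fun x => ((L x ^ (-(1 / 2) : ℝ) : ℝ) : ℂ)) *
        rp p (pinch L B) * Matrix.diagonal (fun x => ((L x ^ (-(1 / 2) : ℝ) : ℝ) : ℂ)))) =
        ∑ x, b x ^ p * ((L x)⁻¹ * ((W.conjTranspose * τ * W) x x).re) := by
      set E := (Matrix.diagonal (fun x => ((L x ^ (-(1 / 2) : ℝ) : ℝ) : ℂ))) with hE
      have : rtr (τ * (E * rp p (pinch L B) * E)) = rtr ((E * τ * E) * rp p (pinch L B)) := by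
        rw [← Matrix.mul_assoc, rtr_mul_comm]
        simp only [Matrix.mul_assoc]
      rw [this, (hd.rp_diag p).eq, rtr_mul_diag_conj]
      refine Finset.sum_congr rfl fun x _ => ?_
      rw [hE, block_conj_scale hW (fun l => l ^ (-(1 / 2) : ℝ)), Complex.re_ofReal_mul,
        ← Real.rpow_natCast, ← Real.rpow_mul (hL x)]
      norm_num [Real.rpow_neg_one]
    rw [e1] at hle
    rw [rtr_mul_diag_conj]
    calc _ ≤ ∑ x, Real.exp (-(n * r)) / Real.exp (n * Ψ) *
          (b x ^ p * ((L x)⁻¹ * ((W.conjTranspose * τ * W) x x).re)) := by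
          refine Finset.sum_le_sum fun x _ => ?_
          refine (mul_le_mul_of_nonneg_right (min_le_right _ _) (conj_apply_nonneg hτ W x)).trans_eq ?_
          rw [div_eq_mul_inv, mul_inv, div_eq_mul_inv]
          ring
      _ ≤ Real.exp (-(n * r)) / Real.exp (n * Ψ) * Real.exp (n * Ψ) := by
          rw [← Finset.mul_sum]
          exact mul_le_mul_of_nonneg_left hle (by positivity)
      _ = _ := div_mul_cancel₀ _ (Real.exp_ne_zero _)
  · rw [rtr_mul_comm, rtr_mul_diag_conj]
    have hv : (0 : ℝ) < nval L := by exact_mod_cast (one_le_nval L)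
    have hs1 : (nval L : ℝ) ^ (-p) ≤ (∑ x, b x ^ p) / Real.exp (n * Ψ) := by
      rw [le_div_iff₀ (Real.exp_pos _), ← hQ, Qsand_eq hp hρ hσ, Real.rpow_neg hv.le,
        inv_mul_le_iff₀ (Real.rpow_pos_of_pos hv _)]
      exact rtr_rp_le_pinch L hBp hd hp
    have hs2 : ∀ s c, 1 < s → Qsand s ρ D ≤ Real.exp (n * Ψ) * Real.exp (n * (c + δ * ε / 2)) →
        (∑ x, (L x ^ ((1 - s) / s) * (L x ^ ((p - 1) / p) * b x)) ^ s) / Real.exp (n * Ψ) *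
          Real.exp (-(n * (c + δ * ε))) ≤ Real.exp (-(n * (δ * ε / 2))) := by
      intro s c hs h
      have h1 : (∑ x, (L x ^ ((1 - s) / s) * (L x ^ ((p - 1) / p) * b x)) ^ s) /
          Real.exp (n * Ψ) ≤ Real.exp (n * (c + δ * ε / 2)) := by
        rw [div_le_iff₀ (Real.exp_pos _), mul_comm]
        exact (hpei s hs).trans h
      refine (mul_le_mul_of_nonneg_right h1 (Real.exp_pos _).le).trans_eq ?_
      rw [← Real.exp_add]
      congr 1
      ring
    have h1 := hs2 _ _ (by linarith) hQp
    have h2 := hs2 _ _ hpδ hQm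
    refine le_trans ?_ ((Finset.sum_le_sum fun x _ =>
      pointwise_test_bound (ε := ε) hδ hpδ hn hH (hL x) (hb x) (hb0 x)).trans_eq
        (Finset.sum_congr rfl fun x _ => ?_))
    · rw [← Finset.mul_sum, Finset.sum_sub_distrib, Finset.sum_sub_distrib, ← Finset.sum_mul,
        ← Finset.sum_mul, ← Finset.sum_div, ← Finset.sum_div, ← Finset.sum_div]
      refine mul_le_mul_of_nonneg_left ?_ (Real.exp_pos _).le
      linarith
    · rw [hρd, Complex.ofReal_re, mul_comm]

end PointwiseBound

section TestConstruction

variable {κ : Type*} [Fintype κ] [DecidableEq κ]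

theorem eventually_exp_le_rpow_sub (m : ℕ) {p c ε : ℝ} (hp : 0 < p) (hc : 0 < c) (hε : 0 < ε) :
    ∀ᶠ n : ℕ in atTop, ∀ v : ℝ, 0 < v → v ≤ ((n : ℝ) + 1) ^ m →
      Real.exp (-(n * ε)) ≤ v ^ (-p) - 2 * Real.exp (-(n * c)) := by
  set θ := min ε c / 2 with hθ
  have hθ0 : 0 < θ := half_pos (lt_min hε hc)
  have h1 : 2 * θ ≤ ε := by rw [hθ]; linarith [min_le_left ε c]
  have h2 : 2 * θ ≤ c := by rw [hθ]; linarith [min_le_right ε c]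
  filter_upwards [eventually_poly_le_exp m (div_pos hθ0 hp), eventually_poly_le_exp 1 hθ0,
    eventually_ge_atTop 2] with n hn1 hn2 hn3 v hv hvn
  have h3 : Real.exp (-(n * θ)) ≤ v ^ (-p) := by
    refine le_trans (le_of_eq ?_) (Real.rpow_le_rpow_of_nonpos hv (hvn.trans hn1) (by linarith))
    rw [← Real.exp_mul]
    congr 1
    field_simp
  have h4 : (3 : ℝ) ≤ Real.exp (θ * n) := by
    have : (2 : ℝ) ≤ n := by exact_mod_cast hn3
    linarith
  have h5 : Real.exp (-(n * ε)) ≤ Real.exp (-(n * (2 * θ))) := by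
    rw [Real.exp_le_exp]; gcongr
  have h6 : Real.exp (-(n * c)) ≤ Real.exp (-(n * (2 * θ))) := by
    rw [Real.exp_le_exp]; gcongr
  have h7 : 3 * Real.exp (-(n * (2 * θ))) ≤ Real.exp (-(n * θ)) := by
    refine (mul_le_mul_of_nonneg_right h4 (Real.exp_pos _).le).trans_eq ?_
    rw [← Real.exp_add]
    congr 1
    ring
  linarith

/-- Achievability: a test built from the pinched `n`-copy operator `X^{⊗n}`. -/
theorem exists_test [Nonempty κ] {p r H : ℝ} (hp : 1 < p) {ρ σ V : Matrix κ κ ℂ} {lam : κ → ℝ}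
    (hρ : ρ.PosSemidef) (hσ : σ.PosSemidef) (hk : ∀ v, σ.mulVec v = 0 → ρ.mulVec v = 0)
    (hpos : 0 < Qsand p ρ σ) (hd : Diag σ V lam) (hlam : ∀ i, 0 ≤ lam i)
    (hH : (p - 1) * r - Real.log (Qsand p ρ σ) = p * H)
    (htan : ∀ s, 1 < s → Qsand p ρ σ * Real.exp ((r - H) * (s - p)) ≤ Qsand s ρ σ)
    {ε : ℝ} (hε : 0 < ε) :
    ∀ᶠ n : ℕ in atTop, ∃ T : Matrix (Fin n → κ) (Fin n → κ) ℂ, IsTest T ∧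
      (∀ τ : Matrix (Fin n → κ) (Fin n → κ) ℂ, τ.PosSemidef →
        rtr ((tpowG V n).conjTranspose * τ * tpowG V n *
          (Matrix.diagonal (fun x => (((∏ i, lam (x i)) ^ (-(1 / 2) : ℝ) : ℝ) : ℂ)) *
          rp p (pinch (fun x : Fin n → κ => ∏ i, lam (x i))
            (tpowG (V.conjTranspose * Xs p ρ σ * V) n)) *
          Matrix.diagonal (fun x => (((∏ i, lam (x i)) ^ (-(1 / 2) : ℝ) : ℝ) : ℂ)))) ≤
            Qsand p ρ σ ^ n →
        rtr (τ * T) ≤ Real.exp (-(n * r))) ∧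
      Real.exp (-(n * (H + ε))) ≤ rtr (T * tpowG ρ n) := by
  have hp2 : 0 < 2 * p - 1 := by linarith
  set ε₁ := ε / 2 / (2 * p - 1) with hε₁
  have hε₁0 : 0 < ε₁ := by positivity
  obtain ⟨η, hη, hev⟩ := Metric.eventually_nhds_iff.1
    (eventually_Qsand_le hp hρ hσ hpos htan (half_pos hε₁0))
  set δ := min (η / 2) ((p - 1) / 2) with hδ
  have hδ0 : 0 < δ := lt_min (by linarith) (by linarith)
  have hδ1 : δ < η := (min_le_left _ _).trans_lt (by linarith)
  have hδ2 : 1 < p - δ := by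
    have := min_le_right (η / 2) ((p - 1) / 2)
    rw [← hδ] at this; linarith
  filter_upwards [eventually_exp_le_rpow_sub (Fintype.card κ) (show 0 < p by linarith)
    (show 0 < δ * ε₁ / 2 by positivity) (half_pos hε)] with n hn
  have hdn := hd.tens n
  have hρn := tpowG_posSemidef hρ n
  have hσn := tpowG_posSemidef hσ n
  have hρ' := hρn.conjTranspose_mul_mul_same (tpowG V n)
  have hL : ∀ x : Fin n → κ, 0 ≤ ∏ i, lam (x i) := fun x => Finset.prod_nonneg fun i _ => hlam _
  have h0 : ∀ x y : Fin n → κ, ∏ i, lam (x i) = 0 →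
      ((tpowG V n).conjTranspose * tpowG ρ n * tpowG V n) x y = 0 := by
    intro x y hx
    obtain ⟨i, -, hi⟩ := Finset.prod_eq_zero_iff.1 hx
    rw [tpowG_conjTranspose, tpowG_mul, tpowG_mul, tpowG_apply]
    exact Finset.prod_eq_zero (Finset.mem_univ i) (kernel_diag hd hρ.1 hk _ _ hi)
  have hQs : ∀ s, 1 < s → Qsand s ((tpowG V n).conjTranspose * tpowG ρ n * tpowG V n)
      (Matrix.diagonal fun x : Fin n → κ => ((∏ i, lam (x i) : ℝ) : ℂ)) = Qsand s ρ σ ^ n := by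
    intro s hs
    rw [← hdn.conj_eq, Qsand_conj' hs hρn hσn hdn.l hdn.r, Qsand_tpowG hs hρ hσ]
  have hQn : Qsand p ρ σ ^ n = Real.exp (n * Real.log (Qsand p ρ σ)) := by
    rw [Real.exp_nat_mul, Real.exp_log hpos]
  have hX : Xs p ((tpowG V n).conjTranspose * tpowG ρ n * tpowG V n)
      (Matrix.diagonal fun x : Fin n → κ => ((∏ i, lam (x i) : ℝ) : ℂ)) =
      tpowG (V.conjTranspose * Xs p ρ σ * V) n := by
    rw [← hdn.conj_eq, tpowG_conjTranspose, tpowG_mul, tpowG_mul, tpowG_mul, tpowG_mul,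
      Xs_tpowG p (hσ.conjTranspose_mul_mul_same V)]
    congr 1
    have := Xs_conj (U := V.conjTranspose) p hσ.1 (ρ := ρ) (by simpa using hd.r)
      (by simpa using hd.l)
    simpa using this
  have hbd : ∀ s c, 1 < s → dist s p < η → (r - H) * (s - p) + ε₁ / 2 * |s - p| = c →
      Qsand s ρ σ ^ n ≤ Real.exp (n * Real.log (Qsand p ρ σ)) * Real.exp (n * c) := by
    intro s c hs hsd hc
    rw [← hQn, Real.exp_nat_mul, ← mul_pow, ← hc]
    refine pow_le_pow_left₀ ?_ (hev hsd) n
    rw [Qsand_eq hs hρ hσ]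
    exact rtr_nonneg (rp_posSemidef (Xs_posSemidef s hρ hσ) _)
  obtain ⟨T, hT, hT2, hT3⟩ := exists_test_diagonal (n := n) (ε := ε₁) hδ0.le hδ2 (Nat.cast_nonneg n)
    hH hL inferInstance hρ' h0 (by rw [hQs p hp, hQn])
    (by
      rw [hQs _ (by linarith)]
      refine hbd _ _ (by linarith) (by simpa [abs_of_pos hδ0] using hδ1) ?_
      rw [add_sub_cancel_left, abs_of_pos hδ0]; ring)
    (by
      rw [hQs _ (by linarith)]
      refine hbd _ _ (by linarith) (by simpa [abs_of_pos hδ0] using hδ1) ?_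
      rw [show p - δ - p = -δ by ring, abs_neg, abs_of_pos hδ0]; ring)
  refine ⟨tpowG V n * T * (tpowG V n).conjTranspose, ?_, fun τ hτ h => ?_, ?_⟩
  · have := conj_test (U := (tpowG V n).conjTranspose) (by simpa using hdn.r) hT
    simpa using this
  · have h1 := hT2 _ (hτ.conjTranspose_mul_mul_same (tpowG V n)) (by rw [hX, ← hQn]; exact h)
    refine le_trans (le_of_eq ?_) h1
    rw [← Matrix.mul_assoc, rtr_mul_comm]
    simp only [Matrix.mul_assoc]
  · have h1 : rtr (tpowG V n * T * (tpowG V n).conjTranspose * tpowG ρ n) =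
        rtr (T * ((tpowG V n).conjTranspose * tpowG ρ n * tpowG V n)) := by
      rw [Matrix.mul_assoc, Matrix.mul_assoc, rtr_mul_comm]
      simp only [Matrix.mul_assoc]
    rw [h1]
    refine le_trans ?_ hT3
    have h2 := hn (nval fun x : Fin n → κ => ∏ i, lam (x i))
      (by exact_mod_cast one_le_nval fun x : Fin n → κ => ∏ i, lam (x i))
      (by exact_mod_cast nval_prod_le lam n)
    refine le_trans (le_of_eq ?_) (mul_le_mul_of_nonneg_left h2 (Real.exp_pos _).le)
    rw [← Real.exp_add]
    congr 1
    rw [hε₁, mul_div_cancel₀ _ hp2.ne']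
    ring

end TestConstruction

section Mellin

/-- The Mellin transform of `t ↦ 1 / (1 + t)`. -/
def mellinInv (z : ℂ) : ℂ := mellin (fun t : ℝ => (((1 + t : ℝ)⁻¹ : ℝ) : ℂ)) z

theorem image_div_one_sub : (fun x : ℝ => x / (1 - x)) '' Set.Ioo 0 1 = Set.Ioi 0 := by
  ext t
  constructor
  · rintro ⟨x, ⟨h0, h1⟩, rfl⟩
    exact div_pos h0 (by linarith)
  · intro ht
    have ht' : (0 : ℝ) < t := ht
    refine ⟨t / (1 + t), ⟨by positivity, (div_lt_one (by positivity)).2 (by linarith)⟩, ?_⟩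
    field_simp
    ring

theorem mellinInv_integrand (z : ℂ) {x : ℝ} (hx : x ∈ Set.Ioo (0 : ℝ) 1) :
    |1 / (1 - x) ^ 2| • (((x / (1 - x) : ℝ) : ℂ) ^ (z - 1) •
      (((1 + x / (1 - x) : ℝ)⁻¹ : ℝ) : ℂ)) =
      (x : ℂ) ^ (z - 1) * (1 - (x : ℂ)) ^ ((1 - z) - 1) := by
  have h1 : 0 < 1 - x := by linarith [hx.2]
  have h1c : (1 - (x : ℂ)) ≠ 0 := by
    have : ((1 - x : ℝ) : ℂ) ≠ 0 := by exact_mod_cast h1.ne'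
    simpa using this
  have e1 : (1 + x / (1 - x))⁻¹ = 1 - x := by field_simp; ring
  rw [e1, abs_of_pos (by positivity), div_eq_mul_inv x, Complex.ofReal_mul,
    Complex.mul_cpow_ofReal_nonneg hx.1.le (inv_nonneg.2 h1.le), Complex.ofReal_inv,
    Complex.inv_cpow, Complex.real_smul, smul_eq_mul]
  · have e2 : (1 - (x : ℂ)) ^ ((1 - z) - 1) = ((1 - (x : ℂ)) ^ (z - 1))⁻¹ * (1 - (x : ℂ))⁻¹ := by
      rw [← Complex.cpow_neg, ← Complex.cpow_neg_one, ← Complex.cpow_add _ _ h1c]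
      congr 1; ring
    rw [e2]
    push_cast
    field_simp
  · rw [Complex.arg_ofReal_of_nonneg h1.le]
    exact Real.pi_ne_zero.symm

theorem mellinInv_convergent {z : ℂ} (h0 : 0 < z.re) (h1 : z.re < 1) :
    MellinConvergent (fun t : ℝ => (((1 + t : ℝ)⁻¹ : ℝ) : ℂ)) z ∧ mellinInv z ≠ 0 := by
  have hd : ∀ x ∈ Set.Ioo (0 : ℝ) 1,
      HasDerivWithinAt (fun x : ℝ => x / (1 - x)) (1 / (1 - x) ^ 2) (Set.Ioo 0 1) x := by
    intro x hx
    have h1 : 1 - x ≠ 0 := by linarith [hx.2]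
    have := ((hasDerivAt_id x).div ((hasDerivAt_id x).const_sub 1) h1).hasDerivWithinAt
      (s := Set.Ioo 0 1)
    refine this.congr_deriv ?_
    simp
  have hinj : Set.InjOn (fun x : ℝ => x / (1 - x)) (Set.Ioo 0 1) := by
    intro x hx y hy hxy
    have h1 : 1 - x ≠ 0 := by linarith [hx.2]
    have h2 : 1 - y ≠ 0 := by linarith [hy.2]
    simp only at hxy
    rw [div_eq_div_iff h1 h2] at hxy
    linarith
  have hz : 0 < (1 - z).re := by simpa using h1
  set g : ℝ → ℂ := fun t => (t : ℂ) ^ (z - 1) • (((1 + t : ℝ)⁻¹ : ℝ) : ℂ) with hg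
  have hb := Complex.betaIntegral_convergent h0 hz
  rw [intervalIntegrable_iff_integrableOn_Ioo_of_le zero_le_one] at hb
  constructor
  · rw [MellinConvergent, ← image_div_one_sub,
      integrableOn_image_iff_integrableOn_abs_deriv_smul measurableSet_Ioo hd hinj]
    exact hb.congr_fun (fun x hx => (mellinInv_integrand z hx).symm) measurableSet_Ioo
  · have h2 : mellinInv z = Complex.betaIntegral z (1 - z) := by
      rw [mellinInv, mellin, ← image_div_one_sub,
        integral_image_eq_integral_abs_deriv_smul measurableSet_Ioo hd hinj,
        Complex.betaIntegral, intervalIntegral.integral_of_le zero_le_one,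
        integral_Ioc_eq_integral_Ioo]
      exact setIntegral_congr_fun measurableSet_Ioo fun x hx => mellinInv_integrand z hx
    have h3 := Complex.Gamma_mul_Gamma_eq_betaIntegral h0 hz
    rw [h2]
    intro h
    rw [h, mul_zero] at h3
    exact mul_ne_zero (Complex.Gamma_ne_zero_of_re_pos h0) (Complex.Gamma_ne_zero_of_re_pos hz) h3

theorem mellin_inv_add {z : ℂ} (h0 : 0 < z.re) (h1 : z.re < 1) {x : ℝ} (hx : 0 < x) :
    IntegrableOn (fun t : ℝ => (t : ℂ) ^ (z - 1) * (((t + x : ℝ)⁻¹ : ℝ) : ℂ)) (Set.Ioi 0) ∧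
      ∫ t in Set.Ioi (0 : ℝ), (t : ℂ) ^ (z - 1) * (((t + x : ℝ)⁻¹ : ℝ) : ℂ) =
        (x : ℂ) ^ (z - 1) * mellinInv z := by
  have hxi : 0 < x⁻¹ := inv_pos.2 hx
  have hxc : (x : ℂ) ≠ 0 := by exact_mod_cast hx.ne'
  have e : ∀ t : ℝ, (t : ℂ) ^ (z - 1) * (((t + x : ℝ)⁻¹ : ℝ) : ℂ) =
      (x : ℂ)⁻¹ * ((t : ℂ) ^ (z - 1) • (((1 + x⁻¹ * t : ℝ)⁻¹ : ℝ) : ℂ)) := by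
    intro t
    have : (t + x)⁻¹ = x⁻¹ * (1 + x⁻¹ * t)⁻¹ := by
      rw [← mul_inv]; congr 1; field_simp; ring
    rw [this]
    push_cast
    rw [smul_eq_mul]
    ring
  obtain ⟨hc, -⟩ := mellinInv_convergent h0 h1
  have hc' := (MellinConvergent.comp_mul_left (s := z) hxi).2 hc
  constructor
  · simp only [e]
    exact Integrable.const_mul hc' _
  · simp only [e]
    rw [integral_const_mul]
    have := mellin_comp_mul_left (fun t : ℝ => (((1 + t : ℝ)⁻¹ : ℝ) : ℂ)) z hxi
    rw [mellin] at this
    rw [this, mellinInv, smul_eq_mul, ← mul_assoc]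
    congr 1
    rw [Complex.ofReal_inv, Complex.inv_cpow, Complex.cpow_neg, inv_inv, Complex.cpow_sub _ _ hxc,
      Complex.cpow_one]
    · field_simp
    · rw [Complex.arg_ofReal_of_nonneg hx.le]
      exact Real.pi_ne_zero.symm

theorem exists_integral_rpow_inv {q : ℝ} (h0 : 0 < q) (h1 : q < 1) : ∃ J : ℝ, 0 < J ∧ ∀ x : ℝ, 0 < x →
    IntegrableOn (fun t : ℝ => t ^ (q - 1) * (t + x)⁻¹) (Set.Ioi 0) ∧
      ∫ t in Set.Ioi (0 : ℝ), t ^ (q - 1) * (t + x)⁻¹ = x ^ (q - 1) * J := by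
  have e : ∀ x : ℝ, ∀ t ∈ Set.Ioi (0 : ℝ), (t : ℂ) ^ ((q : ℂ) - 1) * (((t + x : ℝ)⁻¹ : ℝ) : ℂ) =
      ((t ^ (q - 1) * (t + x)⁻¹ : ℝ) : ℂ) := by
    intro x t ht
    rw [Complex.ofReal_mul, Complex.ofReal_cpow (le_of_lt ht)]
    push_cast
    rfl
  have hq0 : 0 < (q : ℂ).re := by simpa using h0
  have hq1 : (q : ℂ).re < 1 := by simpa using h1
  have hI : ∀ x : ℝ, 0 < x → IntegrableOn (fun t : ℝ => t ^ (q - 1) * (t + x)⁻¹) (Set.Ioi 0) := by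
    intro x hx
    exact ((mellin_inv_add hq0 hq1 hx).1.congr_fun (e x) measurableSet_Ioi).re
  have hV : ∀ x : ℝ, 0 < x → ((∫ t in Set.Ioi (0 : ℝ), t ^ (q - 1) * (t + x)⁻¹ : ℝ) : ℂ) =
      ((x ^ (q - 1) : ℝ) : ℂ) * mellinInv q := by
    intro x hx
    have h := (mellin_inv_add hq0 hq1 hx).2
    rw [setIntegral_congr_fun measurableSet_Ioi (e x), integral_complex_ofReal] at h
    rw [h, Complex.ofReal_cpow hx.le]
    push_cast
    rfl
  set J := ∫ t in Set.Ioi (0 : ℝ), t ^ (q - 1) * (t + 1)⁻¹ with hJ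
  have hJm : (J : ℂ) = mellinInv q := by
    rw [hV 1 one_pos]; simp
  refine ⟨J, lt_of_le_of_ne ?_ ?_, fun x hx => ⟨hI x hx, ?_⟩⟩
  · refine setIntegral_nonneg measurableSet_Ioi fun t ht => ?_
    have : (0 : ℝ) < t := ht
    positivity
  · intro h
    refine (mellinInv_convergent hq0 hq1).2 ?_
    rw [← hJm, ← h]; simp
  · have := hV x hx
    rw [← hJm, ← Complex.ofReal_mul] at this
    exact_mod_cast this

end Mellin

section Averaging

variable {κ : Type*} [Fintype κ] [DecidableEq κ]

theorem norm_integral_freq_sub_le (c : ℂ) (w T : ℝ) :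
    ‖(∫ t in (0 : ℝ)..T, c * Complex.exp ((Complex.I * w) * t)) - T * (if w = 0 then c else 0)‖ ≤
      ‖c‖ * (2 / |w|) := by
  rw [intervalIntegral.integral_const_mul]
  by_cases hw : w = 0
  · subst hw; simp [mul_comm]
  · have hc : Complex.I * (w : ℂ) ≠ 0 := by simp [hw]
    rw [integral_exp_mul_complex hc, if_neg hw, mul_zero, sub_zero, norm_mul, norm_div]
    have h1 : ‖Complex.I * (w : ℂ)‖ = |w| := by simp
    rw [h1]
    gcongr
    refine (norm_sub_le _ _).trans ?_
    have h2 : ∀ T : ℝ, ‖Complex.exp (Complex.I * w * T)‖ = 1 := by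
      intro T
      rw [Complex.norm_exp]; simp
    rw [h2, h2]; norm_num

/-- A trigonometric polynomial bounded above has its constant term bounded by the same number. -/
theorem re_sum_zero_freq_le (c : κ → ℂ) (w : κ → ℝ) (M : ℝ)
    (h : ∀ t : ℝ, (∑ k, c k * Complex.exp ((Complex.I * w k) * t)).re ≤ M) :
    (∑ k, if w k = 0 then c k else 0).re ≤ M := by
  set S := ∑ k, if w k = 0 then c k else 0 with hS
  set K := ∑ k, ‖c k‖ * (2 / |w k|) with hK
  have hcont : ∀ k, Continuous fun t : ℝ => c k * Complex.exp ((Complex.I * w k) * t) := by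
    intro k; fun_prop
  have key : ∀ T : ℝ, 0 < T → T * S.re - K ≤ M * T := by
    intro T hT
    have e1 : ∫ t in (0 : ℝ)..T, ∑ k, c k * Complex.exp ((Complex.I * w k) * t) =
        ∑ k, ∫ t in (0 : ℝ)..T, c k * Complex.exp ((Complex.I * w k) * t) :=
      intervalIntegral.integral_finsetSum fun k _ => (hcont k).intervalIntegrable _ _
    have e2 : ‖(∫ t in (0 : ℝ)..T, ∑ k, c k * Complex.exp ((Complex.I * w k) * t)) - T * S‖ ≤ K := by
      rw [e1, hS, Finset.mul_sum, ← Finset.sum_sub_distrib]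
      exact (norm_sum_le _ _).trans (Finset.sum_le_sum fun k _ => norm_integral_freq_sub_le _ _ _)
    have e3 : (∫ t in (0 : ℝ)..T, ∑ k, c k * Complex.exp ((Complex.I * w k) * t)).re ≤ M * T := by
      have hc : Continuous fun t : ℝ => ∑ k, c k * Complex.exp ((Complex.I * w k) * t) :=
        continuous_finsetSum _ fun k _ => hcont k
      have e4 := (Complex.reCLM.intervalIntegral_comp_comm (hc.intervalIntegrable 0 T)
        (μ := volume))
      simp only [Complex.reCLM_apply] at e4
      rw [← e4]
      calc _ ≤ ∫ t in (0 : ℝ)..T, M := intervalIntegral.integral_mono_on hT.le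
            ((Complex.continuous_re.comp hc).intervalIntegrable _ _)
            intervalIntegrable_const fun t _ => h t
        _ = M * T := by simp [mul_comm]
    have e5 := (Complex.abs_re_le_norm _).trans e2
    rw [Complex.sub_re, Complex.re_ofReal_mul] at e5
    have := (abs_le.1 e5).1
    linarith
  by_contra! hlt
  have hK0 : 0 ≤ K := Finset.sum_nonneg fun k _ => by positivity
  have hd : 0 < S.re - M := by linarith
  have := key ((K + 1) / (S.re - M)) (by positivity)
  have e : (K + 1) / (S.re - M) * (S.re - M) = K + 1 := div_mul_cancel₀ _ hd.ne'
  nlinarith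

end Averaging

section Resolvent

variable {κ : Type*} [Fintype κ] [DecidableEq κ]

/-- Integration of a parametrised functional calculus under the trace. -/
theorem integral_rtr_fc {μ : Measure ℝ} {A V : Matrix κ κ ℂ} {a : κ → ℝ} (hd : Diag A V a)
    (K : Matrix κ κ ℂ) (g : ℝ → ℝ → ℝ) (f : ℝ → ℝ)
    (h : ∀ i, ((V.conjTranspose * K * V) i i).re = 0 ∨
      (Integrable (fun t => g t (a i)) μ ∧ ∫ t, g t (a i) ∂μ = f (a i))) :
    Integrable (fun t => rtr (K * fc (fun x => (g t x : ℂ)) A)) μ ∧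
      ∫ t, rtr (K * fc (fun x => (g t x : ℂ)) A) ∂μ = rtr (K * fc (fun x => (f x : ℂ)) A) := by
  have e : ∀ F : ℝ → ℝ, rtr (K * fc (fun x => (F x : ℂ)) A) =
      ∑ i, F (a i) * ((V.conjTranspose * K * V) i i).re := by
    intro F
    rw [hd.fc_eq, rtr_mul_diag_conj]
  simp only [e]
  have hI : ∀ i, Integrable (fun t => g t (a i) * ((V.conjTranspose * K * V) i i).re) μ := by
    intro i
    rcases h i with h | h
    · simp [h]
    · exact h.1.mul_const _
  refine ⟨integrable_finsetSum _ fun i _ => hI i, ?_⟩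
  rw [integral_finsetSum _ fun i _ => hI i]
  refine Finset.sum_congr rfl fun i _ => ?_
  rcases h i with h | h
  · simp [h]
  · rw [integral_mul_const, h.2]

/-- The resolvent `(l + A)⁻¹`. -/
def resl (l : ℝ) (A : Matrix κ κ ℂ) : Matrix κ κ ℂ := fc (fun x => (((l + x)⁻¹ : ℝ) : ℂ)) A

theorem resl_posSemidef {l : ℝ} (hl : 0 < l) {A : Matrix κ κ ℂ} (hA : A.PosSemidef) :
    (resl l A).PosSemidef :=
  fc_posSemidef hA fun x hx => by positivity

theorem fc_add {A : Matrix κ κ ℂ} (hA : A.IsHermitian) (f g : ℝ → ℂ) :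
    fc f A + fc g A = fc (fun x => f x + g x) A := by
  have hd := exists_diag hA
  rw [hd.fc_eq, hd.fc_eq, hd.fc_eq, ← Matrix.add_mul, ← Matrix.mul_add, Matrix.diagonal_add]

theorem fc_smul {A : Matrix κ κ ℂ} (hA : A.IsHermitian) (c : ℂ) (f : ℝ → ℂ) :
    c • fc f A = fc (fun x => c * f x) A := by
  have hd := exists_diag hA
  rw [hd.fc_eq, hd.fc_eq, ← Matrix.smul_mul, ← Matrix.mul_smul, ← Matrix.diagonal_smul]
  rfl

theorem fc_add_id {A : Matrix κ κ ℂ} (hA : A.IsHermitian) (l : ℝ) :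
    fc (fun x => ((l + x : ℝ) : ℂ)) A = (l : ℂ) • 1 + A := by
  have h := fc_add hA (fun _ => (l : ℂ) * 1) (fun x => (x : ℂ))
  rw [← fc_smul hA, fc_one hA, fc_id hA] at h
  rw [h]
  simp

theorem resl_mul {l : ℝ} (hl : 0 < l) {A : Matrix κ κ ℂ} (hA : A.PosSemidef) :
    resl l A * ((l : ℂ) • 1 + A) = 1 := by
  obtain ⟨V, a, hd, ha⟩ := exists_diag_psd hA
  rw [← fc_add_id hA.1, resl, hd.fc_mul, ← fc_one hA.1]
  refine hd.fc_congr fun i => ?_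
  have : l + a i ≠ 0 := by have := ha i; positivity
  rw [← Complex.ofReal_mul, inv_mul_cancel₀ this, Complex.ofReal_one]

theorem mul_resl {l : ℝ} (hl : 0 < l) {A : Matrix κ κ ℂ} (hA : A.PosSemidef) :
    ((l : ℂ) • 1 + A) * resl l A = 1 := by
  rw [mul_eq_one_comm]; exact resl_mul hl hA

/-- Operator convexity of the inverse in tangent form. -/
theorem resl_tangent {l : ℝ} (hl : 0 < l) {A Y : Matrix κ κ ℂ} (hA : A.PosSemidef)
    (hY : Y.IsHermitian) :
    (resl l A - (Y + Y - Y * ((l : ℂ) • 1 + A) * Y)).PosSemidef := by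
  set Z := (l : ℂ) • 1 + A with hZ
  have hZh : Z.IsHermitian := by
    rw [hZ, ← fc_add_id hA.1]; exact fc_isHermitian _ hA.1
  have := (resl_posSemidef hl hA).conjTranspose_mul_mul_same (1 - Z * Y)
  rw [Matrix.conjTranspose_sub, Matrix.conjTranspose_mul, hZh.eq, hY.eq,
    Matrix.conjTranspose_one] at this
  convert this using 1
  have h1 : resl l A * Z = 1 := resl_mul hl hA
  have h2 : Z * resl l A = 1 := mul_resl hl hA
  have h3 : (1 - Y * Z) * resl l A = resl l A - Y := by
    rw [Matrix.sub_mul, Matrix.mul_assoc, h2]; simp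
  rw [h3, Matrix.mul_sub, Matrix.mul_one, Matrix.sub_mul, ← Matrix.mul_assoc, h1,
    ← Matrix.mul_assoc, Matrix.one_mul]
  abel

theorem pinch_mul_left {L : κ → ℝ} {Y : Matrix κ κ ℂ} (hY : pinch L Y = Y) (M : Matrix κ κ ℂ) :
    pinch L (Y * M) = Y * pinch L M := by
  have hY' : ∀ x y, L x ≠ L y → Y x y = 0 := by
    intro x y h
    rw [← hY]; simp [pinch, h]
  ext x y
  simp only [pinch, Matrix.of_apply, Matrix.mul_apply, ← Finset.sum_ite_irrel, Finset.sum_const_zero]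
  split_ifs with h
  · refine Finset.sum_congr rfl fun z _ => ?_
    split_ifs with h2
    · rfl
    · rw [hY' x z (by rw [h]; exact fun e => h2 e.symm)]; simp
  · refine (Finset.sum_eq_zero fun z _ => ?_).symm
    split_ifs with h2
    · rw [hY' x z (by rw [h2]; exact h)]; simp
    · simp

theorem pinch_conjTranspose (L : κ → ℝ) (M : Matrix κ κ ℂ) :
    (pinch L M).conjTranspose = pinch L M.conjTranspose := by
  ext x y
  simp only [pinch, Matrix.of_apply, Matrix.conjTranspose_apply, eq_comm (a := L y)]
  split_ifs <;> simp

theorem pinch_mul_right {L : κ → ℝ} {Y : Matrix κ κ ℂ} (hY : pinch L Y = Y) (M : Matrix κ κ ℂ) :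
    pinch L (M * Y) = pinch L M * Y := by
  have h := pinch_mul_left (L := L) (Y := Y.conjTranspose) (by rw [← pinch_conjTranspose, hY])
    M.conjTranspose
  rw [← Matrix.conjTranspose_mul, ← pinch_conjTranspose, ← pinch_conjTranspose,
    ← Matrix.conjTranspose_mul] at h
  exact Matrix.conjTranspose_injective h

theorem pinch_pinch (L : κ → ℝ) (M : Matrix κ κ ℂ) : pinch L (pinch L M) = pinch L M := by
  ext x y; simp only [pinch, Matrix.of_apply]; split_ifs <;> rfl

theorem pinch_trace (L : κ → ℝ) (M : Matrix κ κ ℂ) : rtr (pinch L M) = rtr M := by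
  simp [rtr, Matrix.trace, pinch]

theorem rtr_mul_pinch (L : κ → ℝ) (C M : Matrix κ κ ℂ) :
    rtr (C * pinch L M) = rtr (pinch L C * M) := by
  rw [← pinch_trace L (C * pinch L M), pinch_mul_right (pinch_pinch L M),
    ← pinch_mul_left (pinch_pinch L C), pinch_trace]

theorem pinch_fc (L : κ → ℝ) {B : Matrix κ κ ℂ} (hB : B.IsHermitian) (f : ℝ → ℂ) :
    pinch L (fc f (pinch L B)) = fc f (pinch L B) := by
  have hc : pinch L B * Matrix.diagonal (fun x => (L x : ℂ)) =
      Matrix.diagonal (fun x => (L x : ℂ)) * pinch L B := by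
    ext x y
    rw [Matrix.mul_diagonal, Matrix.diagonal_mul]
    simp only [pinch, Matrix.of_apply]
    split_ifs with h
    · rw [h, mul_comm]
    · simp
  have := fc_intertwine (pinch_isHermitian hB L) (pinch_isHermitian hB L) hc f
  ext x y
  simp only [pinch, Matrix.of_apply]
  split_ifs with h
  · rfl
  · have h2 := congrFun (congrFun this x) y
    rw [Matrix.mul_diagonal, Matrix.diagonal_mul, mul_comm] at h2
    by_contra h3
    exact h (Complex.ofReal_injective (mul_right_cancel₀ (Ne.symm h3) h2)).symm

theorem pinch_add (L : κ → ℝ) (A B : Matrix κ κ ℂ) : pinch L (A + B) = pinch L A + pinch L B := by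
  ext x y; simp only [pinch, Matrix.of_apply, Matrix.add_apply]; split_ifs <;> simp

theorem pinch_smul_one (L : κ → ℝ) (c : ℂ) : pinch L (c • (1 : Matrix κ κ ℂ)) = c • 1 := by
  ext x y
  simp only [pinch, Matrix.of_apply, Matrix.smul_apply, Matrix.one_apply]
  split_ifs with h h2 <;> first | rfl | simp_all

theorem rtr_mul_resl_pinch_le (L : κ → ℝ) {l : ℝ} (hl : 0 < l) {B C : Matrix κ κ ℂ}
    (hB : B.PosSemidef) (hC : C.PosSemidef) :
    rtr (C * resl l (pinch L B)) ≤ rtr (pinch L C * resl l B) := by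
  have hPB := pinch_posSemidef hB L
  set Y := resl l (pinch L B) with hYd
  have hY : pinch L Y = Y := pinch_fc L hB.1 _
  have h := rtr_mul_mono (resl_tangent hl hB (resl_posSemidef hl hPB).1) (pinch_posSemidef hC L)
  refine le_trans (le_of_eq ?_) h
  rw [← rtr_mul_pinch]
  have e : pinch L (Y + Y - Y * ((l : ℂ) • 1 + B) * Y) = Y := by
    have e0 : pinch L (Y * ((l : ℂ) • 1 + B) * Y) = Y := by
      rw [pinch_mul_right hY, pinch_mul_left hY, pinch_add, pinch_smul_one, hYd, resl_mul hl hPB,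
        Matrix.one_mul]
    have e1 : pinch L (Y + Y - Y * ((l : ℂ) • 1 + B) * Y) +
        pinch L (Y * ((l : ℂ) • 1 + B) * Y) = Y + Y := by
      rw [← pinch_add, sub_add_cancel, pinch_add, hY]
    rw [e0] at e1
    exact add_right_cancel e1
  rw [e]

theorem rtr_mul_rp_pinch_le (L : κ → ℝ) {p : ℝ} (h1 : 1 < p) (h2 : p ≤ 2) {B C : Matrix κ κ ℂ}
    (hB : B.PosSemidef) (hC : C.PosSemidef) :
    rtr (C * rp p (pinch L B)) ≤ rtr (C * pinch L (rp p B)) := by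
  have hPB := pinch_posSemidef hB L
  rw [rtr_mul_pinch]
  rcases h2.eq_or_lt with rfl | h2
  · have sq : ∀ {A : Matrix κ κ ℂ}, A.PosSemidef → rp 2 A = A * A := by
      intro A hA
      have := rp_mul hA (s := 1) (t := 1) (by norm_num)
      rw [rp_one hA.1] at this
      rw [this]; norm_num
    rw [sq hB, sq hPB]
    have h := rtr_mul_nonneg (pinch_posSemidef hC L)
      (Matrix.posSemidef_self_mul_conjTranspose (B - pinch L B))
    rw [Matrix.conjTranspose_sub, hB.1.eq, hPB.1.eq] at h
    have hpp := pinch_pinch L B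
    have e1 : rtr (pinch L C * (B * pinch L B)) = rtr (C * (pinch L B * pinch L B)) := by
      rw [← rtr_mul_pinch, pinch_mul_right hpp]
    have e2 : rtr (pinch L C * (pinch L B * B)) = rtr (C * (pinch L B * pinch L B)) := by
      rw [← rtr_mul_pinch, pinch_mul_left hpp]
    have e3 : rtr (pinch L C * (pinch L B * pinch L B)) = rtr (C * (pinch L B * pinch L B)) := by
      rw [← rtr_mul_pinch, pinch_mul_left hpp, hpp]
    have e4 : (B - pinch L B) * (B - pinch L B) =
        B * B - B * pinch L B - (pinch L B * B - pinch L B * pinch L B) := by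
      noncomm_ring
    rw [e4] at h
    simp only [Matrix.mul_sub, rtr_sub, e1, e2, e3] at h
    linarith
  obtain ⟨J, hJ, hInt⟩ := exists_integral_rpow_inv (q := p - 1) (by linarith) (by linarith)
  set g : ℝ → ℝ → ℝ := fun t x => t ^ (p - 1 - 1) * (x - t + t ^ 2 * (t + x)⁻¹) with hg
  have main : ∀ {A : Matrix κ κ ℂ} (K : Matrix κ κ ℂ), A.PosSemidef →
      IntegrableOn (fun t => rtr (K * fc (fun x => (g t x : ℂ)) A)) (Set.Ioi 0) ∧
      ∫ t in Set.Ioi (0 : ℝ), rtr (K * fc (fun x => (g t x : ℂ)) A) = J * rtr (K * rp p A) := by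
    intro A K hA
    obtain ⟨V, a, hd, ha⟩ := exists_diag_psd hA
    have := integral_rtr_fc (μ := volume.restrict (Set.Ioi 0)) hd K g (fun x => J * x ^ p) ?_
    · refine ⟨this.1, this.2.trans ?_⟩
      rw [rp, hd.fc_eq, rtr_mul_diag_conj, hd.fc_eq, rtr_mul_diag_conj, Finset.mul_sum]
      simp only [mul_assoc]
    · intro i
      right
      rcases (ha i).eq_or_lt with h0 | h0
      · have e0 : ∀ t ∈ Set.Ioi (0 : ℝ), g t (a i) = 0 := by
          intro t ht
          have ht' : t ≠ 0 := ne_of_gt ht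
          simp only [hg, ← h0]
          rw [add_zero, zero_sub, sq, mul_assoc, mul_inv_cancel₀ ht', mul_one, neg_add_cancel,
            mul_zero]
        refine ⟨?_, ?_⟩
        · exact (integrableOn_zero : IntegrableOn (fun _ => (0 : ℝ)) (Set.Ioi (0:ℝ)) volume).congr_fun
            (fun t ht => (e0 t ht).symm) measurableSet_Ioi
        · rw [setIntegral_congr_fun measurableSet_Ioi e0, ← h0,
            Real.zero_rpow (by linarith : p ≠ 0)]; simp
      · have e0 : ∀ t ∈ Set.Ioi (0 : ℝ), (a i) ^ 2 * (t ^ (p - 1 - 1) * (t + a i)⁻¹) = g t (a i) := by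
          intro t ht
          have ht' : (0:ℝ) < t := ht
          have : t + a i ≠ 0 := by positivity
          simp only [hg]
          field_simp
          ring
        obtain ⟨i1, i2⟩ := hInt (a i) h0
        refine ⟨?_, ?_⟩
        · exact IntegrableOn.congr_fun (i1.const_mul ((a i) ^ 2)) e0 measurableSet_Ioi
        · rw [← setIntegral_congr_fun measurableSet_Ioi e0, integral_const_mul, i2]
          rw [show (a i) ^ 2 = (a i) ^ (2 : ℝ) by norm_cast, ← mul_assoc, ← Real.rpow_add h0]
          rw [show 2 + (p - 1 - 1) = p by ring, mul_comm]
  obtain ⟨a1, a2⟩ := main C hPB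
  obtain ⟨b1, b2⟩ := main (pinch L C) hB
  have hle := setIntegral_mono_on a1 b1 measurableSet_Ioi (fun t ht => ?_)
  · rw [a2, b2] at hle
    exact le_of_mul_le_mul_left hle hJ
  · have ht' : (0 : ℝ) < t := ht
    have e : ∀ {A : Matrix κ κ ℂ} (K : Matrix κ κ ℂ), A.PosSemidef →
        rtr (K * fc (fun x => (g t x : ℂ)) A) =
        t ^ (p - 1 - 1) * (rtr (K * A) - t * rtr K + t ^ 2 * rtr (K * resl t A)) := by
      intro A K hA
      have e1 : fc (fun x => (g t x : ℂ)) A =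
          ((t ^ (p - 1 - 1) : ℝ) : ℂ) • (A - (t : ℂ) • 1 + ((t ^ 2 : ℝ) : ℂ) • resl t A) := by
        have h3 : (A - (t : ℂ) • 1 + ((t ^ 2 : ℝ) : ℂ) • resl t A) = fc (fun x =>
            (x : ℂ) + (-t : ℂ) * 1 + ((t ^ 2 : ℝ) : ℂ) * (((t + x)⁻¹ : ℝ) : ℂ)) A := by
          rw [← fc_add hA.1, ← fc_add hA.1, ← fc_smul hA.1, ← fc_smul hA.1, fc_id hA.1,
            fc_one hA.1, neg_smul, ← sub_eq_add_neg]
          rfl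
        rw [h3, fc_smul hA.1]
        congr 1
        funext x
        simp only [hg]
        push_cast
        ring
      rw [e1, Matrix.mul_smul, rtr_smul, Matrix.mul_add, Matrix.mul_sub, rtr_add, rtr_sub,
        Matrix.mul_smul, Matrix.mul_smul, rtr_smul, rtr_smul, Matrix.mul_one]
    rw [e C hPB, e (pinch L C) hB, rtr_mul_pinch, pinch_trace]
    gcongr
    exact rtr_mul_resl_pinch_le L ht' hB hC

end Resolvent

section Rotated

variable {κ : Type*} [Fintype κ] [DecidableEq κ]

theorem pw_mul (w : ℂ) {x y : ℝ} (hx : 0 ≤ x) (hy : 0 ≤ y) : pw w (x * y) = pw w x * pw w y := by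
  unfold pw
  by_cases h1 : x = 0
  · simp [h1]
  by_cases h2 : y = 0
  · simp [h2]
  rw [if_neg h1, if_neg h2, if_neg (mul_ne_zero h1 h2), Complex.ofReal_mul,
    Complex.mul_cpow_ofReal_nonneg hx hy]

theorem pw_prod {τ : Type*} (s : Finset τ) (w : ℂ) (f : τ → ℝ) (hf : ∀ i, 0 ≤ f i) :
    pw w (∏ i ∈ s, f i) = ∏ i ∈ s, pw w (f i) := by
  induction s using Finset.induction_on with
  | empty => simp [pw]
  | insert a s ha ih =>
    rw [Finset.prod_insert ha, Finset.prod_insert ha, pw_mul _ (hf a)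
      (Finset.prod_nonneg fun i _ => hf i), ih]

theorem star_pw (w : ℂ) {x : ℝ} (hx : 0 ≤ x) : star (pw w x) = pw (star w) x := by
  unfold pw
  split_ifs with h
  · simp
  · have h1 := Complex.cpow_conj (x : ℂ) w
      (by rw [Complex.arg_ofReal_of_nonneg hx]; exact Real.pi_ne_zero.symm)
    rw [Complex.conj_ofReal] at h1
    exact h1.symm

theorem pw_neg_half {x : ℝ} (hx : 0 ≤ x) (t : ℝ) :
    pw (-((1 : ℂ) + Complex.I * (t : ℂ)) / 2) x =
      ((x ^ (-(1 / 2) : ℝ) : ℝ) : ℂ) * Complex.exp (-(Complex.I * (Real.log x / 2 : ℝ) * t)) := by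
  rcases hx.eq_or_lt with h | h
  · subst h; simp [pw, Real.zero_rpow]
  · have h0 : (x : ℂ) ≠ 0 := by exact_mod_cast h.ne'
    rw [pw, if_neg h.ne', Complex.ofReal_cpow hx, Complex.cpow_def_of_ne_zero h0,
      Complex.cpow_def_of_ne_zero h0, ← Complex.exp_add, ← Complex.ofReal_log hx]
    congr 1
    push_cast
    ring

/-- The rotated operator `σ^{-(1+it)/2} X^p σ^{-(1-it)/2}`. -/
def rotated (p : ℝ) (ρ σ : Matrix κ κ ℂ) (t : ℝ) : Matrix κ κ ℂ :=
  mpow σ (-((1 : ℂ) + Complex.I * (t : ℂ)) / 2) * rp p (Xs p ρ σ) *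
    mpow σ (-((1 : ℂ) - Complex.I * (t : ℂ)) / 2)

theorem mpow_conj_half {σ : Matrix κ κ ℂ} (hσ : σ.PosSemidef) (t : ℝ) :
    mpow σ (-((1 : ℂ) - Complex.I * (t : ℂ)) / 2) =
      (mpow σ (-((1 : ℂ) + Complex.I * (t : ℂ)) / 2)).conjTranspose := by
  obtain ⟨V, a, h, ha⟩ := exists_diag_psd hσ
  rw [mpow_eq_fc, mpow_eq_fc, fc_conjTranspose _ hσ.1]
  refine h.fc_congr fun i => ?_
  rw [star_pw _ (ha i)]
  congr 1
  simp
  ring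

theorem rotated_posSemidef (p : ℝ) {ρ σ : Matrix κ κ ℂ} (hρ : ρ.PosSemidef) (hσ : σ.PosSemidef)
    (t : ℝ) : (rotated p ρ σ t).PosSemidef := by
  rw [rotated, mpow_conj_half hσ]
  exact (rp_posSemidef (Xs_posSemidef p hρ hσ) p).mul_mul_conjTranspose_same _

theorem tpowG_rotated (p : ℝ) {ρ σ V : Matrix κ κ ℂ} {lam : κ → ℝ} (hσ : σ.PosSemidef)
    (hd : Diag σ V lam) (hlam : ∀ i, 0 ≤ lam i) (t : ℝ) (n : ℕ) :
    tpowG (rotated p ρ σ t) n = tpowG V n *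
      (Matrix.diagonal (fun x => pw (-((1 : ℂ) + Complex.I * (t : ℂ)) / 2) (∏ i, lam (x i))) *
        tpowG (V.conjTranspose * rp p (Xs p ρ σ) * V) n *
        (Matrix.diagonal (fun x => pw (-((1 : ℂ) + Complex.I * (t : ℂ)) / 2)
          (∏ i, lam (x i)))).conjTranspose) * (tpowG V n).conjTranspose := by
  have e : Matrix.diagonal (fun x : Fin n → κ =>
      pw (-((1 : ℂ) + Complex.I * (t : ℂ)) / 2) (∏ i, lam (x i))) =
      tpowG (Matrix.diagonal fun i => pw (-((1 : ℂ) + Complex.I * (t : ℂ)) / 2) (lam i)) n := by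
    rw [tpowG_diagonal]
    congr 1
    funext x
    exact pw_prod _ _ _ fun i => hlam _
  rw [e, tpowG_conjTranspose, tpowG_conjTranspose]
  simp only [tpowG_mul]
  rw [rotated, mpow_conj_half hσ, mpow_eq_fc, hd.fc_eq]
  congr 1
  simp only [Matrix.mul_assoc, Matrix.conjTranspose_mul, Matrix.conjTranspose_conjTranspose]

theorem tpowG_smul (c : ℂ) (A : Matrix κ κ ℂ) (n : ℕ) : tpowG (c • A) n = c ^ n • tpowG A n := by
  ext x y
  simp [tpowG_apply, Finset.prod_mul_distrib]

/-- Averaging the rotated bounds over time leaves the pinched operator. -/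
theorem rtr_pinch_le_of_rotated {Λ : κ → ℝ} (hΛ : ∀ x, 0 ≤ Λ x) (τ C : Matrix κ κ ℂ) (M : ℝ)
    (h : ∀ t : ℝ, rtr (τ * (Matrix.diagonal
      (fun x => pw (-((1 : ℂ) + Complex.I * (t : ℂ)) / 2) (Λ x)) * C *
      (Matrix.diagonal
        (fun x => pw (-((1 : ℂ) + Complex.I * (t : ℂ)) / 2) (Λ x))).conjTranspose)) ≤ M) :
    rtr (τ * ((Matrix.diagonal (fun x => ((Λ x ^ (-(1 / 2) : ℝ) : ℝ) : ℂ)) * pinch Λ C) *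
      Matrix.diagonal (fun x => ((Λ x ^ (-(1 / 2) : ℝ) : ℝ) : ℂ)))) ≤ M := by
  have key := re_sum_zero_freq_le (κ := κ × κ)
    (fun k => τ k.1 k.2 * (((Λ k.2 ^ (-(1 / 2) : ℝ) : ℝ) : ℂ) * C k.2 k.1 *
      ((Λ k.1 ^ (-(1 / 2) : ℝ) : ℝ) : ℂ)))
    (fun k => Real.log (Λ k.1) / 2 - Real.log (Λ k.2) / 2) M ?_
  · refine le_trans (le_of_eq ?_) key
    rw [rtr, Matrix.trace]
    simp only [Matrix.diag_apply, Matrix.mul_apply (M := τ)]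
    rw [Fintype.sum_prod_type]
    congr 1
    refine Finset.sum_congr rfl fun x _ => Finset.sum_congr rfl fun y _ => ?_
    rw [Matrix.mul_diagonal, Matrix.diagonal_mul]
    simp only [pinch, Matrix.of_apply]
    by_cases hx : Λ x = 0
    · have : (0 : ℝ) ^ (-(1 / 2) : ℝ) = 0 := Real.zero_rpow (by norm_num)
      simp [hx, this]
    by_cases hy : Λ y = 0
    · have : (0 : ℝ) ^ (-(1 / 2) : ℝ) = 0 := Real.zero_rpow (by norm_num)
      simp [hy, this]
    have hx' := lt_of_le_of_ne (hΛ x) (Ne.symm hx)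
    have hy' := lt_of_le_of_ne (hΛ y) (Ne.symm hy)
    by_cases hxy : Λ y = Λ x
    · simp [hxy]
    · rw [if_neg hxy, if_neg]
      · simp
      · intro h0
        apply hxy
        refine (Real.log_injOn_pos hx' hy' ?_).symm
        linarith
  · intro t
    refine le_trans (le_of_eq ?_) (h t)
    rw [rtr, Matrix.trace]
    simp only [Matrix.diag_apply, Matrix.mul_apply (M := τ)]
    rw [Fintype.sum_prod_type]
    congr 1
    refine Finset.sum_congr rfl fun x _ => Finset.sum_congr rfl fun y _ => ?_
    rw [Matrix.diagonal_conjTranspose, Matrix.mul_diagonal, Matrix.diagonal_mul, Pi.star_apply,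
      pw_neg_half (hΛ x), pw_neg_half (hΛ y)]
    rw [star_mul', ← starRingEnd_apply, ← starRingEnd_apply, ← Complex.exp_conj,
      Complex.conj_ofReal]
    have e : (starRingEnd ℂ) (-(Complex.I * (Real.log (Λ x) / 2 : ℝ) * t)) =
        Complex.I * (Real.log (Λ x) / 2 : ℝ) * t := by
      rw [map_neg, map_mul, map_mul, Complex.conj_I, Complex.conj_ofReal, Complex.conj_ofReal]
      ring
    rw [e]
    have e2 : Complex.exp (Complex.I * ((Real.log (Λ x) / 2 - Real.log (Λ y) / 2 : ℝ) : ℂ) * t) =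
        Complex.exp (-(Complex.I * (Real.log (Λ y) / 2 : ℝ) * t)) *
          Complex.exp (Complex.I * (Real.log (Λ x) / 2 : ℝ) * t) := by
      rw [← Complex.exp_add]
      congr 1
      push_cast
      ring
    rw [e2]
    ring

theorem pinch_eq_self {L : κ → ℝ} {M : Matrix κ κ ℂ}
    (h : Matrix.diagonal (fun x => (L x : ℂ)) * M = M * Matrix.diagonal (fun x => (L x : ℂ))) :
    pinch L M = M := by
  ext x y
  simp only [pinch, Matrix.of_apply]
  split_ifs with hxy
  · rfl
  · have h2 := congrFun (congrFun h x) y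
    rw [Matrix.mul_diagonal, Matrix.diagonal_mul, mul_comm] at h2
    by_contra h3
    exact hxy (Complex.ofReal_injective (mul_left_cancel₀ (Ne.symm h3) h2))

/-- The comparison hypothesis of the test construction follows from the bounds on the rotated
operators. -/
theorem rtr_test_operator_le {p : ℝ} {ρ σ V : Matrix κ κ ℂ} {lam : κ → ℝ}
    (hρ : ρ.PosSemidef) (hσ : σ.PosSemidef) (hd : Diag σ V lam) (hlam : ∀ i, 0 ≤ lam i) (n : ℕ)
    (hM : ∀ C : Matrix (Fin n → κ) (Fin n → κ) ℂ, C.PosSemidef →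
      rtr (C * rp p (pinch (fun x : Fin n → κ => ∏ i, lam (x i))
        (tpowG (V.conjTranspose * Xs p ρ σ * V) n))) ≤
      rtr (C * pinch (fun x : Fin n → κ => ∏ i, lam (x i))
        (rp p (tpowG (V.conjTranspose * Xs p ρ σ * V) n))))
    {τ : Matrix (Fin n → κ) (Fin n → κ) ℂ} (hτ : τ.PosSemidef) {Q : ℝ}
    (h : ∀ t, rtr (τ * tpowG (rotated p ρ σ t) n) ≤ Q) :
    rtr ((tpowG V n).conjTranspose * τ * tpowG V n *
          (Matrix.diagonal (fun x => (((∏ i, lam (x i)) ^ (-(1 / 2) : ℝ) : ℝ) : ℂ)) *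
          rp p (pinch (fun x : Fin n → κ => ∏ i, lam (x i))
            (tpowG (V.conjTranspose * Xs p ρ σ * V) n)) *
          Matrix.diagonal (fun x => (((∏ i, lam (x i)) ^ (-(1 / 2) : ℝ) : ℝ) : ℂ)))) ≤ Q := by
  set Λ : (Fin n → κ) → ℝ := fun x => ∏ i, lam (x i) with hΛd
  have hΛ : ∀ x, 0 ≤ Λ x := fun x => Finset.prod_nonneg fun i _ => hlam _
  set E : Matrix (Fin n → κ) (Fin n → κ) ℂ :=
    Matrix.diagonal (fun x => (((∏ i, lam (x i)) ^ (-(1 / 2) : ℝ) : ℝ) : ℂ)) with hE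
  have hEh : E.conjTranspose = E := by
    rw [hE, Matrix.diagonal_conjTranspose]; congr 1; funext x; simp
  have hτ' : ((tpowG V n).conjTranspose * τ * tpowG V n).PosSemidef :=
    hτ.conjTranspose_mul_mul_same _
  set τ' := (tpowG V n).conjTranspose * τ * tpowG V n with hτd
  have hX : (V.conjTranspose * Xs p ρ σ * V).PosSemidef :=
    (Xs_posSemidef p hρ hσ).conjTranspose_mul_mul_same V
  have hEτ : (E * τ' * E).PosSemidef := by
    have := hτ'.conjTranspose_mul_mul_same E
    rwa [hEh] at this
  have hr : ∀ M : Matrix (Fin n → κ) (Fin n → κ) ℂ,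
      rtr (τ' * (E * M * E)) = rtr (E * τ' * E * M) := by
    intro M
    rw [← Matrix.mul_assoc, rtr_mul_comm]
    simp only [Matrix.mul_assoc]
  rw [hr]
  refine (hM _ hEτ).trans ?_
  rw [← hr, rp_tpowG hX]
  have hc : rp p (V.conjTranspose * Xs p ρ σ * V) = V.conjTranspose * rp p (Xs p ρ σ) * V := by
    have := fc_conj (fun x => ((x ^ p : ℝ) : ℂ)) (A := Xs p ρ σ) (U := V.conjTranspose)
      (Xs_posSemidef p hρ hσ).1 (by rw [Matrix.conjTranspose_conjTranspose, hd.r])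
      (by rw [Matrix.conjTranspose_conjTranspose, hd.l])
    rwa [Matrix.conjTranspose_conjTranspose] at this
  rw [hc]
  refine rtr_pinch_le_of_rotated hΛ τ' _ Q fun t => ?_
  refine le_trans (le_of_eq ?_) (h t)
  rw [tpowG_rotated p hσ hd hlam, hτd]
  have hl : (tpowG V n).conjTranspose * tpowG V n = 1 := by
    rw [tpowG_conjTranspose, tpowG_mul, hd.l, tpowG_one]
  rw [← Matrix.mul_assoc τ, rtr_mul_comm _ ((tpowG V n).conjTranspose)]
  simp only [Matrix.mul_assoc, hΛd]

theorem pinched_power_of_le_two {p : ℝ} (h1 : 1 < p) (h2 : p ≤ 2) (L : κ → ℝ) {X : Matrix κ κ ℂ}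
    (hX : X.PosSemidef) (C : Matrix κ κ ℂ) (hC : C.PosSemidef) :
    rtr (C * rp p (pinch L X)) ≤ rtr (C * pinch L (rp p X)) :=
  rtr_mul_rp_pinch_le L h1 h2 hX hC

theorem pinched_power_of_commute {p : ℝ} {lam : κ → ℝ} {X : Matrix κ κ ℂ} (hX : X.PosSemidef)
    (hc : Matrix.diagonal (fun x => (lam x : ℂ)) * X = X * Matrix.diagonal (fun x => (lam x : ℂ)))
    (n : ℕ) (C : Matrix (Fin n → κ) (Fin n → κ) ℂ) :
    rtr (C * rp p (pinch (fun x : Fin n → κ => ∏ i, lam (x i)) (tpowG X n))) ≤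
      rtr (C * pinch (fun x : Fin n → κ => ∏ i, lam (x i)) (rp p (tpowG X n))) := by
  have e : Matrix.diagonal (fun x : Fin n → κ => ((∏ i, lam (x i) : ℝ) : ℂ)) =
      tpowG (Matrix.diagonal (fun x => (lam x : ℂ))) n := by
    rw [tpowG_diagonal]; congr 1; funext x; push_cast; rfl
  have h1 : Matrix.diagonal (fun x : Fin n → κ => ((∏ i, lam (x i) : ℝ) : ℂ)) * tpowG X n =
      tpowG X n * Matrix.diagonal (fun x : Fin n → κ => ((∏ i, lam (x i) : ℝ) : ℂ)) := by
    rw [e, tpowG_mul, tpowG_mul, hc]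
  have h2 := fc_intertwine (tpowG_posSemidef hX n).1 (tpowG_posSemidef hX n).1 h1.symm
    (fun x => ((x ^ p : ℝ) : ℂ))
  have h3 : pinch (fun x : Fin n → κ => ∏ i, lam (x i)) (rp p (tpowG X n)) = rp p (tpowG X n) :=
    pinch_eq_self h2.symm
  rw [pinch_eq_self h1, h3]

end Rotated

section RotatedPolar

/-- Bounds on the rotated operators against `S 1` propagate to tensor powers via polar sets. -/
theorem rtr_tpowG_le_of_polar {d : ℕ}
    {S : (n : ℕ) → Set (Matrix (Fin n → Fin d) (Fin n → Fin d) ℂ)} (hS : Assumption1 S)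
    {M : Matrix (Fin 1 → Fin d) (Fin 1 → Fin d) ℂ} (hM : M.PosSemidef) {Q : ℝ} (hQ : 0 < Q)
    (h : ∀ τ ∈ S 1, rtr (τ * M) ≤ Q) {n : ℕ}
    {e : (Fin n → Fin d) ≃ (Fin n → Fin 1 → Fin d)}
    (he : ∀ F : (n : ℕ) → Set (Matrix (Fin n → Fin d) (Fin n → Fin d) ℂ),
        (∀ m n, 1 ≤ m → 1 ≤ n → ∀ A ∈ F m, ∀ B ∈ F n, tensOp A B ∈ F (m + n)) →
        ∀ ω ∈ F 1, (tpowG ω n).submatrix e e ∈ F n) {τ : Matrix (Fin n → Fin d) (Fin n → Fin d) ℂ}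
    (hτ : τ ∈ S n) : rtr (τ.submatrix e.symm e.symm * tpowG M n) ≤ Q ^ n := by
  have hm : ((Q⁻¹ : ℝ) : ℂ) • M ∈ polar (S 1) := by
    refine ⟨?_, fun Y hY => ?_⟩
    · exact hM.smul (by exact_mod_cast (inv_pos.2 hQ).le)
    · rw [Matrix.smul_mul, rtr_smul, rtr_mul_comm, inv_mul_le_iff₀ hQ, mul_one]
      exact h Y hY
  have h1 := (he (fun n => polar (S n)) hS.polarTens _ hm).2 τ hτ
  have e1 : (tpowG (((Q⁻¹ : ℝ) : ℂ) • M) n).submatrix e e * τ =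
      (tpowG (((Q⁻¹ : ℝ) : ℂ) • M) n * τ.submatrix e.symm e.symm).submatrix e e := by
    rw [Matrix.submatrix_mul _ _ _ e _ e.bijective, Matrix.submatrix_submatrix]
    simp
  rw [e1, rtr_submatrix, tpowG_smul, Matrix.smul_mul, ← Complex.ofReal_pow, rtr_smul,
    rtr_mul_comm, inv_pow, inv_mul_le_iff₀ (by positivity), mul_one] at h1
  exact h1

end RotatedPolar

section Support

variable {κ : Type*} [Fintype κ] [DecidableEq κ]

theorem ker_of_msupp_le {ρ σ : Matrix κ κ ℂ} (hρ : ρ.IsHermitian) (hσ : σ.IsHermitian)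
    (h : msupp ρ ≤ msupp σ) (v : κ → ℂ) (hv : σ.mulVec v = 0) : ρ.mulVec v = 0 := by
  obtain ⟨w, hw⟩ : ρ.mulVec (ρ.mulVec v) ∈ msupp σ := h ⟨_, rfl⟩
  have hw' : σ.mulVec w = ρ.mulVec (ρ.mulVec v) := hw
  rw [← dotProduct_star_self_eq_zero]
  have h1 : star (ρ.mulVec v) ⬝ᵥ ρ.mulVec v = star v ⬝ᵥ ρ.mulVec (ρ.mulVec v) := by
    rw [Matrix.star_mulVec, hρ.eq, ← Matrix.dotProduct_mulVec]
  rw [h1, ← hw', Matrix.dotProduct_mulVec]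
  have h2 : Matrix.vecMul (star v) σ = star (σ.mulVec v) := by
    rw [Matrix.star_mulVec, hσ.eq]
  rw [h2, hv]
  simp

theorem supp_mul {σ V K : Matrix κ κ ℂ} {a : κ → ℝ} (hd : Diag σ V a) (hK : K.IsHermitian)
    (hk : ∀ v, σ.mulVec v = 0 → K.mulVec v = 0) {f : ℝ → ℂ} (hf : ∀ x, x ≠ 0 → f x = 1) :
    fc f σ * K = K := by
  have h1 : Matrix.diagonal (fun i => f (a i)) * (V.conjTranspose * K * V) =
      V.conjTranspose * K * V := by
    ext x y
    rw [Matrix.diagonal_mul]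
    by_cases h : a x = 0
    · rw [kernel_diag hd hK hk x y h, mul_zero]
    · rw [hf _ h, one_mul]
  have h2 : K = V * (V.conjTranspose * K * V) * V.conjTranspose := by
    rw [← Matrix.mul_assoc, ← Matrix.mul_assoc, hd.r, Matrix.one_mul, Matrix.mul_assoc, hd.r,
      Matrix.mul_one]
  calc fc f σ * K = V * Matrix.diagonal (fun i => f (a i)) * (V.conjTranspose * K * V) *
        V.conjTranspose := by
        rw [hd.fc_eq]
        simp only [Matrix.mul_assoc]
        rw [hd.r, Matrix.mul_one]
    _ = V * (Matrix.diagonal (fun i => f (a i)) * (V.conjTranspose * K * V)) *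
        V.conjTranspose := by simp only [Matrix.mul_assoc]
    _ = K := by rw [h1, ← h2]

theorem msupp_le_of_ker {ρ σ : Matrix κ κ ℂ} (hρ : ρ.IsHermitian) (hσ : σ.IsHermitian)
    (h : ∀ v, σ.mulVec v = 0 → ρ.mulVec v = 0) : msupp ρ ≤ msupp σ := by
  rintro _ ⟨v, rfl⟩
  have hd := exists_diag hσ
  have h1 : σ * fc (fun x => ((x⁻¹ : ℝ) : ℂ)) σ * ρ = ρ := by
    nth_rw 1 [← fc_id hσ]
    rw [fc_mul hσ]
    refine supp_mul hd hρ h fun x hx => ?_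
    rw [← Complex.ofReal_mul, mul_inv_cancel₀ hx, Complex.ofReal_one]
  refine ⟨(fc (fun x => ((x⁻¹ : ℝ) : ℂ)) σ * ρ).mulVec v, ?_⟩
  change σ.mulVec _ = ρ.mulVec v
  rw [Matrix.mulVec_mulVec, ← Matrix.mul_assoc, h1]

theorem ker_of_sub_posSemidef {σ ω : Matrix κ κ ℂ} (hσ : σ.PosSemidef) {c : ℝ} (hc : 0 < c)
    (h : (ω - (c : ℂ) • σ).PosSemidef) (v : κ → ℂ) (hv : ω.mulVec v = 0) : σ.mulVec v = 0 := by
  rw [← hσ.dotProduct_mulVec_zero_iff]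
  have h1 := h.dotProduct_mulVec_nonneg v
  have h2 := hσ.dotProduct_mulVec_nonneg v
  rw [Matrix.sub_mulVec, hv, zero_sub, dotProduct_neg, Matrix.smul_mulVec, dotProduct_smul,
    smul_eq_mul, Left.nonneg_neg_iff] at h1
  refine le_antisymm ?_ h2
  have h3 := mul_le_mul_of_nonneg_left h1 (Complex.zero_le_real.2 (inv_pos.2 hc).le)
  rwa [← mul_assoc, ← Complex.ofReal_mul, inv_mul_cancel₀ hc.ne', Complex.ofReal_one, one_mul,
    mul_zero] at h3

theorem ker_mul_right {σ ρ : Matrix κ κ ℂ} (hk : ∀ v, σ.mulVec v = 0 → ρ.mulVec v = 0)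
    (B : Matrix κ κ ℂ) (v : κ → ℂ) (hv : σ.mulVec v = 0) : (B * ρ).mulVec v = 0 := by
  rw [← Matrix.mulVec_mulVec, hk v hv, Matrix.mulVec_zero]

theorem ker_rp_half {σ ρ : Matrix κ κ ℂ} (hρ : ρ.PosSemidef)
    (hk : ∀ v, σ.mulVec v = 0 → ρ.mulVec v = 0) (v : κ → ℂ) (hv : σ.mulVec v = 0) :
    (rp (1 / 2) ρ).mulVec v = 0 := by
  have h := rp_mul hρ (s := -(1 / 2)) (t := 1) (by norm_num)
  rw [rp_one hρ.1] at h
  have h2 := ker_mul_right hk (rp (-(1 / 2)) ρ) v hv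
  rw [h] at h2
  convert h2 using 3
  norm_num

end Support

section NegativePower

variable {κ : Type*} [Fintype κ] [DecidableEq κ]

/-- The constant of the integral representation of `x ↦ x ^ (-u)`. -/
def IsInvConst (u J : ℝ) : Prop := 0 < J ∧ ∀ x : ℝ, 0 < x →
  IntegrableOn (fun t : ℝ => t ^ (-u) * (t + x)⁻¹) (Set.Ioi 0) ∧
    ∫ t in Set.Ioi (0 : ℝ), t ^ (-u) * (t + x)⁻¹ = x ^ (-u) * J

theorem exists_isInvConst {u : ℝ} (h0 : 0 < u) (h1 : u < 1) : ∃ J, IsInvConst u J := by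
  obtain ⟨J, hJ, h⟩ := exists_integral_rpow_inv (q := 1 - u) (by linarith) (by linarith)
  refine ⟨J, hJ, ?_⟩
  simpa only [sub_sub_cancel_left] using h

theorem integral_rtr_resl {u J : ℝ} (hJ : IsInvConst u J) {ω K : Matrix κ κ ℂ} (hω : ω.PosSemidef)
    (hK : K.IsHermitian) (hk : ∀ v, ω.mulVec v = 0 → K.mulVec v = 0) :
    IntegrableOn (fun t : ℝ => t ^ (-u) * rtr (K * resl t ω)) (Set.Ioi 0) ∧
      ∫ t in Set.Ioi (0 : ℝ), t ^ (-u) * rtr (K * resl t ω) = J * rtr (K * rp (-u) ω) := by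
  obtain ⟨V, a, hd, ha⟩ := exists_diag_psd hω
  have h := integral_rtr_fc (μ := volume.restrict (Set.Ioi 0)) hd K
    (fun t x => t ^ (-u) * (t + x)⁻¹) (fun x => J * x ^ (-u)) (fun i => by
      rcases (ha i).eq_or_lt with h | h
      · left; rw [kernel_diag hd hK hk i i h.symm]; simp
      · right; rw [mul_comm J]; exact hJ.2 _ h)
  have e1 : ∀ t : ℝ, t ^ (-u) * rtr (K * resl t ω) =
      rtr (K * fc (fun x => ((t ^ (-u) * (t + x)⁻¹ : ℝ) : ℂ)) ω) := by
    intro t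
    rw [← rtr_smul, resl, ← Matrix.mul_smul, fc_smul hω.1]
    simp only [Complex.ofReal_mul]
  have e2 : J * rtr (K * rp (-u) ω) = rtr (K * fc (fun x => ((J * x ^ (-u) : ℝ) : ℂ)) ω) := by
    rw [← rtr_smul, rp, ← Matrix.mul_smul, fc_smul hω.1]
    simp only [Complex.ofReal_mul]
  simp only [e1, e2]
  exact h

theorem resl_sub {l : ℝ} (hl : 0 < l) {A B : Matrix κ κ ℂ} (hA : A.PosSemidef)
    (hB : B.PosSemidef) : resl l A - resl l B = resl l A * (B - A) * resl l B := by
  have h1 := resl_mul hl hA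
  have h2 := mul_resl hl hB
  have : B - A = ((l : ℂ) • 1 + B) - ((l : ℂ) • 1 + A) := by abel
  rw [this, Matrix.mul_sub, Matrix.sub_mul, h1, Matrix.mul_assoc, h2]
  simp

theorem resl_antitone {l : ℝ} (hl : 0 < l) {A B : Matrix κ κ ℂ} (hA : A.PosSemidef)
    (hB : B.PosSemidef) (h : (B - A).PosSemidef) : (resl l A - resl l B).PosSemidef := by
  have hY := resl_posSemidef hl hB
  have h1 := resl_tangent hl hA hY.1
  have h2 := h.mul_mul_conjTranspose_same (resl l B)
  rw [hY.1.eq] at h2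
  convert h1.add h2 using 1
  have h3 : resl l B * ((l : ℂ) • 1 + B) * resl l B = resl l B := by
    rw [resl_mul hl hB, Matrix.one_mul]
  have : B - A = ((l : ℂ) • 1 + B) - ((l : ℂ) • 1 + A) := by abel
  rw [this, Matrix.mul_sub, Matrix.sub_mul, h3]
  abel

theorem tendsto_resl {l : ℝ} (hl : 0 < l) {A : ℕ → Matrix κ κ ℂ} {A₀ : Matrix κ κ ℂ}
    (hA : ∀ k, (A k).PosSemidef) (hlim : Tendsto A atTop (nhds A₀)) :
    Tendsto (fun k => resl l (A k)) atTop (nhds (resl l A₀)) := by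
  refine tendsto_fc (F := fun (_ : Unit) x => (((l + x)⁻¹ : ℝ) : ℂ)) (p := fun _ => ())
    (p₀ := ()) tendsto_const_nhds (fun x hx => ?_) hA hlim
  apply ContinuousAt.continuousWithinAt
  have : ((), x).2 + l ≠ 0 := by simp; positivity
  unfold Function.uncurry
  refine Complex.continuous_ofReal.continuousAt.comp ?_
  refine ContinuousAt.inv₀ (by fun_prop) ?_
  simp; positivity

theorem tendsto_rtr_rp_neg {u J : ℝ} (hJ : IsInvConst u J) {K : Matrix κ κ ℂ} (hK : K.PosSemidef)
    {σ : Matrix κ κ ℂ} (hσ : σ.PosSemidef) (hk : ∀ v, σ.mulVec v = 0 → K.mulVec v = 0)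
    {ω : ℕ → Matrix κ κ ℂ} {ω₀ : Matrix κ κ ℂ} (hω : ∀ k, (ω k).PosSemidef)
    (hω₀ : ω₀.PosSemidef) (hlim : Tendsto ω atTop (nhds ω₀)) {c : ℝ} (hc : 0 < c)
    (hle : ∀ k, (ω k - (c : ℂ) • σ).PosSemidef) (hle₀ : (ω₀ - (c : ℂ) • σ).PosSemidef) :
    Tendsto (fun k => rtr (K * rp (-u) (ω k))) atTop (nhds (rtr (K * rp (-u) ω₀))) := by
  have hcσ : ((c : ℂ) • σ).PosSemidef := hσ.smul (by exact_mod_cast hc.le)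
  have hkc : ∀ v, ((c : ℂ) • σ).mulVec v = 0 → K.mulVec v = 0 := by
    intro v hv
    apply hk
    rw [Matrix.smul_mulVec, smul_eq_zero] at hv
    exact hv.resolve_left (by exact_mod_cast hc.ne')
  have hkω : ∀ k v, (ω k).mulVec v = 0 → K.mulVec v = 0 := fun k v hv =>
    hk v (ker_of_sub_posSemidef hσ hc (hle k) v hv)
  have hkω₀ : ∀ v, ω₀.mulVec v = 0 → K.mulVec v = 0 := fun v hv =>
    hk v (ker_of_sub_posSemidef hσ hc hle₀ v hv)
  have hI := fun k => integral_rtr_resl hJ (hω k) hK.1 (hkω k)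
  have hI₀ := integral_rtr_resl hJ hω₀ hK.1 hkω₀
  have hB := integral_rtr_resl hJ hcσ hK.1 hkc
  have hpt : ∀ t : ℝ, t ∈ Set.Ioi (0 : ℝ) → Tendsto (fun k => t ^ (-u) * rtr (K * resl t (ω k)))
      atTop (nhds (t ^ (-u) * rtr (K * resl t ω₀))) := by
    intro t ht
    have h := ((continuous_rtr_mul K).tendsto _).comp (tendsto_resl ht hω hlim)
    simp only [rtr_mul_comm K]
    exact h.const_mul _
  have hdom : ∀ k (t : ℝ), t ∈ Set.Ioi (0 : ℝ) → ‖t ^ (-u) * rtr (K * resl t (ω k))‖ ≤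
      t ^ (-u) * rtr (K * resl t ((c : ℂ) • σ)) := by
    intro k t ht
    have ht : 0 < t := ht
    have h0 := rtr_mul_nonneg hK (resl_posSemidef ht (hω k))
    have h1 := rtr_mul_mono (resl_antitone ht hcσ (hω k) (hle k)) hK
    rw [Real.norm_of_nonneg (by positivity)]
    gcongr
  have key := tendsto_integral_of_dominated_convergence
    (μ := volume.restrict (Set.Ioi (0 : ℝ)))
    (F := fun k (t : ℝ) => t ^ (-u) * rtr (K * resl t (ω k)))
    (f := fun t : ℝ => t ^ (-u) * rtr (K * resl t ω₀))
    (fun t : ℝ => t ^ (-u) * rtr (K * resl t ((c : ℂ) • σ)))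
    (fun k => (hI k).1.aestronglyMeasurable) hB.1
    (fun k => (ae_restrict_iff' measurableSet_Ioi).2 (Eventually.of_forall (hdom k)))
    ((ae_restrict_iff' measurableSet_Ioi).2 (Eventually.of_forall hpt))
  have e : ∀ k, ∫ t in Set.Ioi (0 : ℝ), t ^ (-u) * rtr (K * resl t (ω k)) =
      J * rtr (K * rp (-u) (ω k)) := fun k => (hI k).2
  simp only [e, hI₀.2] at key
  have := key.const_mul J⁻¹
  simpa only [← mul_assoc, inv_mul_cancel₀ hJ.1.ne', one_mul] using this

end NegativePower

section Limits

variable {κ : Type*} [Fintype κ] [DecidableEq κ]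

theorem integral_le_of_tendsto {μ : Measure ℝ} {F : ℕ → ℝ → ℝ} {f : ℝ → ℝ} {c : ℕ → ℝ} {c₀ : ℝ}
    (hF : ∀ k, Integrable (F k) μ) (hF0 : ∀ k, 0 ≤ᵐ[μ] F k)
    (hf : ∀ᵐ x ∂μ, Tendsto (fun k => F k x) atTop (nhds (f x)))
    (hc : ∀ k, ∫ x, F k x ∂μ ≤ c k) (hlim : Tendsto c atTop (nhds c₀)) :
    Integrable f μ ∧ ∫ x, f x ∂μ ≤ c₀ := by
  have hm : AEStronglyMeasurable f μ :=
    aestronglyMeasurable_of_tendsto_ae atTop (fun k => (hF k).aestronglyMeasurable) hf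
  have hf0 : 0 ≤ᵐ[μ] f := by
    filter_upwards [hf, ae_all_iff.2 hF0] with x hx h0
    exact ge_of_tendsto' hx h0
  have hc0 : 0 ≤ c₀ := ge_of_tendsto' hlim fun k => (integral_nonneg_of_ae (hF0 k)).trans (hc k)
  have h1 : ∫⁻ x, ENNReal.ofReal (f x) ∂μ ≤ ENNReal.ofReal c₀ := by
    calc _ = ∫⁻ x, liminf (fun k => ENNReal.ofReal (F k x)) atTop ∂μ := by
          apply lintegral_congr_ae
          filter_upwards [hf] with x hx
          exact ((ENNReal.continuous_ofReal.tendsto _).comp hx).liminf_eq.symm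
      _ ≤ liminf (fun k => ∫⁻ x, ENNReal.ofReal (F k x) ∂μ) atTop :=
          lintegral_liminf_le' fun k => (hF k).aemeasurable.ennreal_ofReal
      _ ≤ liminf (fun k => ENNReal.ofReal (c k)) atTop := by
          refine liminf_le_liminf (Eventually.of_forall fun k => ?_)
          rw [← ofReal_integral_eq_lintegral_ofReal (hF k) (hF0 k)]
          exact ENNReal.ofReal_le_ofReal (hc k)
      _ = ENNReal.ofReal c₀ := ((ENNReal.continuous_ofReal.tendsto _).comp hlim).liminf_eq
  refine ⟨⟨hm, ?_⟩, ?_⟩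
  · rw [hasFiniteIntegral_iff_ofReal hf0]
    exact h1.trans_lt ENNReal.ofReal_lt_top
  · rw [integral_eq_lintegral_of_nonneg_ae hf0 hm]
    exact ENNReal.toReal_le_of_le_ofReal hc0 h1

theorem rtr_conjTranspose (A : Matrix κ κ ℂ) : rtr A.conjTranspose = rtr A := by
  simp [rtr, Matrix.trace_conjTranspose]

theorem tendsto_of_rtr {A : ℕ → Matrix κ κ ℂ} {A₀ : Matrix κ κ ℂ} (hA : ∀ k, (A k).IsHermitian)
    (hA₀ : A₀.IsHermitian)
    (h : ∀ C : Matrix κ κ ℂ, C.PosSemidef →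
      Tendsto (fun k => rtr (C * A k)) atTop (nhds (rtr (C * A₀)))) :
    Tendsto A atTop (nhds A₀) := by
  have h1 : ∀ C : Matrix κ κ ℂ, C.IsHermitian →
      Tendsto (fun k => rtr (C * A k)) atTop (nhds (rtr (C * A₀))) := by
    intro C hC
    obtain ⟨V, a, hd⟩ : ∃ V a, Diag C V a := ⟨_, _, exists_diag hC⟩
    have e : C = fc (fun x => ((max x 0 : ℝ) : ℂ)) C - fc (fun x => ((max (-x) 0 : ℝ) : ℂ)) C := by
      rw [eq_sub_iff_add_eq]
      nth_rw 1 [← fc_id hC]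
      rw [fc_add hC]
      refine hd.fc_congr fun i => ?_
      rw [← Complex.ofReal_add]
      congr 1
      rcases le_total 0 (a i) with h | h
      · rw [max_eq_left h, max_eq_right (by linarith), add_zero]
      · rw [max_eq_right h, max_eq_left (by linarith), add_neg_cancel]
    have p1 : (fc (fun x => ((max x 0 : ℝ) : ℂ)) C).PosSemidef :=
      (hd.diag_fc _).posSemidef fun i => le_max_right _ _
    have p2 : (fc (fun x => ((max (-x) 0 : ℝ) : ℂ)) C).PosSemidef :=
      (hd.diag_fc (fun x => max (-x) 0)).posSemidef fun i => le_max_right _ _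
    rw [e]
    simp only [Matrix.sub_mul, rtr_sub]
    exact (h _ p1).sub (h _ p2)
  have h2 : ∀ C : Matrix κ κ ℂ,
      Tendsto (fun k => rtr (C * A k)) atTop (nhds (rtr (C * A₀))) := by
    intro C
    have e : ∀ B : Matrix κ κ ℂ, B.IsHermitian →
        rtr (C * B) = (1 / 2) * rtr ((C + C.conjTranspose) * B) := by
      intro B hB
      have : rtr (C.conjTranspose * B) = rtr (C * B) := by
        rw [← rtr_conjTranspose, Matrix.conjTranspose_mul, Matrix.conjTranspose_conjTranspose, hB.eq,
          rtr_mul_comm]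
      rw [Matrix.add_mul, rtr_add, this]
      ring
    rw [e _ hA₀]
    simp only [e _ (hA _)]
    refine (h1 _ ?_).const_mul _
    rw [Matrix.IsHermitian, Matrix.conjTranspose_add, Matrix.conjTranspose_conjTranspose, add_comm]
  have hre : ∀ (B : Matrix κ κ ℂ) i j, B i j =
      (rtr (Matrix.single j i 1 * B) : ℂ) + rtr (Matrix.single j i (-Complex.I) * B) * Complex.I := by
    intro B i j
    have e : ∀ c : ℂ, rtr (Matrix.single j i c * B) = (c * B i j).re := by
      intro c
      rw [rtr, Matrix.trace_mul_comm, Matrix.trace_mul_single, mul_comm]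
      rfl
    rw [e, e]
    apply Complex.ext <;> simp
  refine tendsto_pi_nhds.2 fun i => tendsto_pi_nhds.2 fun j => ?_
  simp only [hre]
  exact ((Complex.continuous_ofReal.tendsto _).comp (h2 _)).add
    (((Complex.continuous_ofReal.tendsto _).comp (h2 _)).mul_const _)

theorem tendsto_rp {s : ℝ} (hs : 0 < s) {A : ℕ → Matrix κ κ ℂ} {A₀ : Matrix κ κ ℂ}
    (hA : ∀ k, (A k).PosSemidef) (hlim : Tendsto A atTop (nhds A₀)) :
    Tendsto (fun k => rp s (A k)) atTop (nhds (rp s A₀)) := by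
  refine tendsto_fc (F := fun (_ : Unit) x => ((x ^ s : ℝ) : ℂ)) (p := fun _ => ())
    (p₀ := ()) tendsto_const_nhds (fun x hx => ?_) hA hlim
  apply ContinuousAt.continuousWithinAt
  unfold Function.uncurry
  refine Complex.continuous_ofReal.continuousAt.comp ?_
  exact ContinuousAt.rpow_const continuous_snd.continuousAt (Or.inr hs.le)

end Limits

section FirstOrder

variable {κ : Type*} [Fintype κ] [DecidableEq κ]

theorem Xs_eq_factor {p u : ℝ} (hp : 1 < p) (hu : u = (p - 1) / p) {ρ ω : Matrix κ κ ℂ}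
    (hρ : ρ.PosSemidef) (hω : ω.PosSemidef) :
    Xs p ρ ω = (rp (-(u / 2)) ω * rp (1 / 2) ρ) * (rp (-(u / 2)) ω * rp (1 / 2) ρ).conjTranspose ∧
    rp (1 / 2) ρ * rp (-u) ω * rp (1 / 2) ρ =
      (rp (-(u / 2)) ω * rp (1 / 2) ρ).conjTranspose * (rp (-(u / 2)) ω * rp (1 / 2) ρ) := by
  have hu0 : 0 < u := by rw [hu]; exact div_pos (by linarith) (by linarith)
  have e1 : (1 - p) / (2 * p) = -(u / 2) := by rw [hu]; field_simp; ring
  have e2 : rp (1 / 2) ρ * rp (1 / 2) ρ = ρ := by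
    rw [rp_mul hρ (by norm_num)]; norm_num; exact rp_one hρ.1
  have e3 : rp (-(u / 2)) ω * rp (-(u / 2)) ω = rp (-u) ω := by
    rw [rp_mul hω (by linarith)]; congr 1; ring
  rw [Matrix.conjTranspose_mul, (rp_isHermitian hω.1 _).eq, (rp_isHermitian hρ.1 _).eq, Xs, e1]
  constructor
  · nth_rw 1 [← e2]; simp only [Matrix.mul_assoc]
  · rw [← e3]; simp only [Matrix.mul_assoc]

theorem Qsand_eq_swap {p u : ℝ} (hp : 1 < p) (hu : u = (p - 1) / p) {ρ ω : Matrix κ κ ℂ}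
    (hρ : ρ.PosSemidef) (hω : ω.PosSemidef) :
    Qsand p ρ ω = rtr (rp p (rp (1 / 2) ρ * rp (-u) ω * rp (1 / 2) ρ)) := by
  obtain ⟨h1, h2⟩ := Xs_eq_factor hp hu hρ hω
  rw [Qsand_eq hp hρ hω, h1, h2, rtr_rp_swap _ (by linarith)]

/-- The gradient operator, expressed through the sandwiched operator. -/
theorem gradient_eq {p u : ℝ} (hp : 1 < p) (hu : u = (p - 1) / p) {ρ σ : Matrix κ κ ℂ}
    (hρ : ρ.PosSemidef) (hσ : σ.PosSemidef) (hk : ∀ v, σ.mulVec v = 0 → ρ.mulVec v = 0) :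
    rp (1 / 2) ρ * rp (p - 1) (rp (1 / 2) ρ * rp (-u) σ * rp (1 / 2) ρ) * rp (1 / 2) ρ =
      rp (u / 2) σ * rp p (Xs p ρ σ) * rp (u / 2) σ := by
  have hu0 : 0 < u := by rw [hu]; exact div_pos (by linarith) (by linarith)
  obtain ⟨h1, h2⟩ := Xs_eq_factor hp hu hρ hσ
  have hr := rp_isHermitian hρ.1 (1 / 2)
  have e : rp (u / 2) σ * (rp (-(u / 2)) σ * rp (1 / 2) ρ) = rp (1 / 2) ρ := by
    obtain ⟨V, a, hd, ha⟩ := exists_diag_psd hσ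
    rw [← Matrix.mul_assoc, rp, rp, fc_mul hσ.1]
    have hc : fc (fun x : ℝ => ((x ^ (u / 2) : ℝ) : ℂ) * ((x ^ (-(u / 2)) : ℝ) : ℂ)) σ =
        fc (fun x : ℝ => if x = 0 then 0 else 1) σ := by
      refine hd.fc_congr fun i => ?_
      rw [← Complex.ofReal_mul]
      split_ifs with h
      · rw [h, Real.zero_rpow (by linarith), zero_mul, Complex.ofReal_zero]
      · have := lt_of_le_of_ne (ha i) (Ne.symm h)
        rw [← Real.rpow_add this, add_neg_cancel, Real.rpow_zero, Complex.ofReal_one]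
    rw [hc]
    exact supp_mul hd hr (ker_rp_half hρ hk) fun x hx => if_neg hx
  have e' := congrArg Matrix.conjTranspose e
  rw [Matrix.conjTranspose_mul, (rp_isHermitian hσ.1 _).eq, hr.eq] at e'
  rw [h2, h1, ← rp_swap _ (by linarith : (0 : ℝ) < p)]
  set C := rp (-(u / 2)) σ * rp (1 / 2) ρ
  calc _ = rp (u / 2) σ * C * rp (p - 1) (C.conjTranspose * C) *
        (C.conjTranspose * rp (u / 2) σ) := by rw [e, e']
    _ = _ := by simp only [Matrix.mul_assoc]

end FirstOrder

section FirstOrderCondition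

variable {κ : Type*} [Fintype κ] [DecidableEq κ]

theorem rtr_mul_rp_smul {u c : ℝ} (hc : 0 ≤ c) {σ : Matrix κ κ ℂ} (hσ : σ.PosSemidef)
    (K : Matrix κ κ ℂ) : rtr (K * rp (-u) ((c : ℂ) • σ)) = c ^ (-u) * rtr (K * rp (-u) σ) := by
  obtain ⟨V, a, hd, ha⟩ := exists_diag_psd hσ
  rw [← rtr_smul, rp, rp, ← Matrix.mul_smul, (hd.real_smul c).fc_eq, hd.fc_eq,
    ← Matrix.smul_mul, ← Matrix.mul_smul, ← Matrix.diagonal_smul]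
  congr 5
  ext i
  rw [Real.mul_rpow hc (ha i)]
  simp

/-- First order optimality of `σ` along the segment from `σ` to `τ`. -/
theorem first_order {p u J : ℝ} (hp : 1 < p) (hu : u = (p - 1) / p) (hJ : IsInvConst u J)
    {ρ σ τ : Matrix κ κ ℂ} (hρ : ρ.PosSemidef) (hσ : σ.PosSemidef) (hτ : τ.PosSemidef)
    (hk : ∀ v, σ.mulVec v = 0 → ρ.mulVec v = 0)
    (hmin : ∀ ε : ℝ, 0 < ε → ε < 1 →
      Qsand p ρ σ ≤ Qsand p ρ (((1 - ε : ℝ) : ℂ) • σ + ((ε : ℝ) : ℂ) • τ)) :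
    IntegrableOn (fun t : ℝ => t ^ (-u) * rtr (τ * (resl t σ *
      (rp (u / 2) σ * rp p (Xs p ρ σ) * rp (u / 2) σ) * resl t σ))) (Set.Ioi 0) ∧
    ∫ t in Set.Ioi (0 : ℝ), t ^ (-u) * rtr (τ * (resl t σ *
      (rp (u / 2) σ * rp p (Xs p ρ σ) * rp (u / 2) σ) * resl t σ)) ≤ J * u * Qsand p ρ σ := by
  have hp0 : 0 < p := by linarith
  have hu0 : 0 < u := by rw [hu]; exact div_pos (by linarith) hp0
  have hu1 : u < 1 := by rw [hu, div_lt_one hp0]; linarith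
  set h := rp (1 / 2) ρ with hh
  have hhp : h.PosSemidef := rp_posSemidef hρ _
  have hkh : ∀ v, σ.mulVec v = 0 → h.mulVec v = 0 := ker_rp_half hρ hk
  set e : ℕ → ℝ := fun k => 1 / ((k : ℝ) + 2) with he
  have he0 : ∀ k, 0 < e k := fun k => by simp only [he]; positivity
  have he1 : ∀ k, e k ≤ 1 / 2 := fun k => by
    simp only [he]
    apply one_div_le_one_div_of_le (by norm_num)
    have : (0 : ℝ) ≤ k := Nat.cast_nonneg k
    linarith
  have hel : Tendsto e atTop (nhds 0) := by
    have := (tendsto_natCast_atTop_atTop (R := ℝ)).atTop_add (tendsto_const_nhds (x := (2 : ℝ)))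
    simp only [he, one_div]
    exact this.inv_tendsto_atTop
  set c : ℕ → ℝ := fun k => 1 - e k with hc
  have hc0 : ∀ k, 1 / 2 ≤ c k := fun k => by have := he1 k; simp only [hc]; linarith
  have hcl : Tendsto c atTop (nhds 1) := by simpa using hel.const_sub 1
  set ω' : ℕ → Matrix κ κ ℂ := fun k => ((c k : ℝ) : ℂ) • σ with hω'
  set ω : ℕ → Matrix κ κ ℂ := fun k => ((c k : ℝ) : ℂ) • σ + ((e k : ℝ) : ℂ) • τ with hω
  have hω'p : ∀ k, (ω' k).PosSemidef := fun k => hσ.smul (by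
    have := hc0 k; exact_mod_cast (by linarith : (0 : ℝ) ≤ c k))
  have heτ : ∀ k, (((e k : ℝ) : ℂ) • τ).PosSemidef := fun k => hτ.smul (by
    have := he0 k; exact_mod_cast this.le)
  have hωp : ∀ k, (ω k).PosSemidef := fun k => (hω'p k).add (heτ k)
  have hωω' : ∀ k, ω k - ω' k = ((e k : ℝ) : ℂ) • τ := fun k => by
    simp only [hω, hω']; abel
  have hsm : ∀ (a : ℝ), 1 / 2 ≤ a → (((a : ℝ) : ℂ) • σ - ((1 / 2 : ℝ) : ℂ) • σ).PosSemidef := by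
    intro a ha
    rw [← sub_smul, ← Complex.ofReal_sub]
    exact hσ.smul (by exact_mod_cast sub_nonneg.2 ha)
  have hle : ∀ k, (ω k - ((1 / 2 : ℝ) : ℂ) • σ).PosSemidef := fun k => by
    have := (hsm _ (hc0 k)).add (heτ k)
    convert this using 1
    simp only [hω]; abel
  have hle₀ : (σ - ((1 / 2 : ℝ) : ℂ) • σ).PosSemidef := by
    simpa using hsm 1 (by norm_num)
  have hcast : Continuous fun x : ℝ => (x : ℂ) := Complex.continuous_ofReal
  have hω'l : Tendsto ω' atTop (nhds σ) := by
    have := ((hcast.tendsto _).comp hcl).smul_const σ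
    rwa [Complex.ofReal_one, one_smul] at this
  have hωl : Tendsto ω atTop (nhds σ) := by
    have := hω'l.add (((hcast.tendsto _).comp hel).smul_const τ)
    rwa [Complex.ofReal_zero, zero_smul, add_zero] at this
  set A : ℕ → Matrix κ κ ℂ := fun k => h * rp (-u) (ω k) * h with hA
  set A₀ := h * rp (-u) σ * h with hA₀
  have hconj : ∀ B : Matrix κ κ ℂ, B.PosSemidef → (h * B * h).PosSemidef := by
    intro B hB
    have := hB.mul_mul_conjTranspose_same h
    rwa [hhp.1.eq] at this
  have hAp : ∀ k, (A k).PosSemidef := fun k => hconj _ (rp_posSemidef (hωp k) _)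
  have hA₀p : A₀.PosSemidef := hconj _ (rp_posSemidef hσ _)
  have hcyc : ∀ B C : Matrix κ κ ℂ, rtr (C * (h * B * h)) = rtr (h * C * h * B) := by
    intro B C
    rw [← Matrix.mul_assoc, ← Matrix.mul_assoc, rtr_mul_comm, ← Matrix.mul_assoc,
      ← Matrix.mul_assoc]
  have hkK : ∀ B : Matrix κ κ ℂ, ∀ v, σ.mulVec v = 0 → (h * B * h).mulVec v = 0 :=
    fun B => ker_mul_right hkh _
  have hAl : Tendsto A atTop (nhds A₀) := by
    refine tendsto_of_rtr (fun k => (hAp k).1) hA₀p.1 fun C hC => ?_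
    simp only [hA, hA₀, hcyc]
    exact tendsto_rtr_rp_neg hJ (hconj C hC) hσ (hkK C) hωp hσ hωl (by norm_num) hle hle₀
  set K : ℕ → Matrix κ κ ℂ := fun k => h * rp (p - 1) (A k) * h with hK
  set R := h * rp (p - 1) A₀ * h with hR
  have hKl : Tendsto K atTop (nhds R) := by
    have h1 := tendsto_rp (s := p - 1) (by linarith) hAp hAl
    exact ((tendsto_const_nhds (x := h)).mul h1).mul tendsto_const_nhds
  have hKp : ∀ k, (K k).PosSemidef := fun k => hconj _ (rp_posSemidef (hAp k) _)
  have hQ : Qsand p ρ σ = rtr (rp p A₀) := Qsand_eq_swap hp hu hρ hσ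
  have hRQ : rtr (R * rp (-u) σ) = Qsand p ρ σ := by
    rw [hR, ← hcyc, ← hA₀, hQ]
    nth_rw 2 [← rp_one hA₀p.1]
    rw [rp_mul hA₀p (by linarith), sub_add_cancel]
  have hklein : ∀ k, rtr (K k * rp (-u) σ) ≤ rtr (K k * rp (-u) (ω k)) := by
    intro k
    have h1 := klein (hAp k) hA₀p hp
    have h2 := hmin (e k) (he0 k) (by have := he1 k; linarith)
    rw [hQ, Qsand_eq_swap hp hu hρ (hωp k)] at h2
    have h2' : rtr (rp p A₀) ≤ rtr (rp p (A k)) := h2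
    have h3 : rtr (rp (p - 1) (A k) * (A₀ - A k)) ≤ 0 := by nlinarith
    rw [Matrix.mul_sub, rtr_sub] at h3
    simp only [hA₀, hK, ← hcyc] at h3 ⊢
    linarith
  have hkerω : ∀ k v, (ω k).mulVec v = 0 → (K k).mulVec v = 0 := fun k v hv =>
    hkK _ v (ker_of_sub_posSemidef hσ (by norm_num) (hle k) v hv)
  have hkerω' : ∀ k v, (ω' k).mulVec v = 0 → (K k).mulVec v = 0 := fun k v hv =>
    hkK _ v (ker_of_sub_posSemidef hσ (c := 1 / 2) (by norm_num) (hsm _ (hc0 k)) v hv)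
  set F : ℕ → ℝ → ℝ := fun k t => t ^ (-u) * rtr (K k * (resl t (ω' k) * τ * resl t (ω k))) with hF
  have hFe : ∀ k, ∀ t ∈ Set.Ioi (0 : ℝ), F k t = (e k)⁻¹ *
      (t ^ (-u) * rtr (K k * resl t (ω' k)) - t ^ (-u) * rtr (K k * resl t (ω k))) := by
    intro k t ht
    have h1 := resl_sub ht (hω'p k) (hωp k)
    rw [hωω', Matrix.mul_smul, Matrix.smul_mul] at h1
    rw [← mul_sub, ← rtr_sub, ← Matrix.mul_sub, h1, Matrix.mul_smul, rtr_smul]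
    simp only [hF]
    have := (he0 k).ne'
    field_simp
  have hI1 := fun k => integral_rtr_resl hJ (hω'p k) (hKp k).1 (hkerω' k)
  have hI2 := fun k => integral_rtr_resl hJ (hωp k) (hKp k).1 (hkerω k)
  have hFi : ∀ k, Integrable (F k) (volume.restrict (Set.Ioi 0)) := fun k =>
    (integrableOn_congr_fun (hFe k) measurableSet_Ioi).2 (((hI1 k).1.sub (hI2 k).1).const_mul _)
  have hF0 : ∀ k, 0 ≤ᵐ[volume.restrict (Set.Ioi 0)] F k := by
    intro k
    refine (ae_restrict_iff' measurableSet_Ioi).2 (Eventually.of_forall fun t ht => ?_)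
    have ht' : 0 < t := ht
    have h1 := rtr_mul_mono (resl_antitone ht' (hω'p k) (hωp k) (by rw [hωω']; exact heτ k)) (hKp k)
    have h2 := he0 k
    rw [hFe k t ht, ← mul_sub]
    have := sub_nonneg.2 h1
    change (0 : ℝ) ≤ _
    positivity
  have hFl : ∀ᵐ t ∂(volume.restrict (Set.Ioi 0)), Tendsto (fun k => F k t) atTop
      (nhds (t ^ (-u) * rtr (R * (resl t σ * τ * resl t σ)))) := by
    refine (ae_restrict_iff' measurableSet_Ioi).2 (Eventually.of_forall fun t ht => ?_)
    refine Tendsto.const_mul _ ?_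
    have h1 := hKl.mul (((tendsto_resl ht hω'p hω'l).mul (tendsto_const_nhds (x := τ))).mul
      (tendsto_resl ht hωp hωl))
    have h2 : Continuous fun M : Matrix κ κ ℂ => rtr M := by
      simpa using continuous_rtr_mul (1 : Matrix κ κ ℂ)
    exact (h2.tendsto _).comp h1
  have hσK : ∀ k, 0 ≤ rtr (K k * rp (-u) σ) := fun k =>
    rtr_mul_nonneg (hKp k) (rp_posSemidef hσ _)
  have hbound : ∀ k, ∫ t in Set.Ioi (0 : ℝ), F k t ≤ J * (u / c k) * rtr (K k * rp (-u) σ) := by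
    intro k
    have hck : 0 < c k := by have := hc0 k; linarith
    rw [setIntegral_congr_fun measurableSet_Ioi (hFe k), integral_const_mul,
      integral_sub (hI1 k).1 (hI2 k).1, (hI1 k).2, (hI2 k).2, rtr_mul_rp_smul hck.le hσ]
    have h1 : (c k) ^ (-u) ≤ 1 + u * (e k / c k) := by
      have h2 : (c k) ^ (-u) = (1 + e k / c k) ^ u := by
        rw [Real.rpow_neg hck.le, ← Real.inv_rpow hck.le]
        congr 1
        field_simp
        simp only [hc]; ring
      rw [h2]
      exact rpow_one_add_le_one_add_mul_self
        (by have := he0 k; have : 0 < e k / c k := by positivity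
            linarith) hu0.le hu1.le
    have h3 := mul_le_mul_of_nonneg_right h1 (hσK k)
    have h4 := hklein k
    have he := he0 k
    rw [← mul_sub, inv_mul_le_iff₀ he]
    have h5 : e k * (J * (u / c k) * rtr (K k * rp (-u) σ)) =
        J * (u * (e k / c k) * rtr (K k * rp (-u) σ)) := by ring
    rw [h5]
    refine mul_le_mul_of_nonneg_left ?_ hJ.1.le
    linarith
  have hcl2 : Tendsto (fun k => J * (u / c k) * rtr (K k * rp (-u) σ)) atTop
      (nhds (J * u * Qsand p ρ σ)) := by
    have h1 : Tendsto (fun k => rtr (K k * rp (-u) σ)) atTop (nhds (rtr (R * rp (-u) σ))) :=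
      ((continuous_rtr_mul _).tendsto _).comp hKl
    have h2 := ((tendsto_const_nhds (x := u)).div hcl one_ne_zero).const_mul J
    rw [← hRQ]
    simpa using h2.mul h1
  have key := integral_le_of_tendsto hFi hF0 hFl hbound hcl2
  have hcyc2 : ∀ t : ℝ, rtr (R * (resl t σ * τ * resl t σ)) = rtr (τ * (resl t σ * R * resl t σ)) := by
    intro t
    rw [rtr_mul_comm, Matrix.mul_assoc, Matrix.mul_assoc, rtr_mul_comm]
    simp only [Matrix.mul_assoc]
  simp only [hcyc2] at key
  rw [← gradient_eq hp hu hρ hσ hk]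
  exact key

end FirstOrderCondition

section ScalarSplit

theorem integral_three_scales {φ q : ℝ → ℝ} {a s h B G G' K : ℝ}
    (hφ : IntegrableOn φ (Set.Ioi 0)) (hq : IntegrableOn q (Set.Ioi 0))
    (hq0 : ∀ v, 0 < v → 0 ≤ q v) (hK : ∫ v in Set.Ioi (0 : ℝ), q v ≤ K) (ha0 : 0 < a) (ha1 : a < 1)
    (hs : 0 < s) (hB : 0 < B)
    (h1 : ∀ v, 0 < v → φ v ≤ 1 / 2 * (s * q v + h / s * v⁻¹))
    (h2 : ∀ v, 0 < v → φ v ≤ G * v ^ (a - 2)) (h3 : ∀ v, 0 < v → φ v ≤ G' * v ^ (a - 1)) :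
    ∫ v in Set.Ioi (0 : ℝ), φ v ≤ 1 / 2 * (s * K + h / s * (2 * B)) +
      G * (Real.exp (-(B * (1 - a))) / (1 - a)) + G' * (Real.exp (-(B * a)) / a) := by
  set b := Real.exp (-B) with hb
  set c := Real.exp B with hc
  have hb0 : 0 < b := Real.exp_pos _
  have hc0 : 0 < c := Real.exp_pos _
  have hbc : b ≤ c := Real.exp_le_exp.2 (by linarith)
  have hs1 : Set.Ioi (0 : ℝ) = Set.Ioc 0 b ∪ Set.Ioi b := (Set.Ioc_union_Ioi_eq_Ioi hb0.le).symm
  have hs2 : Set.Ioi b = Set.Ioc b c ∪ Set.Ioi c := (Set.Ioc_union_Ioi_eq_Ioi hbc).symm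
  have sub1 : Set.Ioc 0 b ⊆ Set.Ioi (0 : ℝ) := Set.Ioc_subset_Ioi_self
  have sub2 : Set.Ioc b c ⊆ Set.Ioi (0 : ℝ) := fun x hx => hb0.trans hx.1
  have sub3 : Set.Ioi c ⊆ Set.Ioi (0 : ℝ) := fun x hx => hc0.trans hx
  have sub4 : Set.Ioi b ⊆ Set.Ioi (0 : ℝ) := fun x hx => hb0.trans hx
  have e1 : ∫ v in Set.Ioi (0 : ℝ), φ v =
      (∫ v in Set.Ioc 0 b, φ v) + ((∫ v in Set.Ioc b c, φ v) + ∫ v in Set.Ioi c, φ v) := by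
    rw [← setIntegral_union (Set.Ioc_disjoint_Ioi le_rfl) measurableSet_Ioi (hφ.mono_set sub2)
      (hφ.mono_set sub3), ← hs2, ← setIntegral_union (Set.Ioc_disjoint_Ioi le_rfl) measurableSet_Ioi
      (hφ.mono_set sub1) (hφ.mono_set sub4), ← hs1]
  have p1 : ∫ v in Set.Ioc 0 b, φ v ≤ G' * (Real.exp (-(B * a)) / a) := by
    have hi : IntegrableOn (fun v : ℝ => v ^ (a - 1)) (Set.Ioc 0 b) :=
      (intervalIntegrable_iff_integrableOn_Ioc_of_le hb0.le).1
        (intervalIntegral.intervalIntegrable_rpow' (by linarith))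
    have hv : ∫ v in Set.Ioc 0 b, v ^ (a - 1) = Real.exp (-(B * a)) / a := by
      rw [← intervalIntegral.integral_of_le hb0.le, integral_rpow (Or.inl (by linarith))]
      rw [sub_add_cancel, Real.zero_rpow ha0.ne', sub_zero, hb, ← Real.exp_mul]
      congr 2; ring
    calc _ ≤ ∫ v in Set.Ioc 0 b, G' * v ^ (a - 1) :=
          setIntegral_mono_on (hφ.mono_set sub1) (hi.const_mul _) measurableSet_Ioc
            fun v hv => h3 v hv.1
      _ = _ := by rw [integral_const_mul, hv]
  have p3 : ∫ v in Set.Ioi c, φ v ≤ G * (Real.exp (-(B * (1 - a))) / (1 - a)) := by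
    have hi : IntegrableOn (fun v : ℝ => v ^ (a - 2)) (Set.Ioi c) :=
      integrableOn_Ioi_rpow_of_lt (by linarith) hc0
    have hv : ∫ v in Set.Ioi c, v ^ (a - 2) = Real.exp (-(B * (1 - a))) / (1 - a) := by
      rw [integral_Ioi_rpow_of_lt (by linarith) hc0, hc, ← Real.exp_mul,
        show a - 2 + 1 = -(1 - a) by ring, neg_div_neg_eq]
      congr 2; ring
    calc _ ≤ ∫ v in Set.Ioi c, G * v ^ (a - 2) :=
          setIntegral_mono_on (hφ.mono_set sub3) (hi.const_mul _) measurableSet_Ioi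
            fun v hv => h2 v (hc0.trans hv)
      _ = _ := by rw [integral_const_mul, hv]
  have p2 : ∫ v in Set.Ioc b c, φ v ≤ 1 / 2 * (s * K + h / s * (2 * B)) := by
    have hi : IntegrableOn (fun v : ℝ => v⁻¹) (Set.Ioc b c) := by
      rw [← intervalIntegrable_iff_integrableOn_Ioc_of_le hbc]
      refine intervalIntegral.intervalIntegrable_inv (fun x hx => ?_) continuousOn_id
      rw [Set.uIcc_of_le hbc] at hx
      exact (hb0.trans_le hx.1).ne'
    have hv : ∫ v in Set.Ioc b c, v⁻¹ = 2 * B := by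
      rw [← intervalIntegral.integral_of_le hbc, integral_inv_of_pos hb0 hc0, hb, hc,
        ← Real.exp_sub, Real.log_exp]
      ring
    have hq' : ∫ v in Set.Ioc b c, q v ≤ K := by
      refine le_trans (setIntegral_mono_set hq ?_ (Eventually.of_forall sub2)) hK
      exact (ae_restrict_iff' measurableSet_Ioi).2 (Eventually.of_forall fun v hv => hq0 v hv)
    calc _ ≤ ∫ v in Set.Ioc b c, 1 / 2 * (s * q v + h / s * v⁻¹) :=
          setIntegral_mono_on (hφ.mono_set sub2)
            ((((hq.mono_set sub2).const_mul s).add (hi.const_mul _)).const_mul _) measurableSet_Ioc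
            fun v hv => h1 v (sub2 hv)
      _ = 1 / 2 * (s * (∫ v in Set.Ioc b c, q v) + h / s * (2 * B)) := by
          rw [integral_const_mul, integral_add ((hq.mono_set sub2).const_mul s) (hi.const_mul _),
            integral_const_mul, integral_const_mul, hv]
      _ ≤ _ := by gcongr
  linarith

end ScalarSplit

section HadamardForm

variable {κ : Type*} [Fintype κ] [DecidableEq κ]

/-- The real part of the sesquilinear form on vectors obtained from the entrywise product of two
matrices. -/
def hform (T Z : Matrix κ κ ℂ) (w e : κ → ℂ) : ℝ :=
  rtr (T * (Matrix.diagonal w * Z * (Matrix.diagonal e).conjTranspose))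

theorem hform_eq_sum (T Z : Matrix κ κ ℂ) (w e : κ → ℂ) :
    hform T Z w e = ∑ y, ∑ x, (T y x * (w x * Z x y * star (e y))).re := by
  simp only [hform, rtr, Matrix.trace, Matrix.diag_apply, Complex.re_sum]
  refine Finset.sum_congr rfl fun y _ => ?_
  rw [Matrix.mul_apply, Complex.re_sum]
  refine Finset.sum_congr rfl fun x _ => ?_
  rw [Matrix.diagonal_conjTranspose, Matrix.mul_diagonal, Matrix.diagonal_mul]
  rfl

theorem hform_self_nonneg {T Z : Matrix κ κ ℂ} (hT : T.PosSemidef) (hZ : Z.PosSemidef)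
    (w : κ → ℂ) : 0 ≤ hform T Z w w :=
  rtr_mul_nonneg hT (hZ.mul_mul_conjTranspose_same _)

theorem hform_comm {T Z : Matrix κ κ ℂ} (hT : T.IsHermitian) (hZ : Z.IsHermitian)
    (w e : κ → ℂ) : hform T Z w e = hform T Z e w := by
  rw [hform, ← rtr_conjTranspose]
  simp only [Matrix.conjTranspose_mul, Matrix.conjTranspose_conjTranspose, hT.eq, hZ.eq]
  rw [rtr_mul_comm, hform]
  simp only [Matrix.mul_assoc]

theorem hform_smul_smul (T Z : Matrix κ κ ℂ) (w e : κ → ℂ) (a b : ℂ) {r : ℝ}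
    (h : a * star b = r) : hform T Z (a • w) (b • e) = r * hform T Z w e := by
  rw [hform_eq_sum, hform_eq_sum, Finset.mul_sum]
  refine Finset.sum_congr rfl fun y _ => ?_
  rw [Finset.mul_sum]
  refine Finset.sum_congr rfl fun x _ => ?_
  rw [← Complex.re_ofReal_mul, ← h]
  simp only [Pi.smul_apply, smul_eq_mul, star_mul']
  congr 1; ring

theorem two_hform_le {T Z : Matrix κ κ ℂ} (hT : T.PosSemidef) (hZ : Z.PosSemidef)
    (w e : κ → ℂ) : 2 * hform T Z w e ≤ hform T Z w w + hform T Z e e := by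
  have h := hform_self_nonneg hT hZ (w - e)
  have e1 : hform T Z (w - e) (w - e) =
      hform T Z w w - hform T Z w e - (hform T Z e w - hform T Z e e) := by
    have hs : ∀ f g : κ → ℂ, Matrix.diagonal (f - g) = Matrix.diagonal f - Matrix.diagonal g :=
      fun f g => (Matrix.diagonal_sub f g).symm
    simp only [hform, hs, Matrix.conjTranspose_sub, Matrix.sub_mul, Matrix.mul_sub, rtr_sub]
    ring
  rw [hform_comm hT.1 hZ.1 e w] at e1
  linarith

theorem two_hform_le_weighted {T Z : Matrix κ κ ℂ} (hT : T.PosSemidef) (hZ : Z.PosSemidef)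
    (w e : κ → ℂ) {s : ℝ} (hs : 0 < s) :
    2 * hform T Z w e ≤ s * hform T Z w w + hform T Z e e / s := by
  have h := two_hform_le hT hZ (((√s : ℝ) : ℂ) • w) (((√s : ℝ) : ℂ)⁻¹ • e)
  have h0 : √s ≠ 0 := (Real.sqrt_pos.2 hs).ne'
  rw [hform_smul_smul (r := 1), hform_smul_smul (r := s), hform_smul_smul (r := s⁻¹)] at h
  · rw [div_eq_inv_mul]; linarith
  · rw [star_inv₀, Complex.star_def, Complex.conj_ofReal, ← mul_inv, ← Complex.ofReal_mul,
      Real.mul_self_sqrt hs.le, Complex.ofReal_inv]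
  · rw [Complex.star_def, Complex.conj_ofReal, ← Complex.ofReal_mul, Real.mul_self_sqrt hs.le]
  · rw [star_inv₀, Complex.star_def, Complex.conj_ofReal, mul_inv_cancel₀ (by exact_mod_cast h0)]
    simp

theorem hform_le_sum_norm (T Z : Matrix κ κ ℂ) (w e : κ → ℂ) :
    hform T Z w e ≤ ∑ y, ∑ x, ‖T y x‖ * (‖w x‖ * ‖Z x y‖ * ‖e y‖) := by
  rw [hform_eq_sum]
  refine Finset.sum_le_sum fun y _ => Finset.sum_le_sum fun x _ => ?_
  refine (Complex.re_le_norm _).trans_eq ?_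
  simp [norm_mul]

theorem integral_hform {μ : Measure ℝ} (T Z : Matrix κ κ ℂ) (w : ℝ → κ → ℂ) (f e : κ → ℂ)
    (h : ∀ x, (∀ y, Z x y = 0) ∨ (Integrable (fun v => w v x) μ ∧ ∫ v, w v x ∂μ = f x)) :
    Integrable (fun v => hform T Z (w v) e) μ ∧ ∫ v, hform T Z (w v) e ∂μ = hform T Z f e := by
  have key : ∀ y x, Integrable (fun v => (T y x * (w v x * Z x y * star (e y))).re) μ ∧
      ∫ v, (T y x * (w v x * Z x y * star (e y))).re ∂μ =
        (T y x * (f x * Z x y * star (e y))).re := by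
    intro y x
    rcases h x with h | h
    · simp [h]
    · have h1 : Integrable (fun v => T y x * (w v x * Z x y * star (e y))) μ :=
        ((h.1.mul_const _).mul_const _).const_mul _
      refine ⟨h1.re, ?_⟩
      refine Eq.trans (integral_re h1) ?_
      rw [integral_const_mul, integral_mul_const, integral_mul_const, h.2]
      rfl
  simp only [hform_eq_sum]
  refine ⟨integrable_finsetSum _ fun y _ => integrable_finsetSum _ fun x _ => (key y x).1, ?_⟩
  rw [integral_finsetSum _ fun y _ => integrable_finsetSum _ fun x _ => (key y x).1]
  refine Finset.sum_congr rfl fun y _ => ?_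
  rw [integral_finsetSum _ fun x _ => (key y x).1]
  exact Finset.sum_congr rfl fun x _ => (key y x).2

end HadamardForm

section OneShot

variable {κ : Type*} [Fintype κ] [DecidableEq κ]

/-- The exponent of the Mellin transform producing the power `-(1 + iθ)/2` after multiplication
by the power `u / 2`. -/
def mellinExp (u θ : ℝ) : ℂ := ((1 - u) / 2 : ℝ) - Complex.I * (θ / 2 : ℝ)

theorem mellinExp_re (u θ : ℝ) : (mellinExp u θ).re = (1 - u) / 2 := by
  rw [mellinExp, Complex.sub_re, Complex.ofReal_re, Complex.re_mul_ofReal, Complex.I_re]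
  ring

theorem cpow_mellinExp {u θ x : ℝ} (hx : 0 < x) :
    ((x ^ (u / 2) : ℝ) : ℂ) * (x : ℂ) ^ (mellinExp u θ - 1) =
      pw (-((1 : ℂ) + Complex.I * (θ : ℂ)) / 2) x := by
  rw [pw, if_neg hx.ne', Complex.ofReal_cpow hx.le,
    ← Complex.cpow_add _ _ (by exact_mod_cast hx.ne')]
  congr 1
  rw [mellinExp]
  push_cast
  ring

theorem norm_mul_hform_le {u θ : ℝ} (hu0 : 0 < u) (hu1 : u < 1) {T Z : Matrix κ κ ℂ}
    (hT : T.PosSemidef) (hZ : Z.PosSemidef) {lam : κ → ℝ} (hlam : ∀ x, 0 ≤ lam x)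
    (hk : ∀ x y, lam x = 0 → Z x y = 0) {K l G B : ℝ}
    (hi : IntegrableOn (fun v : ℝ => v ^ (-u) *
      hform T Z (fun x => ((lam x ^ (u / 2) * (v + lam x)⁻¹ : ℝ) : ℂ))
        (fun x => ((lam x ^ (u / 2) * (v + lam x)⁻¹ : ℝ) : ℂ))) (Set.Ioi 0))
    (hK : ∫ v in Set.Ioi (0 : ℝ), v ^ (-u) *
      hform T Z (fun x => ((lam x ^ (u / 2) * (v + lam x)⁻¹ : ℝ) : ℂ))
        (fun x => ((lam x ^ (u / 2) * (v + lam x)⁻¹ : ℝ) : ℂ)) ≤ K)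
    (hl0 : 0 < l) (hl : ∀ x, lam x ≠ 0 → l ≤ lam x) (hB : 0 < B)
    (hG : ∑ y, ∑ x, ‖T y x‖ * (lam x ^ (u / 2) * ‖Z x y‖ *
      ‖pw (-((1 : ℂ) + Complex.I * (θ : ℂ)) / 2) (lam y)‖) ≤ G) :
    ‖mellinInv (mellinExp u θ)‖ *
      hform T Z (fun x => pw (-((1 : ℂ) + Complex.I * (θ : ℂ)) / 2) (lam x))
        (fun x => pw (-((1 : ℂ) + Complex.I * (θ : ℂ)) / 2) (lam x)) ≤
      2 * (B * K / ‖mellinInv (mellinExp u θ)‖ +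
        G * (Real.exp (-(B * (1 - (1 - u) / 2))) / (1 - (1 - u) / 2)) +
        G * l⁻¹ * (Real.exp (-(B * ((1 - u) / 2))) / ((1 - u) / 2))) := by
  set z := mellinExp u θ with hz
  set a := (1 - u) / 2 with ha
  have hza : z.re = a := mellinExp_re u θ
  have ha0 : 0 < a := by simp only [ha]; linarith
  have ha1 : a < 1 := by simp only [ha]; linarith
  set M := mellinInv z with hM
  have hM0 : M ≠ 0 := (mellinInv_convergent (by rw [hza]; exact ha0) (by rw [hza]; exact ha1)).2
  set m := ‖M‖ with hm
  have hm0 : 0 < m := norm_pos_iff.2 hM0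
  have hmc : (m : ℂ) ≠ 0 := by exact_mod_cast hm0.ne'
  set e : κ → ℂ := fun x => pw (-((1 : ℂ) + Complex.I * (θ : ℂ)) / 2) (lam x) with he
  set w : ℝ → κ → ℂ := fun v x => ((lam x ^ (u / 2) * (v + lam x)⁻¹ : ℝ) : ℂ) with hw
  set ph : ℂ := star M / m with hph
  have hph1 : ‖ph‖ = 1 := by
    rw [hph, norm_div, norm_star, Complex.norm_real, Real.norm_of_nonneg hm0.le]
    exact div_self hm0.ne'
  have hphM : ph * M = m := by
    rw [hph, div_mul_eq_mul_div, div_eq_iff hmc, Complex.star_def, ← Complex.normSq_eq_conj_mul_self,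
      Complex.normSq_eq_norm_sq]
    push_cast
    ring
  set c : ℝ → ℂ := fun v => ph * (v : ℂ) ^ (z - 1) with hc
  have hcn : ∀ v : ℝ, 0 < v → ‖c v‖ = v ^ (a - 1) := fun v hv => by
    rw [hc, norm_mul, hph1, one_mul, Complex.norm_cpow_eq_rpow_re_of_pos hv, Complex.sub_re, hza,
      Complex.one_re]
  have hInt := integral_hform (μ := volume.restrict (Set.Ioi (0 : ℝ))) T Z
    (fun v => c v • w v) ((m : ℂ) • e) e (fun x => by
      rcases (hlam x).eq_or_lt with h | h
      · left; exact fun y => hk x y h.symm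
      · right
        have h1 := mellin_inv_add (z := z) (by rw [hza]; exact ha0) (by rw [hza]; exact ha1) h
        have e1 : (fun v : ℝ => (c v • w v) x) = fun v : ℝ => (ph * ((lam x ^ (u / 2) : ℝ) : ℂ)) *
            ((v : ℂ) ^ (z - 1) * (((v + lam x : ℝ)⁻¹ : ℝ) : ℂ)) := by
          funext v
          simp only [hc, hw, Pi.smul_apply, smul_eq_mul, Complex.ofReal_mul]
          ring
        rw [e1]
        refine ⟨h1.1.const_mul _, ?_⟩
        rw [integral_const_mul, h1.2, Pi.smul_apply, smul_eq_mul, ← hphM]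
        simp only [he]
        rw [← cpow_mellinExp h]
        ring)
  set h := hform T Z e e with hh
  have hval : ∫ v in Set.Ioi (0 : ℝ), hform T Z (c v • w v) e = m * h := by
    rw [hInt.2, hh, ← hform_smul_smul T Z e e (m : ℂ) 1 (r := m) (by simp), one_smul]
  have hh0 : 0 ≤ h := hform_self_nonneg hT hZ e
  set s := 2 * B / m with hs
  have hs0 : 0 < s := by positivity
  have hwv : ∀ v : ℝ, 0 < v → ∀ x, ‖w v x‖ ≤ lam x ^ (u / 2) * v⁻¹ := fun v hv x => by
    have h1 := hlam x
    have h2 := Real.rpow_nonneg h1 (u / 2)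
    simp only [hw]
    rw [Complex.norm_real, Real.norm_of_nonneg (by positivity)]
    refine mul_le_mul_of_nonneg_left ?_ h2
    exact inv_anti₀ hv (by linarith)
  have hwl : ∀ v : ℝ, 0 < v → ∀ x, ‖w v x‖ ≤ lam x ^ (u / 2) * l⁻¹ := fun v hv x => by
    have h1 := hlam x
    have h2 := Real.rpow_nonneg h1 (u / 2)
    simp only [hw]
    rw [Complex.norm_real, Real.norm_of_nonneg (by positivity)]
    by_cases h0 : lam x = 0
    · rw [h0, Real.zero_rpow (by linarith), zero_mul, zero_mul]
    · refine mul_le_mul_of_nonneg_left ?_ h2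
      exact inv_anti₀ hl0 (by have := hl x h0; linarith)
  have hcrude : ∀ v : ℝ, 0 < v → ∀ b : ℝ, 0 ≤ b → (∀ x, ‖w v x‖ ≤ lam x ^ (u / 2) * b) →
      hform T Z (c v • w v) e ≤ v ^ (a - 1) * b * G := by
    intro v hv b hb hwb
    refine (hform_le_sum_norm T Z _ e).trans ?_
    have hvp := Real.rpow_nonneg hv.le (a - 1)
    refine le_trans ?_ (mul_le_mul_of_nonneg_left hG (by positivity))
    rw [Finset.mul_sum]
    refine Finset.sum_le_sum fun y _ => ?_
    rw [Finset.mul_sum]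
    refine Finset.sum_le_sum fun x _ => ?_
    rw [Pi.smul_apply, smul_eq_mul, norm_mul, hcn v hv]
    calc ‖T y x‖ * (v ^ (a - 1) * ‖w v x‖ * ‖Z x y‖ * ‖e y‖)
        ≤ ‖T y x‖ * (v ^ (a - 1) * (lam x ^ (u / 2) * b) * ‖Z x y‖ * ‖e y‖) := by
          gcongr; exact hwb x
      _ = _ := by ring
  have key := integral_three_scales (φ := fun v => hform T Z (c v • w v) e)
    (q := fun v => v ^ (-u) * hform T Z (w v) (w v)) (a := a) (s := s) (h := h) (B := B) (G := G)
    (G' := G * l⁻¹) (K := K) hInt.1 hi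
    (fun v hv => mul_nonneg (Real.rpow_nonneg hv.le _) (hform_self_nonneg hT hZ _)) hK ha0 ha1 hs0 hB
    (fun v hv => ?_) (fun v hv => ?_) (fun v hv => ?_)
  · rw [hval] at key
    have e1 : h / s * (2 * B) = m * h := by
      simp only [hs]; field_simp
    have e2 : s * K = 2 * (B * K / m) := by
      simp only [hs]; ring
    rw [e1, e2] at key
    linarith
  · have h1 := two_hform_le_weighted hT hZ (c v • w v) e (s := s * v) (by positivity)
    rw [hform_smul_smul (r := v ^ (-u - 1))] at h1
    · have e1 : s * v * (v ^ (-u - 1) * hform T Z (w v) (w v)) =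
          s * (v ^ (-u) * hform T Z (w v) (w v)) := by
        rw [Real.rpow_sub_one hv.ne']; field_simp
      have e2 : hform T Z e e / (s * v) = h / s * v⁻¹ := by
        rw [hh]; field_simp
      rw [e1, e2] at h1
      linarith
    · have h2 : c v * star (c v) = ((‖c v‖ ^ 2 : ℝ) : ℂ) := by
        rw [Complex.star_def, Complex.mul_conj, Complex.normSq_eq_norm_sq]
      rw [h2, hcn v hv, ← Real.rpow_natCast, ← Real.rpow_mul hv.le]
      congr 2
      simp only [ha]; push_cast; ring
  · refine (hcrude v hv v⁻¹ (by positivity) (hwv v hv)).trans_eq ?_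
    rw [← Real.rpow_neg_one v, ← Real.rpow_add hv, mul_comm]
    congr 2; ring
  · refine (hcrude v hv l⁻¹ (by positivity) (hwl v hv)).trans_eq ?_
    ring

end OneShot

section OneShotRotated

variable {κ : Type*} [Fintype κ] [DecidableEq κ]

theorem ker_rp {σ : Matrix κ κ ℂ} (hσ : σ.PosSemidef) {s : ℝ} (hs : s ≠ 0) (v : κ → ℂ)
    (hv : σ.mulVec v = 0) : (rp s σ).mulVec v = 0 := by
  have h := rp_mul hσ (s := s - 1) (t := 1) (by simpa using hs)
  rw [rp_one hσ.1, sub_add_cancel] at h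
  rw [← h, ← Matrix.mulVec_mulVec, hv, Matrix.mulVec_zero]

theorem ker_rp_Xs {p : ℝ} (hp : 1 < p) {ρ σ : Matrix κ κ ℂ} (hρ : ρ.PosSemidef)
    (hσ : σ.PosSemidef) (v : κ → ℂ) (hv : σ.mulVec v = 0) : (rp p (Xs p ρ σ)).mulVec v = 0 := by
  refine ker_rp (Xs_posSemidef p hρ hσ) (by linarith) v ?_
  rw [Xs, ← Matrix.mulVec_mulVec, ker_rp hσ ?_ v hv, Matrix.mulVec_zero]
  exact div_ne_zero (by linarith) (by linarith)

theorem ker_tpowG {ρ σ : Matrix κ κ ℂ} (hρ : ρ.IsHermitian) (hσ : σ.IsHermitian)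
    (hk : ∀ v, σ.mulVec v = 0 → ρ.mulVec v = 0) (n : ℕ) (v : (Fin n → κ) → ℂ)
    (hv : (tpowG σ n).mulVec v = 0) : (tpowG ρ n).mulVec v = 0 := by
  have h1 : fc (fun x => ((x⁻¹ * x : ℝ) : ℂ)) σ * ρ = ρ :=
    supp_mul (exists_diag hσ) hρ hk fun x hx => by rw [inv_mul_cancel₀ hx, Complex.ofReal_one]
  have h2 : ρ = ρ * fc (fun x => ((x⁻¹ : ℝ) : ℂ)) σ * σ := by
    have h4 : fc (fun x => ((x⁻¹ : ℝ) : ℂ)) σ * σ = fc (fun x => ((x⁻¹ * x : ℝ) : ℂ)) σ := by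
      conv_lhs => rw [← fc_id hσ, fc_fc hσ, fc_mul hσ]
      simp
    rw [Matrix.mul_assoc, h4]
    have h3 := congrArg Matrix.conjTranspose h1
    rw [Matrix.conjTranspose_mul, hρ.eq, (fc_isHermitian _ hσ).eq] at h3
    exact h3.symm
  rw [h2, ← tpowG_mul, ← Matrix.mulVec_mulVec, hv, Matrix.mulVec_zero]

theorem rtr_conj_diag {V : Matrix κ κ ℂ} (τ Y : Matrix κ κ ℂ) (w e : κ → ℂ) :
    rtr (τ * (V * (Matrix.diagonal w * (V.conjTranspose * Y * V) *
      (Matrix.diagonal e).conjTranspose) * V.conjTranspose)) =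
    hform (V.conjTranspose * τ * V) (V.conjTranspose * Y * V) w e := by
  rw [hform, ← Matrix.mul_assoc, rtr_mul_comm]
  simp only [Matrix.mul_assoc]

theorem rtr_rotated_eq_hform (p : ℝ) {ρ σ V : Matrix κ κ ℂ} {lam : κ → ℝ} (hσ : σ.PosSemidef)
    (hd : Diag σ V lam) (τ : Matrix κ κ ℂ) (t : ℝ) :
    rtr (τ * rotated p ρ σ t) =
      hform (V.conjTranspose * τ * V) (V.conjTranspose * rp p (Xs p ρ σ) * V)
        (fun x => pw (-((1 : ℂ) + Complex.I * (t : ℂ)) / 2) (lam x))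
        (fun x => pw (-((1 : ℂ) + Complex.I * (t : ℂ)) / 2) (lam x)) := by
  rw [← rtr_conj_diag, rotated, mpow_conj_half hσ, mpow_eq_fc, hd.fc_eq]
  simp only [Matrix.mul_assoc, Matrix.conjTranspose_mul, Matrix.conjTranspose_conjTranspose]

theorem rtr_gradient_eq_hform {σ V : Matrix κ κ ℂ} {lam : κ → ℝ} (hd : Diag σ V lam)
    (s t : ℝ) (τ Y : Matrix κ κ ℂ) :
    rtr (τ * (resl t σ * (rp s σ * Y * rp s σ) * resl t σ)) =
      hform (V.conjTranspose * τ * V) (V.conjTranspose * Y * V)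
        (fun x => ((lam x ^ s * (t + lam x)⁻¹ : ℝ) : ℂ))
        (fun x => ((lam x ^ s * (t + lam x)⁻¹ : ℝ) : ℂ)) := by
  have h1 : resl t σ * rp s σ = fc (fun x => ((x ^ s * (t + x)⁻¹ : ℝ) : ℂ)) σ := by
    rw [resl, rp, hd.fc_mul]
    refine hd.fc_congr fun i => ?_
    push_cast; ring
  have h2 : rp s σ * resl t σ = (fc (fun x => ((x ^ s * (t + x)⁻¹ : ℝ) : ℂ)) σ).conjTranspose := by
    rw [(fc_isHermitian _ hd.isHermitian).eq, resl, rp, hd.fc_mul]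
    refine hd.fc_congr fun i => ?_
    push_cast; ring
  rw [← rtr_conj_diag]
  have e : resl t σ * (rp s σ * Y * rp s σ) * resl t σ =
      (resl t σ * rp s σ) * Y * (rp s σ * resl t σ) := by simp only [Matrix.mul_assoc]
  rw [e, h1, h2, hd.fc_eq]
  simp only [Matrix.mul_assoc, Matrix.conjTranspose_mul, Matrix.conjTranspose_conjTranspose]

theorem norm_mul_rtr_rotated_le {p u J : ℝ} (hp : 1 < p) (hu : u = (p - 1) / p)
    (hJ : IsInvConst u J) {ρ σ τ V : Matrix κ κ ℂ} {lam : κ → ℝ} (hρ : ρ.PosSemidef)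
    (hσ : σ.PosSemidef) (hτ : τ.PosSemidef) (hk : ∀ v, σ.mulVec v = 0 → ρ.mulVec v = 0)
    (hmin : ∀ ε : ℝ, 0 < ε → ε < 1 →
      Qsand p ρ σ ≤ Qsand p ρ (((1 - ε : ℝ) : ℂ) • σ + ((ε : ℝ) : ℂ) • τ))
    (hd : Diag σ V lam) (hlam : ∀ x, 0 ≤ lam x) {l G B θ : ℝ} (hl0 : 0 < l)
    (hl : ∀ x, lam x ≠ 0 → l ≤ lam x) (hB : 0 < B)
    (hG : ∑ y, ∑ x, ‖(V.conjTranspose * τ * V) y x‖ * (lam x ^ (u / 2) *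
      ‖(V.conjTranspose * rp p (Xs p ρ σ) * V) x y‖ *
      ‖pw (-((1 : ℂ) + Complex.I * (θ : ℂ)) / 2) (lam y)‖) ≤ G) :
    ‖mellinInv (mellinExp u θ)‖ * rtr (τ * rotated p ρ σ θ) ≤
      2 * (B * (J * u * Qsand p ρ σ) / ‖mellinInv (mellinExp u θ)‖ +
        G * (Real.exp (-(B * (1 - (1 - u) / 2))) / (1 - (1 - u) / 2)) +
        G * l⁻¹ * (Real.exp (-(B * ((1 - u) / 2))) / ((1 - u) / 2))) := by
  have hu0 : 0 < u := by rw [hu]; exact div_pos (by linarith) (by linarith)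
  have hu1 : u < 1 := by rw [hu, div_lt_one (by linarith)]; linarith
  have hY := rp_posSemidef (Xs_posSemidef p hρ hσ) p
  obtain ⟨h1, h2⟩ := first_order hp hu hJ hρ hσ hτ hk hmin
  simp only [rtr_gradient_eq_hform hd] at h1 h2
  rw [rtr_rotated_eq_hform p hσ hd]
  exact norm_mul_hform_le hu0 hu1 (hτ.conjTranspose_mul_mul_same V)
    (hY.conjTranspose_mul_mul_same V) hlam
    (fun x y hx => kernel_diag hd hY.1 (ker_rp_Xs hp hρ hσ) x y hx) h1 h2 hl0 hl hB hG

theorem rotated_tpowG (p : ℝ) {ρ σ : Matrix κ κ ℂ} (hρ : ρ.PosSemidef) (hσ : σ.PosSemidef) (t : ℝ)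
    (n : ℕ) : rotated p (tpowG ρ n) (tpowG σ n) t = tpowG (rotated p ρ σ t) n := by
  obtain ⟨V, lam, hd, hlam⟩ := exists_diag_psd hσ
  rw [tpowG_rotated p hσ hd hlam, rotated, mpow_conj_half (tpowG_posSemidef hσ n), mpow_eq_fc,
    (hd.tens n).fc_eq, Xs_tpowG p hσ, rp_tpowG (Xs_posSemidef p hρ hσ), ← tpowG_mul, ← tpowG_mul,
    tpowG_conjTranspose]
  simp only [Matrix.mul_assoc, Matrix.conjTranspose_mul, Matrix.conjTranspose_conjTranspose,
    tpowG_conjTranspose]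

theorem rtr_tpowG_mul {A M : Matrix κ κ ℂ} (hA : A.IsHermitian) (hM : M.PosSemidef) (n : ℕ) :
    rtr (tpowG A n * tpowG M n) = rtr (A * M) ^ n := by
  have hH := rp_isHermitian hM.1 (1 / 2)
  have h := rp_mul hM (s := 1 / 2) (t := 1 / 2) (by norm_num)
  rw [show (1 / 2 : ℝ) + 1 / 2 = 1 by norm_num, rp_one hM.1] at h
  have h2 : (rp (1 / 2) M * A * rp (1 / 2) M).IsHermitian := by
    rw [Matrix.IsHermitian, Matrix.conjTranspose_mul, Matrix.conjTranspose_mul, hH.eq, hA.eq,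
      Matrix.mul_assoc]
  have e : rtr (A * M) = rtr (rp (1 / 2) M * A * rp (1 / 2) M) := by
    nth_rw 1 [← h]
    rw [rtr_mul_comm, Matrix.mul_assoc, rtr_mul_comm]
  have e2 : rtr (tpowG A n * tpowG M n) = rtr (tpowG (rp (1 / 2) M * A * rp (1 / 2) M) n) := by
    rw [← tpowG_mul, ← tpowG_mul]
    nth_rw 1 [← h]
    rw [← tpowG_mul, rtr_mul_comm, Matrix.mul_assoc, rtr_mul_comm]
  rw [e, e2, rtr_tpowG h2]

end OneShotRotated

section ManyCopies

variable {κ : Type*} [Fintype κ] [DecidableEq κ]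

theorem le_of_pow_le_linear_mul_pow {x q c₁ c₂ : ℝ} (hq : 0 < q)
    (h : ∀ N : ℕ, 1 ≤ N → x ^ N ≤ (c₁ * N + c₂) * q ^ N) : x ≤ q := by
  by_contra hx
  push Not at hx
  set y := x / q with hy
  have hy1 : 1 < y := (one_lt_div hq).2 hx
  have h1 := (tendsto_pow_const_div_const_pow_of_one_lt 1 hy1).const_mul c₁
  have h0 := (tendsto_pow_const_div_const_pow_of_one_lt 0 hy1).const_mul c₂
  have h2 := h1.add h0
  rw [mul_zero, mul_zero, add_zero] at h2
  obtain ⟨N, hN, hlt⟩ := ((eventually_ge_atTop 1).and (h2.eventually_lt_const one_pos)).exists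
  have h3 := h N hN
  have hyN : 0 < y ^ N := by positivity
  rw [pow_zero, pow_one, ← mul_div_assoc, ← mul_div_assoc, ← add_div, mul_one,
    div_lt_one hyN] at hlt
  have h4 : x ^ N = y ^ N * q ^ N := by
    rw [← mul_pow, hy, div_mul_cancel₀ _ hq.ne']
  rw [h4] at h3
  have := le_of_mul_le_mul_right h3 (by positivity)
  linarith

theorem exists_pos_le_of_ne_zero {lam : κ → ℝ} (hlam : ∀ x, 0 ≤ lam x) :
    ∃ l : ℝ, 0 < l ∧ l ≤ 1 ∧ ∀ x, lam x ≠ 0 → l ≤ lam x := by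
  have h : ∀ s : Finset κ, ∃ l : ℝ, 0 < l ∧ l ≤ 1 ∧ ∀ x ∈ s, lam x ≠ 0 → l ≤ lam x := by
    intro s
    induction s using Finset.induction_on with
    | empty => exact ⟨1, one_pos, le_rfl, by simp⟩
    | insert a s ha ih =>
      obtain ⟨l, h0, h1, h2⟩ := ih
      by_cases h : lam a = 0
      · refine ⟨l, h0, h1, fun x hx hx0 => ?_⟩
        rcases Finset.mem_insert.1 hx with rfl | hx
        · exact absurd h hx0
        · exact h2 x hx hx0
      · refine ⟨min l (lam a), lt_min h0 (lt_of_le_of_ne (hlam a) (Ne.symm h)),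
          (min_le_left _ _).trans h1, fun x hx hx0 => ?_⟩
        rcases Finset.mem_insert.1 hx with rfl | hx
        · exact min_le_right _ _
        · exact (min_le_left _ _).trans (h2 x hx hx0)
  obtain ⟨l, h0, h1, h2⟩ := h Finset.univ
  exact ⟨l, h0, h1, fun x => h2 x (Finset.mem_univ x)⟩

theorem sum_sum_prod_fun {n : ℕ} (f : κ → κ → ℝ) :
    ∑ y : Fin n → κ, ∑ x : Fin n → κ, ∏ i, f (y i) (x i) = (∑ y, ∑ x, f y x) ^ n := by
  have h1 : ∀ y : Fin n → κ, ∑ x : Fin n → κ, ∏ i, f (y i) (x i) = ∏ i, ∑ x, f (y i) x :=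
    fun y => sum_prod_fun fun i => f (y i)
  simp only [h1]
  rw [sum_prod_fun fun _ y => ∑ x, f y x]
  simp

theorem exists_mul_exp_le (G : ℝ) {c q : ℝ} (hc : 0 < c) (hq : 0 < q) :
    ∃ L : ℝ, 0 < L ∧ G * Real.exp (-(L * c)) ≤ q := by
  have h1 : Tendsto (fun L : ℝ => L * c) atTop atTop := tendsto_id.atTop_mul_const hc
  have h2 := (Real.tendsto_exp_neg_atTop_nhds_zero.comp h1).const_mul G
  rw [mul_zero] at h2
  obtain ⟨L, hL, h⟩ := ((eventually_gt_atTop (0 : ℝ)).and (h2.eventually_le_const hq)).exists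
  exact ⟨L, hL, h⟩

/-- Optimality of all tensor powers of `σ` along the segments towards tensor powers of `τ` gives
the rotated trace inequality. -/
theorem rtr_rotated_le_of_tensor_min {p : ℝ} (hp : 1 < p) {ρ σ τ : Matrix κ κ ℂ}
    (hρ : ρ.PosSemidef) (hσ : σ.PosSemidef) (hτ : τ.PosSemidef)
    (hk : ∀ v, σ.mulVec v = 0 → ρ.mulVec v = 0) (hQ : 0 < Qsand p ρ σ)
    (hmin : ∀ N : ℕ, 1 ≤ N → ∀ ε : ℝ, 0 < ε → ε < 1 → Qsand p ρ σ ^ N ≤ Qsand p (tpowG ρ N)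
      (((1 - ε : ℝ) : ℂ) • tpowG σ N + ((ε : ℝ) : ℂ) • tpowG τ N)) (θ : ℝ) :
    rtr (τ * rotated p ρ σ θ) ≤ Qsand p ρ σ := by
  set u := (p - 1) / p with hu
  have hu0 : 0 < u := by rw [hu]; exact div_pos (by linarith) (by linarith)
  have hu1 : u < 1 := by rw [hu, div_lt_one (by linarith)]; linarith
  obtain ⟨J, hJ⟩ := exists_isInvConst hu0 hu1
  obtain ⟨V, lam, hd, hlam⟩ := exists_diag_psd hσ
  obtain ⟨l, hl0, hl1, hl⟩ := exists_pos_le_of_ne_zero hlam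
  set m := ‖mellinInv (mellinExp u θ)‖ with hm
  set a := (1 - u) / 2 with ha
  have ha0 : 0 < a := by simp only [ha]; linarith
  have ha1 : 0 < 1 - a := by simp only [ha]; linarith
  have hm0 : 0 < m := by
    refine norm_pos_iff.2 (mellinInv_convergent ?_ ?_).2
    · rw [mellinExp_re]; exact ha0
    · rw [mellinExp_re]; linarith
  set Q := Qsand p ρ σ with hQd
  set f : κ → κ → ℝ := fun y x => ‖(V.conjTranspose * τ * V) y x‖ * (lam x ^ (u / 2) *
      ‖(V.conjTranspose * rp p (Xs p ρ σ) * V) x y‖ *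
      ‖pw (-((1 : ℂ) + Complex.I * (θ : ℂ)) / 2) (lam y)‖) with hf
  have hf0 : ∀ y x, 0 ≤ f y x := fun y x => by
    have := Real.rpow_nonneg (hlam x) (u / 2)
    positivity
  set G := ∑ y, ∑ x, f y x with hG
  have hG0 : 0 ≤ G := Finset.sum_nonneg fun y _ => Finset.sum_nonneg fun x _ => hf0 y x
  set c := min a (1 - a) with hc
  have hc0 : 0 < c := lt_min ha0 ha1
  obtain ⟨L, hL0, hL⟩ := exists_mul_exp_le (G * l⁻¹) hc0 hQ
  have hl' : 1 ≤ l⁻¹ := (one_le_inv₀ hl0).2 hl1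
  have hL1 : G * Real.exp (-(L * (1 - a))) ≤ Q := by
    refine le_trans ?_ hL
    have h1 : Real.exp (-(L * (1 - a))) ≤ Real.exp (-(L * c)) :=
      Real.exp_le_exp.2 (neg_le_neg (mul_le_mul_of_nonneg_left (min_le_right _ _) hL0.le))
    exact mul_le_mul (le_mul_of_one_le_right hG0 hl') h1 (Real.exp_pos _).le (by positivity)
  have hL2 : G * l⁻¹ * Real.exp (-(L * a)) ≤ Q := by
    refine le_trans ?_ hL
    refine mul_le_mul_of_nonneg_left ?_ (by positivity)
    exact Real.exp_le_exp.2 (neg_le_neg (mul_le_mul_of_nonneg_left (min_le_left _ _) hL0.le))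
  refine le_of_pow_le_linear_mul_pow (c₁ := 2 / m * (L * (J * u) / m))
    (c₂ := 2 / m * (1 / (1 - a) + 1 / a)) hQ fun N hN => ?_
  have hN0 : (0 : ℝ) < N := by exact_mod_cast hN
  have hGN : ∑ y : Fin N → κ, ∑ x : Fin N → κ,
      ‖((tpowG V N).conjTranspose * tpowG τ N * tpowG V N) y x‖ *
      ((∏ i, lam (x i)) ^ (u / 2) *
      ‖((tpowG V N).conjTranspose * rp p (Xs p (tpowG ρ N) (tpowG σ N)) * tpowG V N) x y‖ *
      ‖pw (-((1 : ℂ) + Complex.I * (θ : ℂ)) / 2) (∏ i, lam (y i))‖) ≤ G ^ N := by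
    refine le_of_eq ?_
    rw [hG, ← sum_sum_prod_fun]
    refine Finset.sum_congr rfl fun y _ => Finset.sum_congr rfl fun x _ => ?_
    rw [Xs_tpowG p hσ, rp_tpowG (Xs_posSemidef p hρ hσ), tpowG_conjTranspose, tpowG_mul, tpowG_mul,
      tpowG_mul, tpowG_mul, pw_prod _ _ _ fun i => hlam _, tpowG_apply, tpowG_apply, norm_prod,
      norm_prod, norm_prod, ← Real.finsetProd_rpow _ _ fun i _ => hlam _]
    simp only [hf, Finset.prod_mul_distrib]
  have key := norm_mul_rtr_rotated_le (θ := θ) (l := l ^ N) (G := G ^ N) (B := N * L) hp hu hJ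
    (tpowG_posSemidef hρ N) (tpowG_posSemidef hσ N) (tpowG_posSemidef hτ N)
    (ker_tpowG hρ.1 hσ.1 hk N)
    (by rw [Qsand_tpowG hp hρ hσ]; exact hmin N hN) (hd.tens N)
    (fun x => Finset.prod_nonneg fun i _ => hlam _) (by positivity)
    (fun x hx => by
      rw [Finset.prod_ne_zero_iff] at hx
      calc l ^ N = ∏ i : Fin N, l := by simp
        _ ≤ _ := Finset.prod_le_prod (fun i _ => hl0.le) fun i hi => hl _ (hx i hi))
    (by positivity) hGN
  rw [rotated_tpowG p hρ hσ, rtr_tpowG_mul hτ.1 (rotated_posSemidef p hρ hσ θ),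
    Qsand_tpowG hp hρ hσ, ← hm, ← ha, ← hQd] at key
  have k1 : G ^ N * Real.exp (-(N * L * (1 - a))) ≤ Q ^ N := by
    have h1 : Real.exp (-(N * L * (1 - a))) = Real.exp (-(L * (1 - a))) ^ N := by
      rw [← Real.exp_nat_mul]; congr 1; ring
    rw [h1, ← mul_pow]
    exact pow_le_pow_left₀ (by positivity) hL1 N
  have k2 : G ^ N * (l ^ N)⁻¹ * Real.exp (-(N * L * a)) ≤ Q ^ N := by
    have h1 : Real.exp (-(N * L * a)) = Real.exp (-(L * a)) ^ N := by
      rw [← Real.exp_nat_mul]; congr 1; ring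
    rw [h1, ← inv_pow, ← mul_pow, ← mul_pow]
    exact pow_le_pow_left₀ (by positivity) hL2 N
  have k1' := div_le_div_of_nonneg_right k1 ha1.le
  have k2' := div_le_div_of_nonneg_right k2 ha0.le
  rw [mul_div_assoc] at k1' k2'
  have k3 : m * rtr (τ * rotated p ρ σ θ) ^ N ≤
      2 * (N * L * (J * u * Q ^ N) / m + Q ^ N / (1 - a) + Q ^ N / a) := by linarith
  rw [mul_comm, ← le_div_iff₀ hm0] at k3
  refine k3.trans_eq ?_
  have := hm0.ne'
  have := ha0.ne'
  have := ha1.ne'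
  field_simp
  ring

end ManyCopies

section Commuting

variable {κ : Type*} [Fintype κ] [DecidableEq κ]

theorem mul_Xs_comm (p : ℝ) {ρ σ : Matrix κ κ ℂ} (hσ : σ.PosSemidef) (h : ρ * σ = σ * ρ) :
    σ * Xs p ρ σ = Xs p ρ σ * σ := by
  have h1 : Commute σ (rp ((1 - p) / (2 * p)) σ) := (fc_intertwine hσ.1 hσ.1 (M := σ) rfl _).symm
  have h2 : Commute σ ρ := h.symm
  exact (h1.mul_right h2).mul_right h1

theorem diagonal_mul_conj_comm {σ V Y : Matrix κ κ ℂ} {lam : κ → ℝ} (hd : Diag σ V lam)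
    (h : σ * Y = Y * σ) :
    Matrix.diagonal (fun i => (lam i : ℂ)) * (V.conjTranspose * Y * V) =
      (V.conjTranspose * Y * V) * Matrix.diagonal (fun i => (lam i : ℂ)) := by
  rw [← hd.conj_eq]
  calc _ = V.conjTranspose * (σ * (V * V.conjTranspose) * Y) * V := by simp only [Matrix.mul_assoc]
    _ = V.conjTranspose * (Y * (V * V.conjTranspose) * σ) * V := by
      rw [hd.r, Matrix.mul_one, Matrix.mul_one, h]
    _ = _ := by simp only [Matrix.mul_assoc]

theorem eq_zero_of_diagonal_comm {Z : Matrix κ κ ℂ} {lam : κ → ℝ}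
    (h : Matrix.diagonal (fun i => (lam i : ℂ)) * Z = Z * Matrix.diagonal (fun i => (lam i : ℂ)))
    {x y : κ} (hxy : lam x ≠ lam y) : Z x y = 0 := by
  have h1 := congrFun (congrFun h x) y
  rw [Matrix.diagonal_mul, Matrix.mul_diagonal, mul_comm, ← sub_eq_zero, ← mul_sub] at h1
  exact (mul_eq_zero.1 h1).resolve_right (sub_ne_zero.2 (by exact_mod_cast hxy))

theorem hform_of_comm {T Z : Matrix κ κ ℂ} {lam : κ → ℝ}
    (hc : ∀ x y, lam x ≠ lam y → Z x y = 0) (F : ℝ → ℂ) :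
    hform T Z (fun x => F (lam x)) (fun x => F (lam x)) =
      ∑ x, (∑ y, (T y x * Z x y).re) * ‖F (lam x)‖ ^ 2 := by
  rw [hform_eq_sum, Finset.sum_comm]
  refine Finset.sum_congr rfl fun x _ => ?_
  rw [Finset.sum_mul]
  refine Finset.sum_congr rfl fun y _ => ?_
  by_cases hxy : lam x = lam y
  · rw [← hxy, ← Complex.re_mul_ofReal]
    congr 1
    have : F (lam x) * star (F (lam x)) = ((‖F (lam x)‖ ^ 2 : ℝ) : ℂ) := by
      rw [Complex.star_def, Complex.mul_conj, Complex.normSq_eq_norm_sq]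
    rw [← this]; ring
  · simp [hc x y hxy]

theorem sum_mul_nonneg_of_comm {T Z : Matrix κ κ ℂ} (hT : T.PosSemidef) (hZ : Z.PosSemidef)
    {lam : κ → ℝ} (hc : ∀ x y, lam x ≠ lam y → Z x y = 0) {H : ℝ → ℝ} (hH : ∀ x, 0 ≤ H (lam x)) :
    0 ≤ ∑ x, (∑ y, (T y x * Z x y).re) * H (lam x) := by
  have h := hform_of_comm (T := T) hc fun x => ((√(H x) : ℝ) : ℂ)
  have h2 := hform_self_nonneg hT hZ fun x => ((√(H (lam x)) : ℝ) : ℂ)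
  rw [h] at h2
  convert h2 using 3 with x
  rw [Complex.norm_real, Real.norm_of_nonneg (Real.sqrt_nonneg _), Real.sq_sqrt (hH x)]

theorem norm_pw_sq {x : ℝ} (hx : 0 ≤ x) (t : ℝ) :
    ‖pw (-((1 : ℂ) + Complex.I * (t : ℂ)) / 2) x‖ ^ 2 = x⁻¹ := by
  have h1 : -(Complex.I * ((Real.log x / 2 : ℝ) : ℂ) * (t : ℂ)) =
      ((-(Real.log x / 2 * t) : ℝ) : ℂ) * Complex.I := by
    push_cast; ring
  rw [pw_neg_half hx, norm_mul, h1, Complex.norm_exp_ofReal_mul_I, mul_one, Complex.norm_real,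
    Real.norm_of_nonneg (Real.rpow_nonneg hx _)]
  rcases hx.eq_or_lt with h | h
  · subst h; simp [Real.zero_rpow]
  · rw [← Real.rpow_natCast, ← Real.rpow_mul hx, ← Real.rpow_neg_one]
    norm_num

theorem IsInvConst.integral_mul {u J : ℝ} (hJ : IsInvConst u J) {ε x : ℝ} (hε : 0 < ε)
    (hx : 0 < x) :
    IntegrableOn (fun t : ℝ => t ^ (-u) * (x ^ u * (t + x)⁻¹ * (t + (1 + ε) * x)⁻¹)) (Set.Ioi 0) ∧
      ∫ t in Set.Ioi (0 : ℝ), t ^ (-u) * (x ^ u * (t + x)⁻¹ * (t + (1 + ε) * x)⁻¹) =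
        x⁻¹ * ((1 - (1 + ε) ^ (-u)) / ε * J) := by
  have h1 := hJ.2 x hx
  have h2 := hJ.2 ((1 + ε) * x) (by positivity)
  have e : ∀ t ∈ Set.Ioi (0 : ℝ), t ^ (-u) * (x ^ u * (t + x)⁻¹ * (t + (1 + ε) * x)⁻¹) =
      x ^ u * (ε * x)⁻¹ * (t ^ (-u) * (t + x)⁻¹ - t ^ (-u) * (t + (1 + ε) * x)⁻¹) := by
    intro t ht
    have ht' : 0 < t := ht
    have a1 : t + x ≠ 0 := by positivity
    have a2 : t + (1 + ε) * x ≠ 0 := by positivity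
    field_simp
    ring
  refine ⟨(integrableOn_congr_fun e measurableSet_Ioi).2 ((h1.1.sub h2.1).const_mul _), ?_⟩
  rw [setIntegral_congr_fun measurableSet_Ioi e, integral_const_mul, integral_sub h1.1 h2.1, h1.2,
    h2.2, Real.mul_rpow (by positivity) hx.le, Real.rpow_neg hx.le]
  have := (Real.rpow_pos_of_pos hx u).ne'
  field_simp

theorem le_of_forall_sub_rpow_le {g Q u : ℝ} (hu : 0 < u)
    (h : ∀ ε : ℝ, 0 < ε → g * ((1 - (1 + ε) ^ (-u)) / ε) ≤ u * Q) : g ≤ Q := by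
  have h1 : HasDerivAt (fun x : ℝ => x ^ (-u)) (-u * 1 ^ (-u - 1)) 1 :=
    Real.hasDerivAt_rpow_const (Or.inl one_ne_zero)
  have h2 := h1.tendsto_slope_zero_right
  have h3 : Tendsto (fun ε : ℝ => g * ((1 - (1 + ε) ^ (-u)) / ε)) (nhdsWithin 0 (Set.Ioi 0))
      (nhds (g * u)) := by
    have h4 := h2.neg.const_mul g
    simp only [Real.one_rpow, mul_one, neg_neg] at h4
    refine h4.congr fun ε => ?_
    rw [smul_eq_mul]
    ring
  have h5 : g * u ≤ u * Q :=
    le_of_tendsto h3 (eventually_nhdsWithin_of_forall fun ε hε => h ε hε)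
  rw [mul_comm] at h5
  exact le_of_mul_le_mul_left h5 hu

/-- In the commuting case first order optimality already gives the rotated trace inequality. -/
theorem rtr_rotated_le_of_comm {p : ℝ} (hp : 1 < p) {ρ σ τ : Matrix κ κ ℂ}
    (hρ : ρ.PosSemidef) (hσ : σ.PosSemidef) (hτ : τ.PosSemidef) (hcomm : ρ * σ = σ * ρ)
    (hk : ∀ v, σ.mulVec v = 0 → ρ.mulVec v = 0)
    (hmin : ∀ ε : ℝ, 0 < ε → ε < 1 →
      Qsand p ρ σ ≤ Qsand p ρ (((1 - ε : ℝ) : ℂ) • σ + ((ε : ℝ) : ℂ) • τ)) (θ : ℝ) :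
    rtr (τ * rotated p ρ σ θ) ≤ Qsand p ρ σ := by
  set u := (p - 1) / p with hu
  have hu0 : 0 < u := by rw [hu]; exact div_pos (by linarith) (by linarith)
  have hu1 : u < 1 := by rw [hu, div_lt_one (by linarith)]; linarith
  obtain ⟨J, hJ⟩ := exists_isInvConst hu0 hu1
  obtain ⟨V, lam, hd, hlam⟩ := exists_diag_psd hσ
  have hX := Xs_posSemidef p hρ hσ
  have hY := rp_posSemidef hX p
  obtain ⟨h1, h2⟩ := first_order hp hu hJ hρ hσ hτ hk hmin
  simp only [rtr_gradient_eq_hform hd] at h1 h2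
  rw [rtr_rotated_eq_hform p hσ hd]
  set T := V.conjTranspose * τ * V with hT
  set Z := V.conjTranspose * rp p (Xs p ρ σ) * V with hZ
  have hTp : T.PosSemidef := hτ.conjTranspose_mul_mul_same V
  have hZp : Z.PosSemidef := hY.conjTranspose_mul_mul_same V
  have hc : ∀ x y, lam x ≠ lam y → Z x y = 0 := fun x y hxy =>
    eq_zero_of_diagonal_comm (diagonal_mul_conj_comm hd
      (fc_intertwine hX.1 hX.1 (mul_Xs_comm p hσ hcomm).symm _).symm) hxy
  have hZ0 : ∀ x, lam x = 0 → ∑ y, (T y x * Z x y).re = 0 := fun x hx =>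
    Finset.sum_eq_zero fun y _ => by
      have h0 : Z x y = 0 := kernel_diag hd hY.1 (ker_rp_Xs hp hρ hσ) x y hx
      rw [h0, mul_zero, Complex.zero_re]
  have hform_e := hform_of_comm (T := T) hc (pw (-((1 : ℂ) + Complex.I * (θ : ℂ)) / 2))
  have hform_w := fun t : ℝ => hform_of_comm (T := T) hc
    (fun x => ((x ^ (u / 2) * (t + x)⁻¹ : ℝ) : ℂ))
  simp only [norm_pw_sq (hlam _)] at hform_e
  simp only [hform_w] at h1 h2
  rw [hform_e]
  set β : κ → ℝ := fun x => ∑ y, (T y x * Z x y).re with hβ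
  refine le_of_forall_sub_rpow_le hu0 fun ε hε => ?_
  have hx : ∀ x, IntegrableOn (fun t : ℝ => β x *
      (t ^ (-u) * (lam x ^ u * (t + lam x)⁻¹ * (t + (1 + ε) * lam x)⁻¹))) (Set.Ioi 0) ∧
      ∫ t in Set.Ioi (0 : ℝ), β x *
        (t ^ (-u) * (lam x ^ u * (t + lam x)⁻¹ * (t + (1 + ε) * lam x)⁻¹)) =
        β x * ((lam x)⁻¹ * ((1 - (1 + ε) ^ (-u)) / ε * J)) := by
    intro x
    rcases (hlam x).eq_or_lt with h | h
    · simp only [hβ, hZ0 x h.symm, zero_mul]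
      exact ⟨integrableOn_zero, by simp⟩
    · have := hJ.integral_mul hε h
      exact ⟨this.1.const_mul _, by rw [integral_const_mul, this.2]⟩
  have hlow : ∫ t in Set.Ioi (0 : ℝ), ∑ x, β x *
      (t ^ (-u) * (lam x ^ u * (t + lam x)⁻¹ * (t + (1 + ε) * lam x)⁻¹)) ≤ J * u * Qsand p ρ σ := by
    refine le_trans (setIntegral_mono_on (integrable_finsetSum _ fun x _ => (hx x).1) h1
      measurableSet_Ioi fun t ht => ?_) h2
    have ht' : 0 < t := ht
    have hpos := sum_mul_nonneg_of_comm hTp hZp hc (H := fun x =>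
      ‖((x ^ (u / 2) * (t + x)⁻¹ : ℝ) : ℂ)‖ ^ 2 - x ^ u * (t + x)⁻¹ * (t + (1 + ε) * x)⁻¹)
      (fun x => ?_)
    · have htu := Real.rpow_nonneg ht'.le (-u)
      have h3 := mul_nonneg htu hpos
      simp only [mul_sub, Finset.sum_sub_distrib] at h3
      rw [sub_nonneg] at h3
      refine le_trans (le_of_eq ?_) h3
      rw [Finset.mul_sum]
      exact Finset.sum_congr rfl fun x _ => by simp only [hβ]; ring
    · have hl := hlam x
      have hlu := Real.rpow_nonneg hl u
      have hsq : (lam x ^ (u / 2)) ^ 2 = lam x ^ u := by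
        rw [← Real.rpow_natCast, ← Real.rpow_mul hl]
        norm_num
      rw [sub_nonneg, Complex.norm_real, Real.norm_eq_abs, sq_abs, mul_pow, hsq, mul_assoc, sq]
      gcongr
      nlinarith
  rw [integral_finsetSum _ fun x _ => (hx x).1, Finset.sum_congr rfl fun x _ => (hx x).2] at hlow
  have e : ∑ x, β x * ((lam x)⁻¹ * ((1 - (1 + ε) ^ (-u)) / ε * J)) =
      J * ((∑ x, β x * (lam x)⁻¹) * ((1 - (1 + ε) ^ (-u)) / ε)) := by
    rw [Finset.sum_mul, Finset.mul_sum]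
    exact Finset.sum_congr rfl fun x _ => by ring
  rw [e, mul_assoc] at hlow
  exact le_of_mul_le_mul_left hlow hJ.1

end Commuting

section SingleLetter

variable {d : ℕ} {ρ : Matrix (Fin d) (Fin d) ℂ}
  {S : (n : ℕ) → Set (Matrix (Fin n → Fin d) (Fin n → Fin d) ℂ)}

theorem tpow_posSemidef (hρ : ρ.PosSemidef) (n : ℕ) : (tpow ρ n).PosSemidef := by
  rw [tpow_eq_tpowG]; exact tpowG_posSemidef hρ n

theorem tpow_ne_zero (hρ : IsState ρ) (n : ℕ) : tpow ρ n ≠ 0 := by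
  intro h
  have h1 : (tpow ρ n).trace = 1 := by
    rw [tpow_eq_tpowG, tpowG_trace, hρ.2, one_pow]
  rw [h, Matrix.trace_zero] at h1
  exact zero_ne_one h1

theorem nonempty_of_isState (hρ : IsState ρ) (n : ℕ) : Nonempty (Fin n → Fin d) := by
  have : Nonempty (Fin d) := by
    by_contra h
    rw [not_nonempty_iff] at h
    have h1 := hρ.2
    rw [Matrix.trace, Fintype.sum_empty] at h1
    exact zero_ne_one h1
  infer_instance

theorem Assumption1.mix_mem (hS : Assumption1 S) {n : ℕ} (hn : 1 ≤ n)
    {A B : Matrix (Fin n → Fin d) (Fin n → Fin d) ℂ} (hA : A ∈ S n) (hB : B ∈ S n) {ε : ℝ}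
    (h0 : 0 < ε) (h1 : ε < 1) : ((1 - ε : ℝ) : ℂ) • A + ((ε : ℝ) : ℂ) • B ∈ S n := by
  have h := hS.convex n hn hA hB (a := 1 - ε) (b := ε) (by linarith) h0.le (by ring)
  simpa only [Complex.coe_smul] using h

theorem ker_mix {κ : Type*} [Fintype κ] [DecidableEq κ] {ρ σ τ : Matrix κ κ ℂ}
    (hσ : σ.PosSemidef) (hτ : τ.PosSemidef) (hk : ∀ v, σ.mulVec v = 0 → ρ.mulVec v = 0) {ε : ℝ}
    (h0 : 0 < ε) (h1 : ε < 1) (v : κ → ℂ)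
    (hv : (((1 - ε : ℝ) : ℂ) • σ + ((ε : ℝ) : ℂ) • τ).mulVec v = 0) : ρ.mulVec v = 0 := by
  refine hk v (ker_of_sub_posSemidef (c := 1 - ε) hσ (by linarith) ?_ v hv)
  rw [add_sub_cancel_left]
  exact hτ.smul (by exact_mod_cast h0.le)

/-- A single-letter bound on the rotated trace makes the strong converse exponent at most the
value of the tangent line of `log Q̃`. -/
theorem sc_le_of_rotated_le (hρ : IsState ρ) (hS : Assumption1 S) {p r H : ℝ} (hp : 1 < p)
    {σ : Matrix (Fin 1 → Fin d) (Fin 1 → Fin d) ℂ} (hσ : σ ∈ S 1)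
    (hk : ∀ v, σ.mulVec v = 0 → (tpow ρ 1).mulVec v = 0)
    (hH : (p - 1) * r - Real.log (Qsand p (tpow ρ 1) σ) = p * H)
    (htan : ∀ s, 1 < s →
      Qsand p (tpow ρ 1) σ * Real.exp ((r - H) * (s - p)) ≤ Qsand s (tpow ρ 1) σ)
    (hM : ∀ V lam, Diag σ V lam → (∀ i, 0 ≤ lam i) → ∀ n,
      ∀ C : Matrix (Fin n → Fin 1 → Fin d) (Fin n → Fin 1 → Fin d) ℂ, C.PosSemidef →
      rtr (C * rp p (pinch (fun x => ∏ i, lam (x i))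
        (tpowG (V.conjTranspose * Xs p (tpow ρ 1) σ * V) n))) ≤
      rtr (C * pinch (fun x => ∏ i, lam (x i))
        (rp p (tpowG (V.conjTranspose * Xs p (tpow ρ 1) σ * V) n))))
    (h : ∀ t, ∀ τ ∈ S 1, rtr (τ * rotated p (tpow ρ 1) σ t) ≤ Qsand p (tpow ρ 1) σ) :
    scExp r ρ S ≤ (H : EReal) := by
  have := nonempty_of_isState hρ 1
  have hρ1 := tpow_posSemidef hρ.1 1
  have hσp := hS.psd 1 le_rfl σ hσ
  have hpos := Qsand_pos hp hρ1 (tpow_ne_zero hρ 1) hσp hk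
  obtain ⟨V, lam, hd, hlam⟩ := exists_diag_psd hσp
  suffices hε : ∀ ε : ℝ, 0 < ε → scExp r ρ S ≤ ((H + ε : ℝ) : EReal) by
    rw [← EReal.le_of_forall_lt_iff_le]
    intro z hz
    have := hε (z - H) (by have := EReal.coe_lt_coe_iff.1 hz; linarith)
    rwa [add_sub_cancel] at this
  intro ε hε
  have hev : ∀ᶠ n : ℕ in atTop, ∃ T : Matrix (Fin n → Fin d) (Fin n → Fin d) ℂ,
      IsTest T ∧ (∀ τ ∈ S n, rtr (τ * T) ≤ Real.exp (-(n * r))) ∧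
        Real.exp (-(n * (H + ε))) ≤ rtr (T * tpow ρ n) := by
    filter_upwards [exists_test hp hρ1 hσp hk hpos hd hlam hH htan hε, eventually_ge_atTop 1]
      with n hn hn1
    obtain ⟨T, hT, hT1, hT2⟩ := hn
    obtain ⟨e, he1, he2⟩ := exists_reindex (d := d) 1 le_rfl n hn1 n (by ring)
    refine ⟨T.submatrix e e, isTest_submatrix hT e, fun τ hτ => ?_, ?_⟩
    · have hτp := (hS.psd n hn1 τ hτ).submatrix e.symm
      have h1 : rtr (τ * T.submatrix e e) = rtr (τ.submatrix e.symm e.symm * T) := by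
        rw [← rtr_submatrix (τ.submatrix e.symm e.symm * T) e, ← Matrix.submatrix_mul_equiv _ _ _ e,
          Matrix.submatrix_submatrix]
        simp
      rw [h1]
      exact hT1 _ hτp (rtr_test_operator_le hρ1 hσp hd hlam n (hM V lam hd hlam n) hτp fun t =>
        rtr_tpowG_le_of_polar hS (rotated_posSemidef p hρ1 hσp t) hpos (h t) he2 hτ)
    · rwa [he1, Matrix.submatrix_mul_equiv, rtr_submatrix]
  obtain ⟨n₀, hn₀⟩ := eventually_atTop.1 hev
  choose T hT using hn₀
  have hz : ∀ n, IsTest (0 : Matrix (Fin n → Fin d) (Fin n → Fin d) ℂ) := fun n =>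
    ⟨Matrix.PosSemidef.zero, by rw [sub_zero]; exact Matrix.PosSemidef.one⟩
  refine sc_upper hρ r (H + ε) (fun n => if hn : n₀ ≤ n then T n hn else 0) ?_ ?_ ?_
  · intro n
    split_ifs with hn
    exacts [(hT n hn).1, hz n]
  · intro n _
    refine Real.sSup_le ?_ (Real.exp_pos _).le
    rintro _ ⟨τ, hτ, rfl⟩
    dsimp only
    split_ifs with hn
    · exact (hT n hn).2.1 τ hτ
    · simp [rtr, (Real.exp_pos _).le]
  · intro δ hδ
    filter_upwards [eventually_ge_atTop n₀] with n hn
    rw [dif_pos hn]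
    refine le_trans (Real.exp_le_exp.2 ?_) (hT n hn).2.2
    have : (0 : ℝ) ≤ n * δ := by positivity
    nlinarith

/-- If the single-letter value bounds the strong converse exponent from above, then `σ^{⊗N}` is
optimal for every number of copies, along segments towards `τ^{⊗N}`. -/
theorem tensor_min_of_sc_le (hρ : IsState ρ) (hS : Assumption1 S) {p r : ℝ} (hp : 1 < p)
    {σ τ : Matrix (Fin 1 → Fin d) (Fin 1 → Fin d) ℂ} (hσ : σ ∈ S 1) (hτ : τ ∈ S 1)
    (hk : ∀ v, σ.mulVec v = 0 → (tpow ρ 1).mulVec v = 0)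
    (h : scExp r ρ S ≤
      (((p - 1) / p * r - Real.log (Qsand p (tpow ρ 1) σ) / p : ℝ) : EReal))
    {N : ℕ} (hN : 1 ≤ N) {ε : ℝ} (h0 : 0 < ε) (h1 : ε < 1) :
    Qsand p (tpow ρ 1) σ ^ N ≤ Qsand p (tpowG (tpow ρ 1) N)
      (((1 - ε : ℝ) : ℂ) • tpowG σ N + ((ε : ℝ) : ℂ) • tpowG τ N) := by
  have hρ1 := tpow_posSemidef hρ.1 1
  have hσp := hS.psd 1 le_rfl σ hσ
  have hτp := hS.psd 1 le_rfl τ hτ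
  have hpos := Qsand_pos hp hρ1 (tpow_ne_zero hρ 1) hσp hk
  obtain ⟨e, he1, he2⟩ := exists_reindex (d := d) 1 le_rfl N hN N (by ring)
  set ω := ((1 - ε : ℝ) : ℂ) • tpowG σ N + ((ε : ℝ) : ℂ) • tpowG τ N with hω
  have hωp : ω.PosSemidef :=
    ((tpowG_posSemidef hσp N).smul (by exact_mod_cast (by linarith : (0 : ℝ) ≤ 1 - ε))).add
      ((tpowG_posSemidef hτp N).smul (by exact_mod_cast h0.le))
  have hωS : ω.submatrix e e ∈ S N :=
    hS.mix_mem hN (he2 S hS.tens σ hσ) (he2 S hS.tens τ hτ) h0 h1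
  have hρN := tpowG_posSemidef hρ1 N
  have hρN0 : tpowG (tpow ρ 1) N ≠ 0 := fun h => tpow_ne_zero hρ N (by rw [he1, h]; rfl)
  have hkω : ∀ v, ω.mulVec v = 0 → (tpowG (tpow ρ 1) N).mulVec v = 0 :=
    ker_mix (tpowG_posSemidef hσp N) (tpowG_posSemidef hτp N) (ker_tpowG hρ1.1 hσp.1 hk N) h0 h1
  have hωpos := Qsand_pos hp hρN hρN0 hωp hkω
  have hQ : Qsand p (tpow ρ N) (ω.submatrix e e) = Qsand p (tpowG (tpow ρ 1) N) ω := by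
    rw [he1, Qsand_submatrix hp hρN hωp e]
  have hkS : ∀ v, (ω.submatrix e e).mulVec v = 0 → (tpow ρ N).mulVec v = 0 := by
    intro v hv
    rw [Matrix.submatrix_mulVec_equiv] at hv
    rw [he1, Matrix.submatrix_mulVec_equiv]
    have h2 : ω.mulVec (v ∘ e.symm) = 0 := by
      funext x
      simpa using congrFun hv (e.symm x)
    rw [hkω _ h2]; rfl
  have hl := (sc_lower hρ hS r hp hN hωS hkS (by rwa [hQ])).trans h
  rw [EReal.coe_le_coe_iff, hQ] at hl
  have hN0 : (0 : ℝ) < N := by exact_mod_cast hN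
  have hp0 : 0 < p := by linarith
  have h3 : Real.log (Qsand p (tpow ρ 1) σ) / p ≤
      Real.log (Qsand p (tpowG (tpow ρ 1) N) ω) / (p * N) := by linarith
  rw [← Real.log_le_log_iff (pow_pos hpos N) hωpos, Real.log_pow]
  rw [div_le_div_iff₀ hp0 (by positivity)] at h3
  have h4 : p * (N * Real.log (Qsand p (tpow ρ 1) σ)) ≤
      p * Real.log (Qsand p (tpowG (tpow ρ 1) N) ω) := by linarith
  exact le_of_mul_le_mul_left h4 hp0

end SingleLetter

section Objective

variable {κ : Type*} [Fintype κ] [DecidableEq κ]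

theorem scObj_eq {r p : ℝ} (hp : 1 < p) {ρ σ : Matrix κ κ ℂ} (h : msupp ρ ≤ msupp σ) :
    scObj r ρ σ p = (((p - 1) / p * r - Real.log (Qsand p ρ σ) / p : ℝ) : EReal) := by
  rw [scObj, Dsand, if_pos (Or.inr h), ← EReal.coe_sub, ← EReal.coe_mul]
  have h1 : p - 1 ≠ 0 := by linarith
  have h2 : p ≠ 0 := by linarith
  congr 1
  field_simp

theorem scObj_eq_bot {r p : ℝ} (hp : 1 < p) {ρ σ : Matrix κ κ ℂ} (h : ¬ msupp ρ ≤ msupp σ) :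
    scObj r ρ σ p = ⊥ := by
  rw [scObj, Dsand, if_neg, EReal.sub_top, EReal.coe_mul_bot_of_pos]
  · exact div_pos (by linarith) (by linarith)
  · rintro (h1 | h1)
    exacts [absurd h1.1 (by linarith), h h1]

theorem rtr_mul_rotated_zero {p : ℝ} (hp : 1 < p) {ρ σ : Matrix κ κ ℂ} (hρ : ρ.PosSemidef)
    (hσ : σ.PosSemidef) : rtr (σ * rotated p ρ σ 0) = Qsand p ρ σ := by
  have e1 : ∀ z : ℂ, z = ((-(1 / 2) : ℝ) : ℂ) → mpow σ z = rp (-(1 / 2)) σ := by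
    rintro _ rfl
    exact mpow_eq_rp hσ (by norm_num)
  obtain ⟨V, lam, hd, hlam⟩ := exists_diag_psd hσ
  have h1 : rp (-(1 / 2)) σ * σ * rp (-(1 / 2)) σ = fc (fun x => if x = 0 then 0 else 1) σ := by
    nth_rewrite 2 [← rp_one hσ.1]
    rw [rp_mul hσ (by norm_num), rp, rp, hd.fc_mul]
    refine hd.fc_congr fun i => ?_
    rw [← Complex.ofReal_mul]
    rcases (hlam i).eq_or_lt with h | h
    · rw [← h]; norm_num
    · rw [← Real.rpow_add h, if_neg h.ne']; norm_num
  rw [rotated, e1 _ (by push_cast; ring), e1 _ (by push_cast; ring), Qsand_eq hp hρ hσ]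
  calc rtr (σ * (rp (-(1 / 2)) σ * rp p (Xs p ρ σ) * rp (-(1 / 2)) σ))
      = rtr (σ * rp (-(1 / 2)) σ * rp p (Xs p ρ σ) * rp (-(1 / 2)) σ) := by
        simp only [Matrix.mul_assoc]
    _ = rtr (rp (-(1 / 2)) σ * σ * rp (-(1 / 2)) σ * rp p (Xs p ρ σ)) := by
        rw [rtr_mul_comm]; simp only [Matrix.mul_assoc]
    _ = rtr (rp p (Xs p ρ σ)) := by
        rw [h1, supp_mul hd (rp_posSemidef (Xs_posSemidef p hρ hσ) p).1 (ker_rp_Xs hp hρ hσ)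
          fun x hx => if_neg hx]

theorem iSup_rotated_eq_iff {p : ℝ} (hp : 1 < p) {ρ σ : Matrix κ κ ℂ} (hρ : ρ.PosSemidef)
    (hσ : σ.PosSemidef) {F : Set (Matrix κ κ ℂ)} (hσF : σ ∈ F) :
    (⨆ t : ℝ, ⨆ τ ∈ F, ((rtr (τ * rotated p ρ σ t) : ℝ) : EReal)) = ((Qsand p ρ σ : ℝ) : EReal) ↔
      ∀ t, ∀ τ ∈ F, rtr (τ * rotated p ρ σ t) ≤ Qsand p ρ σ := by
  constructor
  · intro h t τ hτ
    rw [← EReal.coe_le_coe_iff, ← h]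
    exact le_iSup_of_le t (le_iSup₂_of_le τ hτ le_rfl)
  · intro h
    refine le_antisymm (iSup_le fun t => iSup₂_le fun τ hτ => EReal.coe_le_coe_iff.2 (h t τ hτ)) ?_
    exact le_iSup_of_le 0 (le_iSup₂_of_le σ hσF (by rw [rtr_mul_rotated_zero hp hρ hσ]))

end Objective

/-- Theorem 37 of the paper: criterion for the strong converse exponent
to be given by the single-letter formula. -/
theorem strong_converse_single_letter {d : ℕ}
    (ρ : Matrix (Fin d) (Fin d) ℂ) (hρ : IsState ρ)
    (S : (n : ℕ) → Set (Matrix (Fin n → Fin d) (Fin n → Fin d) ℂ))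
    (hS : Assumption1 S)
    (hsupp : ∃ τ ∈ S 1, IsState τ ∧ msupp (tpow ρ 1) ≤ msupp τ)
    (hgap : (⨅ σ ∈ S 1, relEnt (tpow ρ 1) σ) < ⨅ σ ∈ S 1, DsandInf (tpow ρ 1) σ)
    (r : ℝ)
    (hrlow : (⨅ σ ∈ S 1, relEnt (tpow ρ 1) σ) < (r : EReal))
    (hrhigh : (r : EReal) <
      ⨆ α ∈ Set.Ici (1 : ℝ),
        (((α : ℝ) : EReal) * (⨅ σ ∈ S 1, DsandInf (tpow ρ 1) σ) -
          ((Real.log (sInf ((fun σ => Qsand α (tpow ρ 1) σ) '' S 1)) : ℝ) : EReal)))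
    (α₀ : ℝ) (hα₀ : 1 < α₀)
    (σ₀ : Matrix (Fin 1 → Fin d) (Fin 1 → Fin d) ℂ) (hσ₀ : σ₀ ∈ S 1)
    (hmax : ∀ α : ℝ, 1 < α → ∀ σ ∈ S 1,
      scObj r (tpow ρ 1) σ α ≤ scObj r (tpow ρ 1) σ₀ α₀) :
    (scExp r ρ S = scObj r (tpow ρ 1) σ₀ α₀ →
      (⨆ t : ℝ, ⨆ τ ∈ S 1,
        ((rtr (τ * (mpow σ₀ (-((1 : ℂ) + Complex.I * (t : ℂ)) / 2) *
          mpow (mpow σ₀ (((1 - α₀) / (2 * α₀) : ℝ) : ℂ) * tpow ρ 1 *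
            mpow σ₀ (((1 - α₀) / (2 * α₀) : ℝ) : ℂ)) ((α₀ : ℝ) : ℂ) *
          mpow σ₀ (-((1 : ℂ) - Complex.I * (t : ℂ)) / 2))) : ℝ) : EReal)) =
        ((Qsand α₀ (tpow ρ 1) σ₀ : ℝ) : EReal)) ∧
    ((⨆ t : ℝ, ⨆ τ ∈ S 1,
        ((rtr (τ * (mpow σ₀ (-((1 : ℂ) + Complex.I * (t : ℂ)) / 2) *
          mpow (mpow σ₀ (((1 - α₀) / (2 * α₀) : ℝ) : ℂ) * tpow ρ 1 *
            mpow σ₀ (((1 - α₀) / (2 * α₀) : ℝ) : ℂ)) ((α₀ : ℝ) : ℂ) *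
          mpow σ₀ (-((1 : ℂ) - Complex.I * (t : ℂ)) / 2))) : ℝ) : EReal)) =
        ((Qsand α₀ (tpow ρ 1) σ₀ : ℝ) : EReal) →
      α₀ ≤ 2 →
      (((r : EReal) < ⨅ σ ∈ S 1, DsandInf (tpow ρ 1) σ) ∨
        (∃ γ : ℝ, HasDerivAt (fun α : ℝ => Real.log (Qsand α (tpow ρ 1) σ₀)) γ α₀ ∧
          (γ : EReal) < DsandInf (tpow ρ 1) σ₀)) →
      scExp r ρ S = scObj r (tpow ρ 1) σ₀ α₀) ∧
    (tpow ρ 1 * σ₀ = σ₀ * tpow ρ 1 →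
      ((⨆ t : ℝ, ⨆ τ ∈ S 1,
        ((rtr (τ * (mpow σ₀ (-((1 : ℂ) + Complex.I * (t : ℂ)) / 2) *
          mpow (mpow σ₀ (((1 - α₀) / (2 * α₀) : ℝ) : ℂ) * tpow ρ 1 *
            mpow σ₀ (((1 - α₀) / (2 * α₀) : ℝ) : ℂ)) ((α₀ : ℝ) : ℂ) *
          mpow σ₀ (-((1 : ℂ) - Complex.I * (t : ℂ)) / 2))) : ℝ) : EReal)) =
        ((Qsand α₀ (tpow ρ 1) σ₀ : ℝ) : EReal)) ∧
      scExp r ρ S = scObj r (tpow ρ 1) σ₀ α₀) := by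
  have hα0 : α₀ ≠ 0 := by linarith
  have hρ1 := tpow_posSemidef hρ.1 1
  have hσp := hS.psd 1 le_rfl σ₀ hσ₀
  have hms : msupp (tpow ρ 1) ≤ msupp σ₀ := by
    obtain ⟨τ, hτS, -, hτ⟩ := hsupp
    by_contra h
    have := hmax α₀ hα₀ τ hτS
    rw [scObj_eq_bot hα₀ h, scObj_eq hα₀ hτ, le_bot_iff] at this
    exact EReal.coe_ne_bot _ this
  have hk := ker_of_msupp_le hρ1.1 hσp.1 hms
  have hpos := fun {s : ℝ} (hs : 1 < s) => Qsand_pos hs hρ1 (tpow_ne_zero hρ 1) hσp hk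
  simp only [mpow_sand hα₀ hρ1 hσp]
  have hobj := scObj_eq (r := r) hα₀ hms
  have hsup := iSup_rotated_eq_iff hα₀ hρ1 hσp hσ₀
  simp only [rotated] at hsup
  rw [hsup, hobj]
  simp only [hobj] at hmax
  set H := (α₀ - 1) / α₀ * r - Real.log (Qsand α₀ (tpow ρ 1) σ₀) / α₀ with hHd
  have hH : (α₀ - 1) * r - Real.log (Qsand α₀ (tpow ρ 1) σ₀) = α₀ * H := by
    rw [hHd]; field_simp
  have htan : ∀ s, 1 < s → Qsand α₀ (tpow ρ 1) σ₀ * Real.exp ((r - H) * (s - α₀)) ≤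
      Qsand s (tpow ρ 1) σ₀ := by
    intro s hs
    have h1 := hmax s hs σ₀ hσ₀
    rw [scObj_eq hs hms, EReal.coe_le_coe_iff] at h1
    have hs0 : 0 < s := by linarith
    have h2 : (s - 1) * r - Real.log (Qsand s (tpow ρ 1) σ₀) ≤ s * H := by
      have h3 : (s - 1) * r - Real.log (Qsand s (tpow ρ 1) σ₀) =
          s * ((s - 1) / s * r - Real.log (Qsand s (tpow ρ 1) σ₀) / s) := by field_simp
      rw [h3]
      exact mul_le_mul_of_nonneg_left h1 hs0.le
    rw [← Real.log_le_log_iff (mul_pos (hpos hα₀) (Real.exp_pos _)) (hpos hs),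
      Real.log_mul (hpos hα₀).ne' (Real.exp_pos _).ne', Real.log_exp]
    linarith
  have hlow : (H : EReal) ≤ scExp r ρ S := by
    have := sc_lower hρ hS r hα₀ le_rfl hσ₀ hk (hpos hα₀)
    simpa only [Nat.cast_one, mul_one] using this
  refine ⟨fun h t τ hτ => ?_, fun h hα₂ _ => ?_, fun hcomm => ?_⟩
  · exact rtr_rotated_le_of_tensor_min hα₀ hρ1 hσp (hS.psd 1 le_rfl τ hτ) hk (hpos hα₀)
      (fun N hN ε h0 h1 => tensor_min_of_sc_le hρ hS hα₀ hσ₀ hτ hk h.le hN h0 h1) t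
  · refine le_antisymm (sc_le_of_rotated_le hρ hS hα₀ hσ₀ hk hH htan ?_ h) hlow
    intro V lam _ _ n C hC
    exact pinched_power_of_le_two hα₀ hα₂ _ (tpowG_posSemidef
      ((Xs_posSemidef α₀ hρ1 hσp).conjTranspose_mul_mul_same V) n) C hC
  · have hrot : ∀ t, ∀ τ ∈ S 1, rtr (τ * rotated α₀ (tpow ρ 1) σ₀ t) ≤
        Qsand α₀ (tpow ρ 1) σ₀ := by
      intro t τ hτ
      refine rtr_rotated_le_of_comm hα₀ hρ1 hσp (hS.psd 1 le_rfl τ hτ) hcomm hk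
        (fun ε h0 h1 => ?_) t
      have hωS := hS.mix_mem le_rfl hσ₀ hτ h0 h1
      have hωp := hS.psd 1 le_rfl _ hωS
      have hkω := ker_mix hσp (hS.psd 1 le_rfl τ hτ) hk h0 h1
      have h2 := hmax α₀ hα₀ _ hωS
      rw [scObj_eq hα₀ (msupp_le_of_ker hρ1.1 hωp.1 hkω), EReal.coe_le_coe_iff, hHd,
        sub_le_sub_iff_left, div_le_div_iff_of_pos_right (by linarith)] at h2
      exact (Real.log_le_log_iff (hpos hα₀)
        (Qsand_pos hα₀ hρ1 (tpow_ne_zero hρ 1) hωp hkω)).1 h2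
    refine ⟨hrot, le_antisymm (sc_le_of_rotated_le hρ hS hα₀ hσ₀ hk hH htan ?_ hrot) hlow⟩
    intro V lam hd _ n C _
    exact pinched_power_of_commute ((Xs_posSemidef α₀ hρ1 hσp).conjTranspose_mul_mul_same V)
      (diagonal_mul_conj_comm hd (mul_Xs_comm α₀ hσp hcomm)) n C

end QHT
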